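/- There exists a constant C > 0, depending only on T, α, β, K and δ, such that for every classical solution (v,u,θ,w,b) of the planar compressible MHD system on ℝ × [0,T] with (K,δ)-admissible initial data, one has θ(x,t) ≤ C for all (x,t) ∈ ℝ × [0,T]. -/

import Mathlib

open MeasureTheory Set Filter

noncomputable section

/-- Viscosity function `μ(z) = 1 + α z^(−α)` (here `μ̃₁ = 1`, `μ̃₂ = α`). -/
def visc (α z : ℝ) : ℝ := 1 + α * z ^ (-α)

/-- Squared Euclidean norm on `ℝ × ℝ` (used for the transverse fields `w, b ∈ ℝ²`). -/
def sq2 (p : ℝ × ℝ) : ℝ := p.1 ^ 2 + p.2 ^ 2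

/-- Partial derivative with respect to the first (spatial) variable. -/
def pdx {E : Type*} [NormedAddCommGroup E] [NormedSpace ℝ E]
    (f : ℝ → ℝ → E) (x t : ℝ) : E := deriv (fun y => f y t) x

/-- Partial derivative with respect to the second (time) variable, taken within `[0, T]`
(so it is one-sided at the endpoints). -/
def pdt (T : ℝ) {E : Type*} [NormedAddCommGroup E] [NormedSpace ℝ E]
    (f : ℝ → ℝ → E) (x t : ℝ) : E := derivWithin (fun s => f x s) (Icc 0 T) t

/-- A classical solution of the planar compressible MHD system (in Lagrangian coordinates,
with all physical constants normalized to `1` and `μ̃₂ = α`) on `ℝ × [0,T]`: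
all the derivatives appearing in the equations exist and are continuous, `v, θ > 0`,
the five equations hold pointwise, the solution tends to `(1,0,1,0,0)` as `|x| → ∞`
uniformly in `t ∈ [0,T]`, and `v−1, u, θ−1, b, w` and their first spatial derivatives
are square-integrable in `x` for each `t ∈ [0,T]`. -/
structure IsClassicalSolution (α β T : ℝ) (v u θ : ℝ → ℝ → ℝ)
    (w b : ℝ → ℝ → ℝ × ℝ) : Prop where
  v_pos : ∀ x : ℝ, ∀ t ∈ Icc (0:ℝ) T, 0 < v x t
  θ_pos : ∀ x : ℝ, ∀ t ∈ Icc (0:ℝ) T, 0 < θ x t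
  diff_x : ∀ x : ℝ, ∀ t ∈ Icc (0:ℝ) T,
    DifferentiableAt ℝ (fun y => v y t) x ∧ DifferentiableAt ℝ (fun y => u y t) x ∧
    DifferentiableAt ℝ (fun y => θ y t) x ∧ DifferentiableAt ℝ (fun y => w y t) x ∧
    DifferentiableAt ℝ (fun y => b y t) x
  diff_xx : ∀ x : ℝ, ∀ t ∈ Icc (0:ℝ) T,
    DifferentiableAt ℝ (fun y => pdx u y t) x ∧ DifferentiableAt ℝ (fun y => pdx θ y t) x ∧
    DifferentiableAt ℝ (fun y => pdx w y t) x ∧ DifferentiableAt ℝ (fun y => pdx b y t) x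
  diff_t : ∀ x : ℝ, ∀ t ∈ Icc (0:ℝ) T,
    DifferentiableWithinAt ℝ (fun s => v x s) (Icc 0 T) t ∧
    DifferentiableWithinAt ℝ (fun s => u x s) (Icc 0 T) t ∧
    DifferentiableWithinAt ℝ (fun s => θ x s) (Icc 0 T) t ∧
    DifferentiableWithinAt ℝ (fun s => w x s) (Icc 0 T) t ∧
    DifferentiableWithinAt ℝ (fun s => b x s) (Icc 0 T) t
  cont : ContinuousOn (fun p : ℝ × ℝ =>
      (v p.1 p.2, u p.1 p.2, θ p.1 p.2, w p.1 p.2, b p.1 p.2)) (univ ×ˢ Icc 0 T)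
  cont_dx : ContinuousOn (fun p : ℝ × ℝ =>
      (pdx v p.1 p.2, pdx u p.1 p.2, pdx θ p.1 p.2, pdx w p.1 p.2, pdx b p.1 p.2))
      (univ ×ˢ Icc 0 T)
  cont_dxx : ContinuousOn (fun p : ℝ × ℝ =>
      (pdx (pdx u) p.1 p.2, pdx (pdx θ) p.1 p.2, pdx (pdx w) p.1 p.2, pdx (pdx b) p.1 p.2))
      (univ ×ˢ Icc 0 T)
  cont_dt : ContinuousOn (fun p : ℝ × ℝ =>
      (pdt T v p.1 p.2, pdt T u p.1 p.2, pdt T θ p.1 p.2, pdt T w p.1 p.2, pdt T b p.1 p.2))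
      (univ ×ˢ Icc 0 T)
  eq_mass : ∀ x : ℝ, ∀ t ∈ Icc (0:ℝ) T, pdt T v x t = pdx u x t
  eq_mom : ∀ x : ℝ, ∀ t ∈ Icc (0:ℝ) T,
    pdt T u x t + pdx (fun y s => θ y s / v y s + sq2 (b y s) / 2) x t
      = pdx (fun y s => visc α (v y s) * pdx u y s / v y s) x t
  eq_w : ∀ x : ℝ, ∀ t ∈ Icc (0:ℝ) T,
    pdt T w x t - pdx b x t = pdx (fun y s => (v y s)⁻¹ • pdx w y s) x t
  eq_b : ∀ x : ℝ, ∀ t ∈ Icc (0:ℝ) T,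
    pdt T (fun y s => v y s • b y s) x t - pdx w x t
      = pdx (fun y s => (v y s)⁻¹ • pdx b y s) x t
  eq_temp : ∀ x : ℝ, ∀ t ∈ Icc (0:ℝ) T,
    pdt T θ x t + θ x t / v x t * pdx u x t
      = pdx (fun y s => θ y s ^ β * pdx θ y s / v y s) x t
        + (visc α (v x t) * pdx u x t ^ 2 + sq2 (pdx w x t) + sq2 (pdx b x t)) / v x t
  farfield : ∀ ε > (0:ℝ), ∃ M : ℝ, ∀ x : ℝ, ∀ t ∈ Icc (0:ℝ) T, M ≤ |x| →
    |v x t - 1| < ε ∧ |u x t| < ε ∧ |θ x t - 1| < ε ∧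
    Real.sqrt (sq2 (b x t)) < ε ∧ Real.sqrt (sq2 (w x t)) < ε
  sq_int : ∀ t ∈ Icc (0:ℝ) T,
    Integrable (fun x => (v x t - 1) ^ 2) ∧ Integrable (fun x => (u x t) ^ 2) ∧
    Integrable (fun x => (θ x t - 1) ^ 2) ∧ Integrable (fun x => sq2 (b x t)) ∧
    Integrable (fun x => sq2 (w x t)) ∧
    Integrable (fun x => (pdx v x t) ^ 2) ∧ Integrable (fun x => (pdx u x t) ^ 2) ∧
    Integrable (fun x => (pdx θ x t) ^ 2) ∧ Integrable (fun x => sq2 (pdx b x t)) ∧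
    Integrable (fun x => sq2 (pdx w x t))

/-- The initial data of a solution are `(K, δ)`-admissible: the `H¹`-type norm of
`(v₀−1, u₀, θ₀−1, b₀, w₀)` is at most `K²` and `v₀ ≥ δ`, `θ₀ ≥ δ`. -/
def Admissible (K δ : ℝ) (v u θ : ℝ → ℝ → ℝ) (w b : ℝ → ℝ → ℝ × ℝ) : Prop :=
  (∫ x : ℝ, ((v x 0 - 1) ^ 2 + (u x 0) ^ 2 + (θ x 0 - 1) ^ 2 + sq2 (b x 0) + sq2 (w x 0)
      + (pdx v x 0) ^ 2 + (pdx u x 0) ^ 2 + (pdx θ x 0) ^ 2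
      + sq2 (pdx b x 0) + sq2 (pdx w x 0))) ≤ K ^ 2 ∧
  (∀ x : ℝ, δ ≤ v x 0) ∧ (∀ x : ℝ, δ ≤ θ x 0)

section Calculus

theorem intervalIntegral_mono_of_continuous {a b : ℝ} (hab : a ≤ b) {f g : ℝ → ℝ}
    (hf : Continuous f) (hg : Continuous g) (h : ∀ x ∈ Icc a b, f x ≤ g x) :
    ∫ x in a..b, f x ≤ ∫ x in a..b, g x :=
  intervalIntegral.integral_mono_on hab (hf.intervalIntegrable _ _) (hg.intervalIntegrable _ _) h

theorem intervalIntegral_le_linear_comb {ι : Type*} (s : Finset ι) {a b : ℝ} (hab : a ≤ b)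
    {f : ℝ → ℝ} {g : ι → ℝ → ℝ} {c : ι → ℝ}
    (hf : Continuous f) (hg : ∀ i, Continuous (g i))
    (h : ∀ x ∈ Icc a b, f x ≤ ∑ i ∈ s, c i * g i x) :
    ∫ x in a..b, f x ≤ ∑ i ∈ s, c i * ∫ x in a..b, g i x := by
  refine (intervalIntegral_mono_of_continuous hab hf (by fun_prop) h).trans_eq ?_
  rw [intervalIntegral.integral_finsetSum]
  · simp
  · intro i _
    exact (continuous_const.mul (hg i)).intervalIntegrable _ _

theorem intervalIntegral_le_comb₂ {a b c₁ c₂ : ℝ} (hab : a ≤ b) {f g₁ g₂ : ℝ → ℝ}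
    (hf : Continuous f) (h₁ : Continuous g₁) (h₂ : Continuous g₂)
    (h : ∀ x ∈ Icc a b, f x ≤ c₁ * g₁ x + c₂ * g₂ x) :
    ∫ x in a..b, f x ≤ c₁ * (∫ x in a..b, g₁ x) + c₂ * ∫ x in a..b, g₂ x := by
  have := intervalIntegral_le_linear_comb (Finset.univ : Finset (Fin 2)) hab (g := ![g₁, g₂])
    (c := ![c₁, c₂]) hf (by intro i; fin_cases i <;> assumption)
    (by intro x hx; simpa [Fin.sum_univ_succ] using h x hx)
  simpa [Fin.sum_univ_succ] using this

theorem intervalIntegral_le_comb₃ {a b c₁ c₂ c₃ : ℝ} (hab : a ≤ b) {f g₁ g₂ g₃ : ℝ → ℝ}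
    (hf : Continuous f) (h₁ : Continuous g₁) (h₂ : Continuous g₂) (h₃ : Continuous g₃)
    (h : ∀ x ∈ Icc a b, f x ≤ c₁ * g₁ x + c₂ * g₂ x + c₃ * g₃ x) :
    ∫ x in a..b, f x ≤ c₁ * (∫ x in a..b, g₁ x) + c₂ * (∫ x in a..b, g₂ x)
      + c₃ * ∫ x in a..b, g₃ x := by
  have := intervalIntegral_le_linear_comb (Finset.univ : Finset (Fin 3)) hab (g := ![g₁, g₂, g₃])
    (c := ![c₁, c₂, c₃]) hf (by intro i; fin_cases i <;> assumption)
    (by intro x hx; simpa [Fin.sum_univ_succ, add_assoc] using h x hx)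
  simpa [Fin.sum_univ_succ, add_assoc] using this

theorem hasDerivAt_integral_of_continuous {T a b : ℝ} {f g : ℝ → ℝ → ℝ}
    (hf : Continuous fun p : ℝ × ℝ => f p.1 p.2) (hg : Continuous fun p : ℝ × ℝ => g p.1 p.2)
    (h : ∀ x, ∀ t ∈ Ioo 0 T, HasDerivAt (fun s => f x s) (g x t) t) {t : ℝ} (ht : t ∈ Ioo 0 T) :
    HasDerivAt (fun s => ∫ x in a..b, f x s) (∫ x in a..b, g x t) t := by
  obtain ⟨C, hC⟩ := (isCompact_uIcc (a := a) (b := b)).prod (isCompact_Icc (a := 0) (b := T))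
    |>.exists_bound_of_continuousOn hg.continuousOn
  refine (intervalIntegral.hasDerivAt_integral_of_dominated_loc_of_deriv_le
    (F := fun s x => f x s) (F' := fun s x => g x s) (bound := fun _ => C)
    (s := Ioo 0 T) (Ioo_mem_nhds ht.1 ht.2) ?_ ?_ ?_ ?_ ?_ ?_).2
  · exact Eventually.of_forall fun s => Continuous.aestronglyMeasurable (by fun_prop)
  · exact Continuous.intervalIntegrable (by fun_prop) _ _
  · exact Continuous.aestronglyMeasurable (by fun_prop)
  · exact Eventually.of_forall fun x hx s hs =>
      hC (x, s) ⟨uIoc_subset_uIcc hx, Ioo_subset_Icc_self hs⟩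
  · exact continuous_const.intervalIntegrable _ _
  · exact Eventually.of_forall fun x _ s hs => h x s hs

/-- Differentiating a weighted Dirichlet integral in time, without assuming that the mixed
derivative exists. -/
theorem hasDerivAt_weighted_dirichlet {T a b : ℝ} {φ φ' : ℝ → ℝ} {f fx fxx ft : ℝ → ℝ → ℝ}
    (hφ : ∀ x, HasDerivAt φ (φ' x) x) (hφ' : Continuous φ') (ha : φ a = 0) (hb : φ b = 0)
    (hfx : Continuous fun p : ℝ × ℝ => fx p.1 p.2)
    (hfxx : Continuous fun p : ℝ × ℝ => fxx p.1 p.2)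
    (hft : Continuous fun p : ℝ × ℝ => ft p.1 p.2)
    (h1 : ∀ x t, HasDerivAt (fun y => f y t) (fx x t) x)
    (h2 : ∀ x t, HasDerivAt (fun y => fx y t) (fxx x t) x)
    (h3 : ∀ x, ∀ t ∈ Ioo 0 T, HasDerivAt (fun s => f x s) (ft x t) t)
    {t : ℝ} (ht : t ∈ Ioo 0 T) :
    HasDerivAt (fun s => ∫ x in a..b, φ x * fx x s ^ 2)
      (∫ x in a..b, -2 * (φ' x * fx x t + φ x * fxx x t) * ft x t) t := by
  have hφc : Continuous φ := continuous_iff_continuousAt.2 fun x => (hφ x).continuousAt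
  set k : ℝ → ℝ → ℝ := fun x s => ∫ τ in (0:ℝ)..1, ft x (t + τ * (s - t)) with hk
  have hkc : Continuous fun p : ℝ × ℝ => k p.1 p.2 := by
    simp only [hk]
    fun_prop
  have hfk : ∀ x, ∀ s ∈ Ioo 0 T, f x s - f x t = (s - t) * k x s := by
    intro x s hs
    have hd : ∀ τ ∈ uIcc (0:ℝ) 1, HasDerivAt (fun τ => f x (t + τ * (s - t)))
        (ft x (t + τ * (s - t)) * (s - t)) τ := by
      intro τ hτ
      rw [uIcc_of_le zero_le_one] at hτ
      have hmem : t + τ * (s - t) ∈ Ioo 0 T := by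
        have := (convex_Ioo (0:ℝ) T) ht hs (a := 1 - τ) (b := τ) (by linarith [hτ.2]) hτ.1 (by ring)
        simp only [smul_eq_mul] at this
        convert this using 1
        ring
      have hl : HasDerivAt (fun τ : ℝ => t + τ * (s - t)) (s - t) τ := by
        simpa using ((hasDerivAt_id τ).mul_const (s - t)).const_add t
      exact (h3 x _ hmem).comp τ hl
    have := intervalIntegral.integral_eq_sub_of_hasDerivAt hd
      (Continuous.intervalIntegrable (by fun_prop) _ _)
    simp only [intervalIntegral.integral_mul_const] at this
    simp only [hk, one_mul, zero_mul, add_zero] at this ⊢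
    rw [show t + (s - t) = s by ring] at this
    linarith
  set K : ℝ → ℝ := fun s => ∫ x in a..b,
    -(φ' x * (fx x s + fx x t) + φ x * (fxx x s + fxx x t)) * k x s with hK
  have hKc : Continuous K := by
    simp only [hK]
    fun_prop
  have hIK : ∀ s ∈ Ioo 0 T, (∫ x in a..b, φ x * fx x s ^ 2) - (∫ x in a..b, φ x * fx x t ^ 2)
      = (s - t) * K s := by
    intro s hs
    have hd : ∀ x ∈ uIcc a b, HasDerivAt
        (fun x => φ x * (fx x s + fx x t) * (f x s - f x t))
        ((φ x * fx x s ^ 2 - φ x * fx x t ^ 2)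
          - (s - t) * (-(φ' x * (fx x s + fx x t) + φ x * (fxx x s + fxx x t)) * k x s)) x := by
      intro x _
      refine (((hφ x).mul ((h2 x s).add (h2 x t))).mul ((h1 x s).sub (h1 x t))).congr_deriv ?_
      simp only [Pi.add_apply, Pi.mul_apply, Pi.sub_apply]
      rw [hfk x s hs]
      ring
    have := intervalIntegral.integral_eq_sub_of_hasDerivAt hd
      (Continuous.intervalIntegrable (by fun_prop) _ _)
    rw [intervalIntegral.integral_sub (Continuous.intervalIntegrable (by fun_prop) _ _)
      (Continuous.intervalIntegrable (by fun_prop) _ _),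
      intervalIntegral.integral_sub (Continuous.intervalIntegrable (by fun_prop) _ _)
      (Continuous.intervalIntegrable (by fun_prop) _ _),
      intervalIntegral.integral_const_mul] at this
    simp only [ha, hb, zero_mul, sub_zero] at this
    simp only [hK]
    linarith
  have hKt : K t = ∫ x in a..b, -2 * (φ' x * fx x t + φ x * fxx x t) * ft x t := by
    simp only [hK]
    refine intervalIntegral.integral_congr fun x _ => ?_
    simp only [hk, sub_self, mul_zero, add_zero, intervalIntegral.integral_const, sub_zero,
      one_smul]
    ring
  rw [← hKt, hasDerivAt_iff_tendsto_slope]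
  refine ((hKc.tendsto t).mono_left nhdsWithin_le_nhds).congr' ?_
  have h4 : ∀ᶠ s in nhdsWithin t {t}ᶜ, s ∈ Ioo 0 T :=
    nhdsWithin_le_nhds (Ioo_mem_nhds ht.1 ht.2)
  filter_upwards [h4, self_mem_nhdsWithin] with s hs hne
  have : s - t ≠ 0 := sub_ne_zero.2 hne
  rw [slope_def_field, hIK s hs]
  field_simp

theorem gronwall_with_dissipation {T A B : ℝ} {y y' z a g : ℝ → ℝ} (hT : 0 < T)
    (hy : Continuous y) (hz : Continuous z) (ha : Continuous a) (hg : Continuous g)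
    (hd : ∀ t ∈ Ioo 0 T, HasDerivAt y (y' t) t)
    (h : ∀ t ∈ Ioo 0 T, y' t + z t ≤ a t * y t + g t)
    (hz0 : ∀ t, 0 ≤ z t) (ha0 : ∀ t, 0 ≤ a t) (hg0 : ∀ t, 0 ≤ g t) (hy0 : 0 ≤ y 0)
    (hA : ∫ t in (0:ℝ)..T, a t ≤ A) (hB : ∫ t in (0:ℝ)..T, g t ≤ B) :
    ∀ t ∈ Icc 0 T, y t + ∫ s in (0:ℝ)..t, z s ≤ Real.exp A * (y 0 + B) := by
  have prim : ∀ {f : ℝ → ℝ}, Continuous f → ∀ t, HasDerivAt (fun t => ∫ s in (0:ℝ)..t, f s) (f t) t :=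
    fun hf t => hf.integral_hasStrictDerivAt 0 t |>.hasDerivAt
  have mono : ∀ {f : ℝ → ℝ}, Continuous f → (∀ t, 0 ≤ f t) → ∀ {s t : ℝ}, s ≤ t →
      ∫ r in (0:ℝ)..s, f r ≤ ∫ r in (0:ℝ)..t, f r := by
    intro f hf h0 s t hst
    rw [← sub_nonneg, intervalIntegral.integral_interval_sub_left (hf.intervalIntegrable _ _)
      (hf.intervalIntegrable _ _)]
    exact intervalIntegral.integral_nonneg hst fun r _ => h0 r
  have nn : ∀ {f : ℝ → ℝ}, (∀ t, 0 ≤ f t) → ∀ {t : ℝ}, 0 ≤ t → 0 ≤ ∫ r in (0:ℝ)..t, f r :=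
    fun h0 _ ht => intervalIntegral.integral_nonneg ht fun r _ => h0 r
  set W : ℝ → ℝ := fun t => (y t + ∫ s in (0:ℝ)..t, z s) * Real.exp (-∫ s in (0:ℝ)..t, a s)
    - ∫ s in (0:ℝ)..t, g s with hW
  have hWd : ∀ t ∈ Ioo 0 T, HasDerivAt W ((y' t + z t) * Real.exp (-∫ s in (0:ℝ)..t, a s)
      + (y t + ∫ s in (0:ℝ)..t, z s) * (Real.exp (-∫ s in (0:ℝ)..t, a s) * (-a t)) - g t) t :=
    fun t ht => (((hd t ht).add (prim hz t)).mul (prim ha t).neg.exp).sub (prim hg t)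
  have hWc : Continuous W := by
    have p : ∀ {f : ℝ → ℝ}, Continuous f → Continuous fun t => ∫ s in (0:ℝ)..t, f s :=
      fun hf => continuous_iff_continuousAt.2 fun t => (prim hf t).continuousAt
    exact ((hy.add (p hz)).mul (p ha).neg.rexp).sub (p hg)
  have hanti : AntitoneOn W (Icc 0 T) := by
    refine antitoneOn_of_deriv_nonpos (convex_Icc 0 T) hWc.continuousOn ?_ ?_
    · intro t ht
      rw [interior_Icc] at ht
      exact (hWd t ht).differentiableAt.differentiableWithinAt
    · intro t ht
      rw [interior_Icc] at ht
      rw [(hWd t ht).deriv]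
      have e1 : Real.exp (-∫ s in (0:ℝ)..t, a s) ≤ 1 := by
        rw [Real.exp_le_one_iff]
        linarith [nn ha0 ht.1.le]
      have e0 := Real.exp_pos (-∫ s in (0:ℝ)..t, a s)
      have hzt := nn hz0 ht.1.le
      have := h t ht
      have h5 : y' t + z t - a t * (y t + ∫ s in (0:ℝ)..t, z s) ≤ g t := by
        nlinarith [mul_nonneg (ha0 t) hzt]
      nlinarith [mul_le_mul_of_nonneg_right h5 e0.le, mul_le_mul_of_nonneg_left e1 (hg0 t)]
  intro t ht
  have h6 := hanti (left_mem_Icc.2 hT.le) ht ht.1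
  simp only [hW, intervalIntegral.integral_same, add_zero, neg_zero, Real.exp_zero, mul_one,
    sub_zero] at h6
  have h7 := (mono hg hg0 ht.2).trans hB
  have h8 := (mono ha ha0 ht.2).trans hA
  have h9 : (y t + ∫ s in (0:ℝ)..t, z s) * Real.exp (-∫ s in (0:ℝ)..t, a s) ≤ y 0 + B := by linarith
  have hB0 : 0 ≤ B := (nn hg0 hT.le).trans hB
  have e0 := Real.exp_pos (∫ s in (0:ℝ)..t, a s)
  calc y t + ∫ s in (0:ℝ)..t, z s
      = (y t + ∫ s in (0:ℝ)..t, z s) * Real.exp (-∫ s in (0:ℝ)..t, a s)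
          * Real.exp (∫ s in (0:ℝ)..t, a s) := by
        rw [mul_assoc, ← Real.exp_add]; simp
    _ ≤ (y 0 + B) * Real.exp (∫ s in (0:ℝ)..t, a s) := by gcongr
    _ ≤ (y 0 + B) * Real.exp A := by
        have : 0 ≤ y 0 + B := by linarith
        gcongr
    _ = _ := mul_comm _ _

theorem exists_le_of_integral_unit_le {f : ℝ → ℝ} (hf : Continuous f) {a C : ℝ}
    (h : ∫ x in a..(a + 1), f x ≤ C) : ∃ y ∈ Icc a (a + 1), f y ≤ C := by
  by_contra! hc
  obtain ⟨m, hm, hmin⟩ := isCompact_Icc.exists_isMinOn (nonempty_Icc.2 (by linarith : a ≤ a + 1))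
    hf.continuousOn
  have := intervalIntegral_mono_of_continuous (by linarith : a ≤ a + 1) continuous_const hf
    (fun x hx => hmin hx)
  simp only [intervalIntegral.integral_const, add_sub_cancel_left, one_smul] at this
  linarith [hc m hm]

theorem nonneg_of_barrier {T R : ℝ} {f ft : ℝ → ℝ → ℝ}
    (hf : Continuous fun p : ℝ × ℝ => f p.1 p.2) (h0 : ∀ x, 0 < f x 0)
    (hR : ∀ x, ∀ t ∈ Icc 0 T, R ≤ |x| → 0 < f x t)
    (hd : ∀ x, ∀ t ∈ Ioo 0 T, HasDerivAt (fun s => f x s) (ft x t) t)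
    (hkey : ∀ x, ∀ t ∈ Ioo 0 T, f x t = 0 → (∀ y, 0 ≤ f y t) → 0 < ft x t) :
    ∀ x, ∀ t ∈ Ico 0 T, 0 ≤ f x t := by
  by_contra! hc
  obtain ⟨x₁, t₁, ht₁, hneg⟩ := hc
  set K : Set (ℝ × ℝ) := (Icc (-R) R ×ˢ Icc 0 t₁) ∩ {p | f p.1 p.2 ≤ 0} with hK
  have hKc : IsCompact K :=
    (isCompact_Icc.prod isCompact_Icc).inter_right (isClosed_le hf continuous_const)
  have hin : ∀ x, ∀ t ∈ Icc 0 T, f x t ≤ 0 → x ∈ Icc (-R) R := by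
    intro x t ht hx
    have : ¬ R ≤ |x| := fun h => (hR x t ht h).not_ge hx
    exact abs_le.1 (not_le.1 this).le
  have hne : K.Nonempty :=
    ⟨(x₁, t₁), ⟨hin x₁ t₁ ⟨ht₁.1, ht₁.2.le⟩ hneg.le, ⟨ht₁.1, le_rfl⟩⟩, hneg.le⟩
  obtain ⟨⟨x, t⟩, ⟨⟨hx, ht⟩, hft0⟩, hmin⟩ := hKc.exists_isMinOn hne continuous_snd.continuousOn
  simp only [mem_ofPred_eq] at hx ht hft0
  have htpos : 0 < t := by
    rcases ht.1.eq_or_lt with h | h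
    · exact absurd (h0 x) (by subst h; exact hft0.not_gt)
    · exact h
  have htT : t ∈ Ioo 0 T := ⟨htpos, ht.2.trans_lt ht₁.2⟩
  have hpos : ∀ y, ∀ s ∈ Ico 0 t, 0 < f y s := by
    intro y s hs
    by_contra! hle
    have hsT : s ∈ Icc 0 T := ⟨hs.1, hs.2.le.trans htT.2.le⟩
    have : (y, s) ∈ K := ⟨⟨hin y s hsT hle, ⟨hs.1, hs.2.le.trans ht.2⟩⟩, hle⟩
    have := hmin this
    simp only [mem_ofPred_eq] at this
    linarith [hs.2]
  have hev : ∀ᶠ s in nhdsWithin t (Iio t), s ∈ Ico 0 t := by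
    filter_upwards [Ioo_mem_nhdsLT htpos] with s hs using ⟨hs.1.le, hs.2⟩
  have hnn : ∀ y, 0 ≤ f y t := by
    intro y
    have hcy : Continuous fun s => f y s := hf.comp (by fun_prop : Continuous fun s => (y, s))
    refine ge_of_tendsto ((hcy.tendsto t).mono_left (nhdsWithin_le_nhds (s := Iio t))) ?_
    filter_upwards [hev] with s hs using (hpos y s hs).le
  have hz : f x t = 0 := le_antisymm hft0 (hnn x)
  have hder := hkey x t htT hz hnn
  have hs : Tendsto (slope (fun s => f x s) t) (nhdsWithin t (Iio t)) (nhds (ft x t)) :=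
    (hasDerivAt_iff_tendsto_slope.1 (hd x t htT)).mono_left
      (nhdsWithin_mono _ fun s (hs : s < t) => hs.ne)
  have : ft x t ≤ 0 := by
    refine le_of_tendsto hs ?_
    filter_upwards [hev] with s hs
    rw [slope_def_field, hz, sub_zero]
    exact div_nonpos_of_nonneg_of_nonpos (hpos x s hs).le (by linarith [hs.2])
  linarith

end Calculus

section Cutoff

/-- The cutoff `(1 - x² / R²)²`, used on `[-R, R]`. -/
def cutoff (R x : ℝ) : ℝ := (1 - x ^ 2 / R ^ 2) ^ 2

/-- The derivative of `cutoff R`. -/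
def cutoffDeriv (R x : ℝ) : ℝ := -(4 * x / R ^ 2) * (1 - x ^ 2 / R ^ 2)

theorem hasDerivAt_cutoff (R x : ℝ) : HasDerivAt (cutoff R) (cutoffDeriv R x) x := by
  unfold cutoff cutoffDeriv
  refine ((((hasDerivAt_pow 2 x).div_const (R ^ 2)).const_sub 1).pow 2).congr_deriv ?_
  ring

@[fun_prop]
theorem continuous_cutoff (R : ℝ) : Continuous (cutoff R) := by unfold cutoff; fun_prop

@[fun_prop]
theorem continuous_cutoffDeriv (R : ℝ) : Continuous (cutoffDeriv R) := by
  unfold cutoffDeriv; fun_prop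

theorem cutoff_nonneg (R x : ℝ) : 0 ≤ cutoff R x := sq_nonneg _

theorem cutoff_right {R : ℝ} (hR : 0 < R) : cutoff R R = 0 := by
  unfold cutoff; rw [div_self (by positivity)]; norm_num

theorem cutoff_left {R : ℝ} (hR : 0 < R) : cutoff R (-R) = 0 := by
  unfold cutoff; rw [neg_sq, div_self (by positivity)]; norm_num

theorem sq_div_sq_le_one {R x : ℝ} (hR : 0 < R) (hx : x ∈ Icc (-R) R) : x ^ 2 / R ^ 2 ≤ 1 := by
  rw [div_le_one (by positivity)]
  nlinarith [hx.1, hx.2]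

theorem cutoff_le_one {R x : ℝ} (hR : 0 < R) (hx : x ∈ Icc (-R) R) : cutoff R x ≤ 1 := by
  unfold cutoff
  have h1 := sq_div_sq_le_one hR hx
  have h2 : 0 ≤ x ^ 2 / R ^ 2 := by positivity
  nlinarith

theorem half_le_cutoff {R x : ℝ} (hR : 0 < R) (hx : x ∈ Icc (-(R / 2)) (R / 2)) :
    1 / 2 ≤ cutoff R x := by
  unfold cutoff
  have h1 : x ^ 2 / R ^ 2 ≤ 1 / 4 := by
    rw [div_le_iff₀ (by positivity)]
    nlinarith [hx.1, hx.2]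
  nlinarith

theorem cutoffDeriv_sq_le {R x : ℝ} (hR : 0 < R) (hx : x ∈ Icc (-R) R) :
    cutoffDeriv R x ^ 2 ≤ 16 / R ^ 2 * cutoff R x := by
  have h1 := sq_div_sq_le_one hR hx
  have : cutoffDeriv R x ^ 2 = 16 / R ^ 2 * cutoff R x * (x ^ 2 / R ^ 2) := by
    unfold cutoffDeriv cutoff; field_simp; ring
  rw [this]
  exact mul_le_of_le_one_right (mul_nonneg (by positivity) (cutoff_nonneg R x)) h1

theorem abs_cutoffDeriv_le {R x : ℝ} (hR : 0 < R) (hx : x ∈ Icc (-R) R) :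
    |cutoffDeriv R x| ≤ 4 / R := by
  apply abs_le_of_sq_le_sq _ (by positivity)
  calc cutoffDeriv R x ^ 2 ≤ 16 / R ^ 2 * cutoff R x := cutoffDeriv_sq_le hR hx
    _ ≤ 16 / R ^ 2 * 1 := by gcongr; exact cutoff_le_one hR hx
    _ = (4 / R) ^ 2 := by ring

theorem integral_cutoff_flux {R : ℝ} (hR : 0 < R) {G G' : ℝ → ℝ}
    (hG : ∀ x, HasDerivAt G (G' x) x) (hc : Continuous G') :
    ∫ x in (-R)..R, (cutoffDeriv R x * G x + cutoff R x * G' x) = 0 := by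
  have hGc : Continuous G := continuous_iff_continuousAt.2 fun x => (hG x).continuousAt
  rw [intervalIntegral.integral_eq_sub_of_hasDerivAt (f := fun x => cutoff R x * G x)
    (fun x _ => (hasDerivAt_cutoff R x).mul (hG x))
    (Continuous.intervalIntegrable (by fun_prop) _ _)]
  simp [cutoff_right hR, cutoff_left hR]

theorem integral_le_two_mul_cutoff {R r : ℝ} (hR : 0 < R) (hr : 0 ≤ r) (hrR : 2 * r ≤ R)
    {f : ℝ → ℝ} (hf : Continuous f) (h0 : ∀ x, 0 ≤ f x) :
    ∫ x in (-r)..r, f x ≤ 2 * ∫ x in (-R)..R, cutoff R x * f x := by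
  have h1 : ∫ x in (-r)..r, f x ≤ ∫ x in (-r)..r, 2 * (cutoff R x * f x) := by
    refine intervalIntegral_mono_of_continuous (by linarith) hf (by fun_prop) fun x hx => ?_
    have := half_le_cutoff hR (x := x) ⟨by linarith [hx.1], by linarith [hx.2]⟩
    nlinarith [h0 x]
  rw [intervalIntegral.integral_const_mul] at h1
  refine h1.trans (mul_le_mul_of_nonneg_left ?_ zero_le_two)
  refine intervalIntegral.integral_mono_interval (by linarith) (by linarith) (by linarith) ?_ ?_
  · exact Eventually.of_forall fun x => mul_nonneg (cutoff_nonneg R x) (h0 x)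
  · exact Continuous.intervalIntegrable (by fun_prop) _ _

/-- A one-dimensional Sobolev estimate with cutoff. -/
theorem cutoff_mul_sq_le {R ε : ℝ} (hR : 0 < R) (hε : 0 < ε) {f f' : ℝ → ℝ}
    (hf : ∀ x, HasDerivAt f (f' x) x) (hc : Continuous f') {x : ℝ} (hx : x ∈ Icc (-R) R) :
    cutoff R x * f x ^ 2 ≤ ε * (∫ y in (-R)..R, cutoff R y * f' y ^ 2)
      + ε⁻¹ * (∫ y in (-R)..R, cutoff R y * f y ^ 2) + 4 / R * ∫ y in (-R)..R, f y ^ 2 := by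
  have hfc : Continuous f := continuous_iff_continuousAt.2 fun x => (hf x).continuousAt
  set g : ℝ → ℝ := fun y => ε * (cutoff R y * f' y ^ 2) + ε⁻¹ * (cutoff R y * f y ^ 2)
    + 4 / R * f y ^ 2 with hg
  have hgc : Continuous g := by fun_prop
  have hg0 : ∀ y, 0 ≤ g y := fun y => by
    have := cutoff_nonneg R y
    positivity
  have h1 : ∫ y in (-R)..x, (cutoffDeriv R y * f y ^ 2 + cutoff R y * (2 * f y * f' y))
      = cutoff R x * f x ^ 2 := by
    rw [intervalIntegral.integral_eq_sub_of_hasDerivAt (f := fun x => cutoff R x * f x ^ 2)]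
    · simp [cutoff_left hR]
    · intro y _
      have := (hasDerivAt_cutoff R y).mul ((hf y).pow 2)
      refine this.congr_deriv ?_
      simp only [Pi.pow_apply]
      ring
    · exact Continuous.intervalIntegrable (by fun_prop) _ _
  have h2 : ∫ y in (-R)..x, (cutoffDeriv R y * f y ^ 2 + cutoff R y * (2 * f y * f' y))
      ≤ ∫ y in (-R)..x, g y := by
    refine intervalIntegral_mono_of_continuous hx.1 (by fun_prop) hgc fun y hy => ?_
    have hy' : y ∈ Icc (-R) R := ⟨hy.1, hy.2.trans hx.2⟩
    have h3 := (le_abs_self _).trans (abs_cutoffDeriv_le hR hy')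
    have h4 : cutoff R y * (2 * f y * f' y)
        ≤ ε * (cutoff R y * f' y ^ 2) + ε⁻¹ * (cutoff R y * f y ^ 2) := by
      have h5 : 2 * f y * f' y ≤ ε * f' y ^ 2 + ε⁻¹ * f y ^ 2 := by
        have : ε * f' y ^ 2 + ε⁻¹ * f y ^ 2 - 2 * f y * f' y = ε⁻¹ * (ε * f' y - f y) ^ 2 := by
          field_simp; ring
        nlinarith [mul_nonneg (inv_pos.2 hε).le (sq_nonneg (ε * f' y - f y))]
      nlinarith [mul_le_mul_of_nonneg_left h5 (cutoff_nonneg R y)]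
    have h6 := mul_le_mul_of_nonneg_right h3 (sq_nonneg (f y))
    simp only [hg]
    linarith
  have h3 : ∫ y in (-R)..x, g y ≤ ∫ y in (-R)..R, g y :=
    intervalIntegral.integral_mono_interval le_rfl hx.1 hx.2
      (Eventually.of_forall hg0) (hgc.intervalIntegrable _ _)
  rw [← h1]
  refine (h2.trans h3).trans_eq ?_
  simp only [hg]
  rw [intervalIntegral.integral_add (Continuous.intervalIntegrable (by fun_prop) _ _)
      (Continuous.intervalIntegrable (by fun_prop) _ _),
    intervalIntegral.integral_add (Continuous.intervalIntegrable (by fun_prop) _ _)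
      (Continuous.intervalIntegrable (by fun_prop) _ _)]
  simp only [intervalIntegral.integral_const_mul]

end Cutoff

section Flow

/-- A function on the plane with continuous first and second space derivatives and a continuous
function that is its time derivative for times in `(0, T)`. -/
structure StripFn (T : ℝ) where
  /-- the function -/
  f : C(ℝ × ℝ, ℝ)
  /-- its space derivative -/
  x : C(ℝ × ℝ, ℝ)
  /-- its second space derivative -/
  xx : C(ℝ × ℝ, ℝ)
  /-- its time derivative -/
  t : C(ℝ × ℝ, ℝ)
  hx : ∀ y s, HasDerivAt (fun z => f (z, s)) (x (y, s)) y
  hxx : ∀ y s, HasDerivAt (fun z => x (z, s)) (xx (y, s)) y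
  ht : ∀ y, ∀ s ∈ Ioo 0 T, HasDerivAt (fun r => f (y, r)) (t (y, s)) s

/-- The derivative of `z ↦ visc α z / z`. -/
def viscDivDeriv (α z : ℝ) : ℝ := α * (-α * z ^ (-α - 1)) / z - visc α z / z ^ 2

theorem hasDerivAt_visc_div (α : ℝ) {z : ℝ} (hz : 0 < z) :
    HasDerivAt (fun z => visc α z / z) (viscDivDeriv α z) z := by
  unfold viscDivDeriv visc
  have h1 : HasDerivAt (fun z : ℝ => 1 + α * z ^ (-α)) (α * (-α * z ^ (-α - 1))) z :=
    ((Real.hasDerivAt_rpow_const (Or.inl hz.ne')).const_mul α).const_add 1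
  refine (h1.div (hasDerivAt_id z) hz.ne').congr_deriv ?_
  simp only [id]
  field_simp

theorem one_le_visc {α : ℝ} (hα : 0 ≤ α) {z : ℝ} (hz : 0 < z) : 1 ≤ visc α z := by
  unfold visc
  have := Real.rpow_pos_of_pos hz (-α)
  nlinarith [mul_nonneg hα this.le]

/-- A solution of the planar MHD system written in components with expanded derivatives, extended
to all times so as to be constant outside `[0, T]`. -/
structure MHDFlow (α β T : ℝ) where
  /-- specific volume -/
  v : C(ℝ × ℝ, ℝ)
  /-- space derivative of the specific volume -/
  vx : C(ℝ × ℝ, ℝ)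
  /-- longitudinal velocity -/
  u : StripFn T
  /-- temperature -/
  θ : StripFn T
  /-- first component of the transverse velocity -/
  wa : StripFn T
  /-- second component of the transverse velocity -/
  wb : StripFn T
  /-- first component of the magnetic field -/
  ba : StripFn T
  /-- second component of the magnetic field -/
  bb : StripFn T
  hvx : ∀ x t, HasDerivAt (fun y => v (y, t)) (vx (x, t)) x
  hvt : ∀ x, ∀ t ∈ Ioo 0 T, HasDerivAt (fun s => v (x, s)) (u.x (x, t)) t
  v_pos : ∀ p, 0 < v p
  θ_pos : ∀ p, 0 < θ.f p
  eq_u : ∀ p, u.t p = visc α (v p) / v p * u.xx p + viscDivDeriv α (v p) * vx p * u.x p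
    - (θ.x p / v p - θ.f p * vx p / v p ^ 2 + ba.f p * ba.x p + bb.f p * bb.x p)
  eq_wa : ∀ p, wa.t p = ba.x p + wa.xx p / v p - vx p * wa.x p / v p ^ 2
  eq_wb : ∀ p, wb.t p = bb.x p + wb.xx p / v p - vx p * wb.x p / v p ^ 2
  eq_ba : ∀ p, v p * ba.t p = ba.xx p / v p - vx p * ba.x p / v p ^ 2 + wa.x p - u.x p * ba.f p
  eq_bb : ∀ p, v p * bb.t p = bb.xx p / v p - vx p * bb.x p / v p ^ 2 + wb.x p - u.x p * bb.f p
  eq_θ : ∀ p, θ.t p = θ.f p ^ β * θ.xx p / v p + β * θ.f p ^ (β - 1) * θ.x p ^ 2 / v p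
    - θ.f p ^ β * θ.x p * vx p / v p ^ 2 - θ.f p / v p * u.x p
    + (visc α (v p) * u.x p ^ 2 + (wa.x p ^ 2 + wb.x p ^ 2) + (ba.x p ^ 2 + bb.x p ^ 2)) / v p
  far : ∀ ε > 0, ∃ M, ∀ p : ℝ × ℝ, M ≤ |p.1| → |v p - 1| < ε ∧ |u.f p| < ε ∧ |θ.f p - 1| < ε ∧
    |wa.f p| < ε ∧ |wb.f p| < ε ∧ |ba.f p| < ε ∧ |bb.f p| < ε

/-- Admissibility of the initial data of a `MHDFlow`. -/
structure MHDFlow.Adm {α β T : ℝ} (S : MHDFlow α β T) (K δ : ℝ) : Prop where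
  bound : ∀ R, 0 ≤ R → ∫ x in (-R)..R, ((S.v (x, 0) - 1) ^ 2 + S.u.f (x, 0) ^ 2
    + (S.θ.f (x, 0) - 1) ^ 2 + (S.ba.f (x, 0) ^ 2 + S.bb.f (x, 0) ^ 2)
    + (S.wa.f (x, 0) ^ 2 + S.wb.f (x, 0) ^ 2) + S.vx (x, 0) ^ 2 + S.u.x (x, 0) ^ 2
    + S.θ.x (x, 0) ^ 2 + (S.ba.x (x, 0) ^ 2 + S.bb.x (x, 0) ^ 2)
    + (S.wa.x (x, 0) ^ 2 + S.wb.x (x, 0) ^ 2)) ≤ K ^ 2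
  v_ge : ∀ x, δ ≤ S.v (x, 0)
  θ_ge : ∀ x, δ ≤ S.θ.f (x, 0)

end Flow

section Reduction

/-- Extension of a function on the strip, constant in time outside `[0, T]`. -/
def stripExt {T : ℝ} (hT : 0 ≤ T) (g : ℝ → ℝ → ℝ)
    (hg : ContinuousOn (fun p : ℝ × ℝ => g p.1 p.2) (univ ×ˢ Icc 0 T)) : C(ℝ × ℝ, ℝ) where
  toFun p := g p.1 (projIcc 0 T hT p.2)
  continuous_toFun := by
    refine hg.comp_continuous
      (f := fun p : ℝ × ℝ => (p.1, ((projIcc 0 T hT p.2 : Icc 0 T) : ℝ))) ?_ ?_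
    · exact continuous_fst.prodMk
        (continuous_subtype_val.comp (continuous_projIcc.comp continuous_snd))
    · exact fun p => ⟨mem_univ _, (projIcc 0 T hT p.2).2⟩

theorem stripExt_apply {T : ℝ} (hT : 0 ≤ T) (g : ℝ → ℝ → ℝ)
    (hg : ContinuousOn (fun p : ℝ × ℝ => g p.1 p.2) (univ ×ˢ Icc 0 T)) (p : ℝ × ℝ) :
    stripExt hT g hg p = g p.1 (projIcc 0 T hT p.2) := rfl

theorem stripExt_of_mem {T : ℝ} (hT : 0 ≤ T) (g : ℝ → ℝ → ℝ)
    (hg : ContinuousOn (fun p : ℝ × ℝ => g p.1 p.2) (univ ×ˢ Icc 0 T)) (x : ℝ) {t : ℝ}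
    (ht : t ∈ Icc 0 T) : stripExt hT g hg (x, t) = g x t := by
  rw [stripExt_apply, projIcc_of_mem hT ht]

theorem hasDerivAt_stripExt_time {T : ℝ} (hT : 0 ≤ T) {g : ℝ → ℝ → ℝ}
    (hg : ContinuousOn (fun p : ℝ × ℝ => g p.1 p.2) (univ ×ˢ Icc 0 T)) {g' x t : ℝ}
    (ht : t ∈ Ioo 0 T) (h : HasDerivWithinAt (fun s => g x s) g' (Icc 0 T) t) :
    HasDerivAt (fun s => stripExt hT g hg (x, s)) g' t := by
  refine (h.hasDerivAt (Icc_mem_nhds ht.1 ht.2)).congr_of_eventuallyEq ?_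
  filter_upwards [Ioo_mem_nhds ht.1 ht.2] with s hs
  exact stripExt_of_mem hT g hg x (Ioo_subset_Icc_self hs)

/-- Build a `StripFn` from a function on the strip and its derivatives. -/
def StripFn.mk' {T : ℝ} (hT : 0 ≤ T) (f fx fxx ft : ℝ → ℝ → ℝ)
    (c : ContinuousOn (fun p : ℝ × ℝ => f p.1 p.2) (univ ×ˢ Icc 0 T))
    (cx : ContinuousOn (fun p : ℝ × ℝ => fx p.1 p.2) (univ ×ˢ Icc 0 T))
    (cxx : ContinuousOn (fun p : ℝ × ℝ => fxx p.1 p.2) (univ ×ˢ Icc 0 T))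
    (ct : ContinuousOn (fun p : ℝ × ℝ => ft p.1 p.2) (univ ×ˢ Icc 0 T))
    (h1 : ∀ x, ∀ t ∈ Icc 0 T, HasDerivAt (fun y => f y t) (fx x t) x)
    (h2 : ∀ x, ∀ t ∈ Icc 0 T, HasDerivAt (fun y => fx y t) (fxx x t) x)
    (h3 : ∀ x, ∀ t ∈ Icc 0 T, HasDerivWithinAt (fun s => f x s) (ft x t) (Icc 0 T) t) :
    StripFn T where
  f := stripExt hT f c
  x := stripExt hT fx cx
  xx := stripExt hT fxx cxx
  t := stripExt hT ft ct
  hx y s := h1 y _ (projIcc 0 T hT s).2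
  hxx y s := h2 y _ (projIcc 0 T hT s).2
  ht y s hs := by
    refine (hasDerivAt_stripExt_time hT c hs (h3 y s (Ioo_subset_Icc_self hs))).congr_deriv ?_
    rw [stripExt_of_mem hT ft ct y (Ioo_subset_Icc_self hs)]

theorem abs_fst_lt_of_sqrt_sq2_lt {p : ℝ × ℝ} {ε : ℝ} (h : Real.sqrt (sq2 p) < ε) : |p.1| < ε := by
  refine lt_of_le_of_lt ?_ h
  rw [← Real.sqrt_sq_eq_abs]
  exact Real.sqrt_le_sqrt (by unfold sq2; nlinarith [sq_nonneg p.2])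

theorem abs_snd_lt_of_sqrt_sq2_lt {p : ℝ × ℝ} {ε : ℝ} (h : Real.sqrt (sq2 p) < ε) : |p.2| < ε := by
  refine lt_of_le_of_lt ?_ h
  rw [← Real.sqrt_sq_eq_abs]
  exact Real.sqrt_le_sqrt (by unfold sq2; nlinarith [sq_nonneg p.1])

variable {α β T : ℝ} {v u θ : ℝ → ℝ → ℝ} {w b : ℝ → ℝ → ℝ × ℝ}

theorem HasDerivAt.fst' {f : ℝ → ℝ × ℝ} {f' : ℝ × ℝ} {x : ℝ} (h : HasDerivAt f f' x) :
    HasDerivAt (fun y => (f y).1) f'.1 x :=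
  (ContinuousLinearMap.fst ℝ ℝ ℝ).hasFDerivAt.comp_hasDerivAt x h

theorem HasDerivAt.snd' {f : ℝ → ℝ × ℝ} {f' : ℝ × ℝ} {x : ℝ} (h : HasDerivAt f f' x) :
    HasDerivAt (fun y => (f y).2) f'.2 x :=
  (ContinuousLinearMap.snd ℝ ℝ ℝ).hasFDerivAt.comp_hasDerivAt x h

theorem HasDerivWithinAt.fst' {f : ℝ → ℝ × ℝ} {f' : ℝ × ℝ} {x : ℝ} {s : Set ℝ}
    (h : HasDerivWithinAt f f' s x) : HasDerivWithinAt (fun y => (f y).1) f'.1 s x :=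
  (ContinuousLinearMap.fst ℝ ℝ ℝ).hasFDerivAt.comp_hasDerivWithinAt x h

theorem HasDerivWithinAt.snd' {f : ℝ → ℝ × ℝ} {f' : ℝ × ℝ} {x : ℝ} {s : Set ℝ}
    (h : HasDerivWithinAt f f' s x) : HasDerivWithinAt (fun y => (f y).2) f'.2 s x :=
  (ContinuousLinearMap.snd ℝ ℝ ℝ).hasFDerivAt.comp_hasDerivWithinAt x h

/-- The expanded, extended form of a classical solution. -/
def IsClassicalSolution.toFlow (hT : 0 < T) (S : IsClassicalSolution α β T v u θ w b) :
    MHDFlow α β T where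
  v := stripExt hT.le v S.cont.fst
  vx := stripExt hT.le (pdx v) S.cont_dx.fst
  u := StripFn.mk' hT.le u (pdx u) (pdx (pdx u)) (pdt T u) S.cont.snd.fst S.cont_dx.snd.fst
    S.cont_dxx.fst S.cont_dt.snd.fst (fun x t ht => (S.diff_x x t ht).2.1.hasDerivAt)
    (fun x t ht => (S.diff_xx x t ht).1.hasDerivAt)
    (fun x t ht => (S.diff_t x t ht).2.1.hasDerivWithinAt)
  θ := StripFn.mk' hT.le θ (pdx θ) (pdx (pdx θ)) (pdt T θ) S.cont.snd.snd.fst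
    S.cont_dx.snd.snd.fst S.cont_dxx.snd.fst S.cont_dt.snd.snd.fst
    (fun x t ht => (S.diff_x x t ht).2.2.1.hasDerivAt)
    (fun x t ht => (S.diff_xx x t ht).2.1.hasDerivAt)
    (fun x t ht => (S.diff_t x t ht).2.2.1.hasDerivWithinAt)
  wa := StripFn.mk' hT.le (fun x t => (w x t).1) (fun x t => (pdx w x t).1)
    (fun x t => (pdx (pdx w) x t).1) (fun x t => (pdt T w x t).1)
    S.cont.snd.snd.snd.fst.fst S.cont_dx.snd.snd.snd.fst.fst S.cont_dxx.snd.snd.fst.fst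
    S.cont_dt.snd.snd.snd.fst.fst
    (fun x t ht => (S.diff_x x t ht).2.2.2.1.hasDerivAt.fst')
    (fun x t ht => (S.diff_xx x t ht).2.2.1.hasDerivAt.fst')
    (fun x t ht => (S.diff_t x t ht).2.2.2.1.hasDerivWithinAt.fst')
  wb := StripFn.mk' hT.le (fun x t => (w x t).2) (fun x t => (pdx w x t).2)
    (fun x t => (pdx (pdx w) x t).2) (fun x t => (pdt T w x t).2)
    S.cont.snd.snd.snd.fst.snd S.cont_dx.snd.snd.snd.fst.snd S.cont_dxx.snd.snd.fst.snd
    S.cont_dt.snd.snd.snd.fst.snd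
    (fun x t ht => (S.diff_x x t ht).2.2.2.1.hasDerivAt.snd')
    (fun x t ht => (S.diff_xx x t ht).2.2.1.hasDerivAt.snd')
    (fun x t ht => (S.diff_t x t ht).2.2.2.1.hasDerivWithinAt.snd')
  ba := StripFn.mk' hT.le (fun x t => (b x t).1) (fun x t => (pdx b x t).1)
    (fun x t => (pdx (pdx b) x t).1) (fun x t => (pdt T b x t).1)
    S.cont.snd.snd.snd.snd.fst S.cont_dx.snd.snd.snd.snd.fst S.cont_dxx.snd.snd.snd.fst
    S.cont_dt.snd.snd.snd.snd.fst
    (fun x t ht => (S.diff_x x t ht).2.2.2.2.hasDerivAt.fst')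
    (fun x t ht => (S.diff_xx x t ht).2.2.2.hasDerivAt.fst')
    (fun x t ht => (S.diff_t x t ht).2.2.2.2.hasDerivWithinAt.fst')
  bb := StripFn.mk' hT.le (fun x t => (b x t).2) (fun x t => (pdx b x t).2)
    (fun x t => (pdx (pdx b) x t).2) (fun x t => (pdt T b x t).2)
    S.cont.snd.snd.snd.snd.snd S.cont_dx.snd.snd.snd.snd.snd S.cont_dxx.snd.snd.snd.snd
    S.cont_dt.snd.snd.snd.snd.snd
    (fun x t ht => (S.diff_x x t ht).2.2.2.2.hasDerivAt.snd')
    (fun x t ht => (S.diff_xx x t ht).2.2.2.hasDerivAt.snd')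
    (fun x t ht => (S.diff_t x t ht).2.2.2.2.hasDerivWithinAt.snd')
  hvx x t := (S.diff_x x _ (projIcc 0 T hT.le t).2).1.hasDerivAt
  hvt x t ht := by
    have ht' := Ioo_subset_Icc_self ht
    refine (hasDerivAt_stripExt_time hT.le S.cont.fst ht
      (S.diff_t x t ht').1.hasDerivWithinAt).congr_deriv ?_
    refine (S.eq_mass x t ht').trans ?_
    exact (stripExt_of_mem hT.le (pdx u) S.cont_dx.snd.fst x ht').symm
  v_pos p := S.v_pos p.1 _ (projIcc 0 T hT.le p.2).2
  θ_pos p := S.θ_pos p.1 _ (projIcc 0 T hT.le p.2).2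
  eq_u p := by
    obtain ⟨x, t'⟩ := p
    simp only [StripFn.mk', stripExt_apply]
    obtain ⟨t, ht⟩ := projIcc 0 T hT.le t'
    simp only
    have hd := S.diff_x x t ht
    have hv := S.v_pos x t ht
    have h := S.eq_mom x t ht
    have e1 : HasDerivAt (fun y => θ y t / v y t + sq2 (b y t) / 2)
        (pdx θ x t / v x t - θ x t * pdx v x t / v x t ^ 2
          + ((b x t).1 * (pdx b x t).1 + (b x t).2 * (pdx b x t).2)) x := by
      have h1 := hd.2.2.1.hasDerivAt.div hd.1.hasDerivAt hv.ne'
      have h2 := ((hd.2.2.2.2.hasDerivAt.fst'.pow 2).add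
        (hd.2.2.2.2.hasDerivAt.snd'.pow 2)).div_const 2
      refine (h1.add h2).congr_deriv ?_
      simp only [pdx]
      field_simp
      ring
    have e2 : HasDerivAt (fun y => visc α (v y t) * pdx u y t / v y t)
        (visc α (v x t) / v x t * pdx (pdx u) x t
          + viscDivDeriv α (v x t) * pdx v x t * pdx u x t) x := by
      have h1 := ((hasDerivAt_visc_div α hv).comp x hd.1.hasDerivAt).mul
        (S.diff_xx x t ht).1.hasDerivAt
      refine (h1.congr_deriv ?_).congr_of_eventuallyEq (Eventually.of_forall fun y => ?_)
      · simp only [Function.comp, pdx]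
        ring
      · simp only [Function.comp, Pi.mul_apply]
        ring
    have e1' := e1.deriv
    have e2' := e2.deriv
    simp only [pdx] at h e1' e2' ⊢
    rw [e1', e2'] at h
    linarith
  eq_wa p := by
    obtain ⟨x, t'⟩ := p
    simp only [StripFn.mk', stripExt_apply]
    obtain ⟨t, ht⟩ := projIcc 0 T hT.le t'
    simp only
    have h := congrArg Prod.fst (S.eq_w x t ht)
    have hv := S.v_pos x t ht
    have e1 := (((S.diff_x x t ht).1.hasDerivAt.inv hv.ne').smul
      (S.diff_xx x t ht).2.2.1.hasDerivAt).deriv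
    simp only [pdx] at h e1 ⊢
    erw [e1] at h
    simp only [Prod.fst_sub, Prod.fst_add, Prod.smul_fst, smul_eq_mul, Pi.inv_apply] at h
    rw [sub_eq_iff_eq_add] at h
    rw [h]
    field_simp
    ring
  eq_wb p := by
    obtain ⟨x, t'⟩ := p
    simp only [StripFn.mk', stripExt_apply]
    obtain ⟨t, ht⟩ := projIcc 0 T hT.le t'
    simp only
    have h := congrArg Prod.snd (S.eq_w x t ht)
    have hv := S.v_pos x t ht
    have e1 := (((S.diff_x x t ht).1.hasDerivAt.inv hv.ne').smul
      (S.diff_xx x t ht).2.2.1.hasDerivAt).deriv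
    simp only [pdx] at h e1 ⊢
    erw [e1] at h
    simp only [Prod.snd_sub, Prod.snd_add, Prod.smul_snd, smul_eq_mul, Pi.inv_apply] at h
    rw [sub_eq_iff_eq_add] at h
    rw [h]
    field_simp
    ring
  eq_ba p := by
    obtain ⟨x, t'⟩ := p
    simp only [StripFn.mk', stripExt_apply]
    obtain ⟨t, ht⟩ := projIcc 0 T hT.le t'
    simp only
    have h := congrArg Prod.fst (S.eq_b x t ht)
    have hv := S.v_pos x t ht
    have hm := S.eq_mass x t ht
    have e1 := (((S.diff_x x t ht).1.hasDerivAt.inv hv.ne').smul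
      (S.diff_xx x t ht).2.2.2.hasDerivAt).deriv
    have e2 := ((S.diff_t x t ht).1.hasDerivWithinAt.smul
      (S.diff_t x t ht).2.2.2.2.hasDerivWithinAt).derivWithin (uniqueDiffOn_Icc hT t ht)
    simp only [pdx, pdt] at h e1 e2 hm ⊢
    erw [e1, e2] at h
    rw [hm] at h
    simp only [Prod.fst_sub, Prod.fst_add, Prod.smul_fst, smul_eq_mul, Pi.inv_apply] at h
    rw [sub_eq_iff_eq_add, ← eq_sub_iff_add_eq] at h
    rw [h]
    field_simp
    ring
  eq_bb p := by
    obtain ⟨x, t'⟩ := p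
    simp only [StripFn.mk', stripExt_apply]
    obtain ⟨t, ht⟩ := projIcc 0 T hT.le t'
    simp only
    have h := congrArg Prod.snd (S.eq_b x t ht)
    have hv := S.v_pos x t ht
    have hm := S.eq_mass x t ht
    have e1 := (((S.diff_x x t ht).1.hasDerivAt.inv hv.ne').smul
      (S.diff_xx x t ht).2.2.2.hasDerivAt).deriv
    have e2 := ((S.diff_t x t ht).1.hasDerivWithinAt.smul
      (S.diff_t x t ht).2.2.2.2.hasDerivWithinAt).derivWithin (uniqueDiffOn_Icc hT t ht)
    simp only [pdx, pdt] at h e1 e2 hm ⊢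
    erw [e1, e2] at h
    rw [hm] at h
    simp only [Prod.snd_sub, Prod.snd_add, Prod.smul_snd, smul_eq_mul, Pi.inv_apply] at h
    rw [sub_eq_iff_eq_add, ← eq_sub_iff_add_eq] at h
    rw [h]
    field_simp
    ring
  eq_θ p := by
    obtain ⟨x, t'⟩ := p
    simp only [StripFn.mk', stripExt_apply]
    obtain ⟨t, ht⟩ := projIcc 0 T hT.le t'
    simp only
    have hd := S.diff_x x t ht
    have hv := S.v_pos x t ht
    have hθ := S.θ_pos x t ht
    have h := S.eq_temp x t ht
    have e1 : HasDerivAt (fun y => θ y t ^ β * pdx θ y t / v y t)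
        (θ x t ^ β * pdx (pdx θ) x t / v x t + β * θ x t ^ (β - 1) * pdx θ x t ^ 2 / v x t
          - θ x t ^ β * pdx θ x t * pdx v x t / v x t ^ 2) x := by
      have h1 := ((hd.2.2.1.hasDerivAt.rpow_const (p := β) (Or.inl hθ.ne')).mul
        (S.diff_xx x t ht).2.1.hasDerivAt).div hd.1.hasDerivAt hv.ne'
      refine h1.congr_deriv ?_
      simp only [pdx, Pi.mul_apply]
      field_simp
      ring
    have e1' := e1.deriv
    simp only [pdx] at h e1' ⊢
    rw [e1'] at h
    simp only [sq2] at h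
    linarith
  far ε hε := by
    obtain ⟨M, hM⟩ := S.farfield ε hε
    refine ⟨M, fun p hp => ?_⟩
    obtain ⟨h1, h2, h3, h4, h5⟩ := hM p.1 _ (projIcc 0 T hT.le p.2).2 hp
    exact ⟨h1, h2, h3, abs_fst_lt_of_sqrt_sq2_lt h5, abs_snd_lt_of_sqrt_sq2_lt h5,
      abs_fst_lt_of_sqrt_sq2_lt h4, abs_snd_lt_of_sqrt_sq2_lt h4⟩

theorem IsClassicalSolution.toFlow_θ (hT : 0 < T) (S : IsClassicalSolution α β T v u θ w b)
    (x : ℝ) {t : ℝ} (ht : t ∈ Icc 0 T) : (S.toFlow hT).θ.f (x, t) = θ x t :=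
  stripExt_of_mem hT.le θ S.cont.snd.snd.fst x ht

theorem IsClassicalSolution.adm_toFlow (hT : 0 < T) (S : IsClassicalSolution α β T v u θ w b)
    {K δ : ℝ} (h : Admissible K δ v u θ w b) : (S.toFlow hT).Adm K δ := by
  have h0 : (0:ℝ) ∈ Icc 0 T := left_mem_Icc.2 hT.le
  refine ⟨fun R hR => ?_, fun x => ?_, fun x => ?_⟩
  · refine le_trans ?_ h.1
    obtain ⟨i1, i2, i3, i4, i5, i6, i7, i8, i9, i10⟩ := S.sq_int 0 h0
    rw [intervalIntegral.integral_of_le (by linarith)]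
    simp only [IsClassicalSolution.toFlow, StripFn.mk', stripExt_of_mem hT.le _ _ _ h0]
    refine setIntegral_le_integral ?_ (Eventually.of_forall fun x => ?_)
    · exact ((((((((i1.add i2).add i3).add i4).add i5).add i6).add i7).add i8).add i9).add i10
    · simp only [Pi.zero_apply]
      positivity
  · exact (h.2.1 x).trans_eq (stripExt_of_mem hT.le v S.cont.fst x h0).symm
  · exact (h.2.2 x).trans_eq (S.toFlow_θ hT x h0).symm

end Reduction

section Energy

variable {α β T : ℝ}

namespace MHDFlow

/-- Powers of the temperature. -/
def pw (S : MHDFlow α β T) (s : ℝ) (q : ℝ × ℝ) : ℝ := S.θ.f q ^ s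

/-- The viscosity coefficient along the flow. -/
def mu (S : MHDFlow α β T) (q : ℝ × ℝ) : ℝ := visc α (S.v q)

/-- The heat production `(μ(v) u_x² + |w_x|² + |b_x|²) / v`. -/
def heat (S : MHDFlow α β T) (q : ℝ × ℝ) : ℝ :=
  (S.mu q * S.u.x q ^ 2 + (S.wa.x q ^ 2 + S.wb.x q ^ 2) + (S.ba.x q ^ 2 + S.bb.x q ^ 2)) / S.v q

/-- The dissipation density attached to the weight `1 - θ ^ (-p)`. -/
def diss (S : MHDFlow α β T) (p : ℝ) (q : ℝ × ℝ) : ℝ :=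
  S.heat q * S.pw (-p) q + p * (S.pw β q * S.pw (-p) q / S.θ.f q * S.θ.x q ^ 2 / S.v q)

/-- The energy density with thermal part `H`. -/
def energy (S : MHDFlow α β T) (H : ℝ → ℝ) (q : ℝ × ℝ) : ℝ :=
  (S.u.f q ^ 2 + (S.wa.f q ^ 2 + S.wb.f q ^ 2) + S.v q * (S.ba.f q ^ 2 + S.bb.f q ^ 2)) / 2
    + (S.v q - Real.log (S.v q) - 1) + H (S.θ.f q)

/-- The time derivative of the energy density when `H' = 1 - θ ^ (-p)`. -/
def energyDot (S : MHDFlow α β T) (p : ℝ) (q : ℝ × ℝ) : ℝ :=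
  S.u.f q * S.u.t q + (S.wa.f q * S.wa.t q + S.wb.f q * S.wb.t q)
    + S.u.x q * (S.ba.f q ^ 2 + S.bb.f q ^ 2) / 2
    + S.v q * (S.ba.f q * S.ba.t q + S.bb.f q * S.bb.t q)
    + (S.u.x q - S.u.x q / S.v q) + (1 - S.pw (-p) q) * S.θ.t q

/-- The total pressure. -/
def pressure (S : MHDFlow α β T) (q : ℝ × ℝ) : ℝ :=
  S.θ.f q / S.v q + (S.ba.f q ^ 2 + S.bb.f q ^ 2) / 2

/-- The energy flux. -/
def flux (S : MHDFlow α β T) (p : ℝ) (q : ℝ × ℝ) : ℝ :=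
  S.u.f q * (S.mu q / S.v q * S.u.x q - S.pressure q + 1)
    + (S.wa.f q * S.ba.f q + S.wb.f q * S.bb.f q)
    + (S.wa.f q * S.wa.x q + S.wb.f q * S.wb.x q + S.ba.f q * S.ba.x q + S.bb.f q * S.bb.x q) / S.v q
    + (1 - S.pw (-p) q) * (S.pw β q * S.θ.x q / S.v q)

variable (S : MHDFlow α β T)

theorem v_ne (q : ℝ × ℝ) : S.v q ≠ 0 := (S.v_pos q).ne'

theorem θ_ne (q : ℝ × ℝ) : S.θ.f q ≠ 0 := (S.θ_pos q).ne'

theorem pw_pos (s : ℝ) (q : ℝ × ℝ) : 0 < S.pw s q := Real.rpow_pos_of_pos (S.θ_pos q) s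

theorem one_le_mu (hα : 0 ≤ α) (q : ℝ × ℝ) : 1 ≤ S.mu q := one_le_visc hα (S.v_pos q)

@[fun_prop]
theorem continuous_pw (s : ℝ) : Continuous (S.pw s) :=
  S.θ.f.continuous.rpow_const fun q => Or.inl (S.θ_ne q)

@[fun_prop]
theorem continuous_mu : Continuous S.mu := by
  unfold mu visc
  exact continuous_const.add (continuous_const.mul
    (S.v.continuous.rpow_const fun q => Or.inl (S.v_ne q)))

@[fun_prop]
theorem continuous_heat : Continuous S.heat := by
  unfold heat
  fun_prop (disch := intro; exact S.v_ne _)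

@[fun_prop]
theorem continuous_diss (p : ℝ) : Continuous (S.diss p) := by
  unfold diss
  have := S.θ_ne
  have := S.v_ne
  fun_prop (disch := assumption)

@[fun_prop]
theorem continuous_energyDot (p : ℝ) : Continuous (S.energyDot p) := by
  unfold energyDot
  have := S.v_ne
  fun_prop (disch := assumption)

@[fun_prop]
theorem continuous_pressure : Continuous S.pressure := by
  unfold pressure
  have := S.v_ne
  fun_prop (disch := assumption)

@[fun_prop]
theorem continuous_flux (p : ℝ) : Continuous (S.flux p) := by
  unfold flux
  have := S.v_ne
  fun_prop (disch := assumption)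

theorem continuous_energy {H H' : ℝ → ℝ} (hH : ∀ z, 0 < z → HasDerivAt H (H' z) z) :
    Continuous (S.energy H) := by
  unfold energy
  have h1 : Continuous fun q => H (S.θ.f q) := continuous_iff_continuousAt.2 fun q =>
    ContinuousAt.comp (f := S.θ.f) (hH _ (S.θ_pos q)).continuousAt S.θ.f.continuous.continuousAt
  have h2 := S.v_ne
  exact Continuous.add (by fun_prop (disch := assumption)) h1

theorem heat_nonneg (hα : 0 ≤ α) (q : ℝ × ℝ) : 0 ≤ S.heat q := by
  have := S.v_pos q
  have := S.one_le_mu hα q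
  unfold heat
  positivity

theorem diss_nonneg (hα : 0 ≤ α) {p : ℝ} (hp : 0 ≤ p) (q : ℝ × ℝ) : 0 ≤ S.diss p q := by
  have := S.v_pos q
  have := S.θ_pos q
  have := S.pw_pos β q
  have := S.pw_pos (-p) q
  have := S.heat_nonneg hα q
  unfold diss
  positivity

theorem hasDerivAt_energy {p : ℝ} {H : ℝ → ℝ}
    (hH : ∀ z, 0 < z → HasDerivAt H (1 - z ^ (-p)) z) (x : ℝ) {t : ℝ} (ht : t ∈ Ioo 0 T) :
    HasDerivAt (fun s => S.energy H (x, s)) (S.energyDot p (x, t)) t := by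
  have hv := S.hvt x t ht
  have h1 := ((((S.u.ht x t ht).pow 2).add (((S.wa.ht x t ht).pow 2).add
    ((S.wb.ht x t ht).pow 2))).add (hv.mul (((S.ba.ht x t ht).pow 2).add
    ((S.bb.ht x t ht).pow 2)))).div_const 2
  have h2 := (hv.sub (hv.log (S.v_ne _))).sub_const 1
  have h3 := (hH _ (S.θ_pos (x, t))).comp t (S.θ.ht x t ht)
  refine ((h1.add h2).add h3).congr_deriv ?_
  simp only [energyDot, pw, Pi.add_apply, Pi.pow_apply]
  ring

theorem hasDerivAt_pw_x (s x t : ℝ) :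
    HasDerivAt (fun y => S.pw s (y, t)) (s * S.pw s (x, t) / S.θ.f (x, t) * S.θ.x (x, t)) x := by
  refine ((S.θ.hx x t).rpow_const (p := s) (Or.inl (S.θ_ne _))).congr_deriv ?_
  simp only [pw]
  rw [Real.rpow_sub_one (S.θ_ne _)]
  ring

theorem hasDerivAt_mu_div_x (x t : ℝ) :
    HasDerivAt (fun y => S.mu (y, t) / S.v (y, t))
      (viscDivDeriv α (S.v (x, t)) * S.vx (x, t)) x :=
  HasDerivAt.comp (h₂ := fun z => visc α z / z) x (hasDerivAt_visc_div α (S.v_pos (x, t)))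
    (S.hvx x t)

theorem hasDerivAt_pressure_x (x t : ℝ) :
    HasDerivAt (fun y => S.pressure (y, t))
      (S.θ.x (x, t) / S.v (x, t) - S.θ.f (x, t) * S.vx (x, t) / S.v (x, t) ^ 2
        + S.ba.f (x, t) * S.ba.x (x, t) + S.bb.f (x, t) * S.bb.x (x, t)) x := by
  refine (((S.θ.hx x t).div (S.hvx x t) (S.v_ne _)).add
    ((((S.ba.hx x t).pow 2).add ((S.bb.hx x t).pow 2)).div_const 2)).congr_deriv ?_
  have := S.v_ne (x, t)
  field_simp
  ring

theorem hasDerivAt_flux (p x t : ℝ) :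
    HasDerivAt (fun y => S.flux p (y, t)) (S.energyDot p (x, t) + S.diss p (x, t)
      - (S.θ.f (x, t) * S.pw (-p) (x, t) - 1) * S.u.x (x, t) / S.v (x, t)) x := by
  have hv := S.hvx x t
  have hne := S.v_ne (x, t)
  have h1 := (S.u.hx x t).mul
    ((((S.hasDerivAt_mu_div_x x t).mul (S.u.hxx x t)).sub (S.hasDerivAt_pressure_x x t)).add_const 1)
  have h2 := ((S.wa.hx x t).mul (S.ba.hx x t)).add ((S.wb.hx x t).mul (S.bb.hx x t))
  have h3 := (((((S.wa.hx x t).mul (S.wa.hxx x t)).add ((S.wb.hx x t).mul (S.wb.hxx x t))).add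
    ((S.ba.hx x t).mul (S.ba.hxx x t))).add ((S.bb.hx x t).mul (S.bb.hxx x t))).div hv hne
  have h4 := ((S.hasDerivAt_pw_x (-p) x t).const_sub 1).mul
    (((S.hasDerivAt_pw_x β x t).mul (S.θ.hxx x t)).div hv hne)
  refine (((h1.add h2).add h3).add h4).congr_deriv ?_
  simp only [energyDot, diss, heat, Pi.add_apply, Pi.mul_apply, Pi.sub_apply, Pi.div_apply]
  have ea : S.v (x, t) * (S.ba.f (x, t) * S.ba.t (x, t) + S.bb.f (x, t) * S.bb.t (x, t))
    = S.ba.f (x, t) * (S.v (x, t) * S.ba.t (x, t))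
      + S.bb.f (x, t) * (S.v (x, t) * S.bb.t (x, t)) := by ring
  rw [ea, S.eq_ba, S.eq_bb, S.eq_u, S.eq_wa, S.eq_wb, S.eq_θ, Real.rpow_sub_one (S.θ_ne _)]
  simp only [pressure]
  have hθ := S.θ_ne (x, t)
  rw [show S.θ.f (x, t) ^ β = S.pw β (x, t) from rfl]
  rw [show visc α (S.v (x, t)) = S.mu (x, t) from rfl]
  field_simp
  ring

end MHDFlow

end Energy

section Qualitative

variable {α β T : ℝ}

theorem exists_bound_of_far {g : ℝ × ℝ → ℝ} (hg : Continuous g) (T : ℝ) {R C : ℝ}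
    (h : ∀ p : ℝ × ℝ, R ≤ |p.1| → |g p| ≤ C) :
    ∃ M, 0 ≤ M ∧ ∀ x, ∀ t ∈ Icc 0 T, |g (x, t)| ≤ M := by
  obtain ⟨D, hD⟩ := ((isCompact_Icc (a := -R) (b := R)).prod (isCompact_Icc (a := 0) (b := T)))
    |>.exists_bound_of_continuousOn hg.continuousOn
  refine ⟨|C| + |D|, by positivity, fun x t ht => ?_⟩
  rcases le_total R |x| with hx | hx
  · linarith [h (x, t) hx, le_abs_self C, abs_nonneg D]
  · have := hD (x, t) ⟨abs_le.1 hx, ht⟩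
    rw [Real.norm_eq_abs] at this
    linarith [le_abs_self D, abs_nonneg C]

theorem integral_abs_le_of_far {h : ℝ → ℝ} (hc : Continuous h) {M ε N : ℝ} (hM : ∀ x, |h x| ≤ M)
    (hε : 0 ≤ ε) (hN : ∀ x, N ≤ |x| → |h x| ≤ ε) {L : ℝ} (hL : 0 ≤ L) :
    ∫ x in (-L)..L, |h x| ≤ 2 * L * ε + M * (1 + N ^ 2) * Real.pi := by
  have hM0 : 0 ≤ M := (abs_nonneg _).trans (hM 0)
  have hd : ∀ x : ℝ, 1 + x ^ 2 ≠ 0 := fun x => by positivity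
  have h1 : ∫ x in (-L)..L, |h x| ≤ ε * (∫ x in (-L)..L, (1:ℝ))
      + M * (1 + N ^ 2) * ∫ x in (-L)..L, 1 / (1 + x ^ 2) := by
    refine intervalIntegral_le_comb₂ (by linarith) (by fun_prop) (by fun_prop)
      (by fun_prop (disch := assumption)) fun x _ => ?_
    have hp : 0 < 1 + x ^ 2 := by positivity
    rcases le_total N |x| with hx | hx
    · have : 0 ≤ M * (1 + N ^ 2) * (1 / (1 + x ^ 2)) := by positivity
      linarith [hN x hx]
    · have h2 : x ^ 2 ≤ N ^ 2 := by
        rw [← sq_abs x]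
        exact pow_le_pow_left₀ (abs_nonneg x) hx 2
      have h3 : M ≤ M * (1 + N ^ 2) * (1 / (1 + x ^ 2)) := by
        rw [mul_one_div, le_div_iff₀ hp]
        nlinarith
      linarith [hM x]
  rw [integral_one_div_one_add_sq, intervalIntegral.integral_const] at h1
  have h4 : Real.arctan L - Real.arctan (-L) ≤ Real.pi := by
    linarith [Real.arctan_lt_pi_div_two L, Real.neg_pi_div_two_lt_arctan (-L)]
  have h5 := mul_le_mul_of_nonneg_left h4 (by positivity : 0 ≤ M * (1 + N ^ 2))
  simp only [smul_eq_mul] at h1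
  linarith

/-- A weighted Young inequality with the derivative of the cutoff. -/
theorem cutoffDeriv_mul_le {R ε x X Y Z : ℝ} (hR : 0 < R) (hε : 0 < ε) (hx : x ∈ Icc (-R) R)
    (hY : 0 ≤ Y) (hZ : 0 ≤ Z) (hXYZ : X ^ 2 ≤ Y * Z) :
    -(cutoffDeriv R x * X) ≤ ε * (cutoff R x * Y) + 4 / (ε * R ^ 2) * Z := by
  have h1 := cutoffDeriv_sq_le hR hx
  have h0 := cutoff_nonneg R x
  set a := ε * (cutoff R x * Y)
  set b := 4 / (ε * R ^ 2) * Z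
  have ha : 0 ≤ a := by positivity
  have hb : 0 ≤ b := by positivity
  have h2 : (cutoffDeriv R x * X) ^ 2 ≤ 4 * (a * b) := by
    rw [mul_pow]
    calc cutoffDeriv R x ^ 2 * X ^ 2 ≤ (16 / R ^ 2 * cutoff R x) * (Y * Z) := by gcongr
      _ = 4 * (a * b) := by simp only [a, b]; field_simp; ring
  have h3 := abs_le_of_sq_le_sq (a := cutoffDeriv R x * X) (b := a + b)
    (by nlinarith [sq_nonneg (a - b)]) (by positivity)
  linarith [(abs_le.1 h3).1]

theorem abs_mul_add_mul_add_mul_le {a b c x y z C : ℝ} (hx : |x| ≤ C) (hy : |y| ≤ C)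
    (hz : |z| ≤ C) : |a * x + (b * y + c * z)| ≤ C * (|a| + |b| + |c|) := by
  refine (abs_add_le _ _).trans ((add_le_add_right (abs_add_le _ _) _).trans ?_)
  simp only [abs_mul]
  linarith [mul_le_mul_of_nonneg_left hx (abs_nonneg a),
    mul_le_mul_of_nonneg_left hy (abs_nonneg b), mul_le_mul_of_nonneg_left hz (abs_nonneg c)]

namespace MHDFlow

variable (S : MHDFlow α β T)

theorem exists_state_bound : ∃ M, 1 ≤ M ∧ ∀ x, ∀ t ∈ Icc 0 T,
    (M⁻¹ ≤ S.v (x, t) ∧ S.v (x, t) ≤ M) ∧ (M⁻¹ ≤ S.θ.f (x, t) ∧ S.θ.f (x, t) ≤ M) ∧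
    |S.u.f (x, t)| ≤ M ∧ |S.wa.f (x, t)| ≤ M ∧ |S.wb.f (x, t)| ≤ M ∧ |S.ba.f (x, t)| ≤ M ∧
    |S.bb.f (x, t)| ≤ M := by
  obtain ⟨R, hR⟩ := S.far (1 / 2) (by norm_num)
  have key : ∀ {z : ℝ}, |z - 1| < 1 / 2 → |z| ≤ 2 ∧ |z⁻¹| ≤ 2 := by
    intro z hz
    rw [abs_lt] at hz
    have hz0 : 0 < z := by linarith
    refine ⟨by rw [abs_of_pos hz0]; linarith, ?_⟩
    rw [abs_of_pos (inv_pos.2 hz0), inv_le_comm₀ hz0 two_pos]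
    linarith
  have := S.v_ne
  have := S.θ_ne
  obtain ⟨M₁, h10, h1⟩ := exists_bound_of_far (g := fun q => S.v q) (by fun_prop) T
    fun p hp => (key (hR p hp).1).1
  obtain ⟨M₂, h20, h2⟩ := exists_bound_of_far (g := fun q => (S.v q)⁻¹)
    (by fun_prop (disch := assumption)) T fun p hp => (key (hR p hp).1).2
  obtain ⟨M₃, h30, h3⟩ := exists_bound_of_far (g := fun q => S.θ.f q) (by fun_prop) T
    fun p hp => (key (hR p hp).2.2.1).1
  obtain ⟨M₄, h40, h4⟩ := exists_bound_of_far (g := fun q => (S.θ.f q)⁻¹)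
    (by fun_prop (disch := assumption)) T fun p hp => (key (hR p hp).2.2.1).2
  obtain ⟨M₅, h50, h5⟩ := exists_bound_of_far (g := fun q => S.u.f q) (by fun_prop) T
    fun p hp => (hR p hp).2.1.le
  obtain ⟨M₆, h60, h6⟩ := exists_bound_of_far (g := fun q => S.wa.f q) (by fun_prop) T
    fun p hp => (hR p hp).2.2.2.1.le
  obtain ⟨M₇, h70, h7⟩ := exists_bound_of_far (g := fun q => S.wb.f q) (by fun_prop) T
    fun p hp => (hR p hp).2.2.2.2.1.le
  obtain ⟨M₈, h80, h8⟩ := exists_bound_of_far (g := fun q => S.ba.f q) (by fun_prop) T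
    fun p hp => (hR p hp).2.2.2.2.2.1.le
  obtain ⟨M₉, h90, h9⟩ := exists_bound_of_far (g := fun q => S.bb.f q) (by fun_prop) T
    fun p hp => (hR p hp).2.2.2.2.2.2.le
  set M := 1 + M₁ + M₂ + M₃ + M₄ + M₅ + M₆ + M₇ + M₈ + M₉ with hM
  have hM0 : 0 < M := by positivity
  refine ⟨M, by linarith, fun x t ht => ⟨⟨?_, ?_⟩, ⟨?_, ?_⟩, ?_, ?_, ?_, ?_, ?_⟩⟩
  · rw [inv_le_comm₀ hM0 (S.v_pos _)]
    linarith [(le_abs_self _).trans (h2 x t ht)]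
  · linarith [(le_abs_self _).trans (h1 x t ht)]
  · rw [inv_le_comm₀ hM0 (S.θ_pos _)]
    linarith [(le_abs_self _).trans (h4 x t ht)]
  · linarith [(le_abs_self _).trans (h3 x t ht)]
  · linarith [h5 x t ht]
  · linarith [h6 x t ht]
  · linarith [h7 x t ht]
  · linarith [h8 x t ht]
  · linarith [h9 x t ht]

theorem exists_bound_of_state {F : ℝ × ℝ → ℝ} (hF : ContinuousOn F (Ioi 0 ×ˢ Ioi 0)) :
    ∃ C, 0 ≤ C ∧ ∀ x, ∀ t ∈ Icc 0 T, F (S.v (x, t), S.θ.f (x, t)) ≤ C := by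
  obtain ⟨M, hM1, hM⟩ := S.exists_state_bound
  have hM0 : 0 < M⁻¹ := by positivity
  obtain ⟨C, hC⟩ := ((isCompact_Icc (a := M⁻¹) (b := M)).prod (isCompact_Icc (a := M⁻¹) (b := M)))
    |>.exists_bound_of_continuousOn (hF.mono fun p hp =>
      ⟨hM0.trans_le hp.1.1, hM0.trans_le hp.2.1⟩)
  refine ⟨|C|, abs_nonneg C, fun x t ht => ?_⟩
  have h := hM x t ht
  exact (le_abs_self _).trans ((hC (_, _) ⟨h.1, h.2.1⟩).trans (le_abs_self C))

set_option maxHeartbeats 1000000 in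
theorem flux_le {p : ℝ} (hα : 0 ≤ α) (hp : 0 < p) : ∃ A B, 0 ≤ A ∧ 0 ≤ B ∧ ∀ R, 0 < R →
    ∀ x ∈ Icc (-R) R, ∀ t ∈ Icc 0 T, -(cutoffDeriv R x * S.flux p (x, t)) ≤
      1 / 4 * (cutoff R x * S.diss p (x, t)) + A / R ^ 2
      + B / R * (|S.u.f (x, t)| + |S.wa.f (x, t)| + |S.wb.f (x, t)|) := by
  obtain ⟨M, hM1, hM⟩ := S.exists_state_bound
  have hrp : ∀ s : ℝ, ContinuousOn (fun q : ℝ × ℝ => q.2 ^ s) (Ioi 0 ×ˢ Ioi 0) := fun s =>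
    continuousOn_snd.rpow_const fun q hq => Or.inl (ne_of_gt hq.2)
  have hrv : ContinuousOn (fun q : ℝ × ℝ => visc α q.1) (Ioi 0 ×ˢ Ioi 0) := by
    unfold visc
    exact continuousOn_const.add (continuousOn_const.mul
      (continuousOn_fst.rpow_const fun q hq => Or.inl (ne_of_gt hq.1)))
  have hv0 : ∀ q ∈ (Ioi 0 ×ˢ Ioi 0 : Set (ℝ × ℝ)), q.1 ≠ 0 := fun q hq => ne_of_gt hq.1
  obtain ⟨C₁, h10, h1⟩ := S.exists_bound_of_state
    (F := fun q => visc α q.1 / q.1 / q.2 ^ (-p)) ((hrv.div continuousOn_fst hv0).div (hrp _)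
      fun q hq => (Real.rpow_pos_of_pos hq.2 _).ne')
  obtain ⟨C₂, h20, h2⟩ := S.exists_bound_of_state
    (F := fun q => 1 / q.1 / q.2 ^ (-p)) ((continuousOn_const.div continuousOn_fst hv0).div (hrp _)
      fun q hq => (Real.rpow_pos_of_pos hq.2 _).ne')
  obtain ⟨C₃, h30, h3⟩ := S.exists_bound_of_state
    (F := fun q => (1 - q.2 ^ (-p)) ^ 2 * q.2 ^ β * q.2 / q.2 ^ (-p) / q.1 / p)
    ((((((((continuousOn_const.sub (hrp _)).pow 2).mul (hrp _)).mul continuousOn_snd).div (hrp _)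
      fun q hq => (Real.rpow_pos_of_pos hq.2 _).ne')).div continuousOn_fst hv0).div_const p)
  obtain ⟨C₄, h40, h4⟩ := S.exists_bound_of_state
    (F := fun q => q.2 / q.1) (continuousOn_snd.div continuousOn_fst hv0)
  refine ⟨16 * (M ^ 2 * C₁ + 4 * (M ^ 2 * C₂) + C₃), 4 * (C₄ + 2 * M ^ 2 + 1 + M), by positivity,
    by positivity, fun R hR x hx t ht => ?_⟩
  obtain ⟨-, -, hu, hwa, hwb, hba, hbb⟩ := hM x t ht
  specialize h1 x t ht
  specialize h2 x t ht
  specialize h3 x t ht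
  specialize h4 x t ht
  have hv := S.v_pos (x, t)
  have hθ := S.θ_pos (x, t)
  have hpw := S.pw_pos (-p) (x, t)
  have hpβ := S.pw_pos β (x, t)
  have hmu := S.one_le_mu hα (x, t)
  change S.mu (x, t) / S.v (x, t) / S.pw (-p) (x, t) ≤ C₁ at h1
  change 1 / S.v (x, t) / S.pw (-p) (x, t) ≤ C₂ at h2
  change (1 - S.pw (-p) (x, t)) ^ 2 * S.pw β (x, t) * S.θ.f (x, t) / S.pw (-p) (x, t) / S.v (x, t) / p
    ≤ C₃ at h3
  change S.θ.f (x, t) / S.v (x, t) ≤ C₄ at h4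
  have sqb : ∀ {z : ℝ}, |z| ≤ M → z ^ 2 ≤ M ^ 2 := fun {z} hz => by
    rw [← sq_abs]; exact pow_le_pow_left₀ (abs_nonneg z) hz 2
  have d1 := cutoffDeriv_mul_le (X := S.u.f (x, t) * (S.mu (x, t) / S.v (x, t) * S.u.x (x, t)))
    (Y := S.mu (x, t) * S.u.x (x, t) ^ 2 / S.v (x, t) * S.pw (-p) (x, t)) (Z := M ^ 2 * C₁)
    hR (by norm_num : (0:ℝ) < 1 / 4) hx (by positivity) (by positivity) (by
      calc _ = S.mu (x, t) * S.u.x (x, t) ^ 2 / S.v (x, t) * S.pw (-p) (x, t) *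
            (S.u.f (x, t) ^ 2 * (S.mu (x, t) / S.v (x, t) / S.pw (-p) (x, t))) := by field_simp
        _ ≤ _ := by gcongr ?_ * (?_ * ?_); exact sqb hu)
  have dw : ∀ f g : ℝ, |f| ≤ M → _ := fun f g hf => cutoffDeriv_mul_le (X := f * g / S.v (x, t))
    (Y := g ^ 2 / S.v (x, t) * S.pw (-p) (x, t)) (Z := M ^ 2 * C₂)
    hR (by norm_num : (0:ℝ) < 1 / 4) hx (by positivity) (by positivity) (by
      calc _ = g ^ 2 / S.v (x, t) * S.pw (-p) (x, t) *
            (f ^ 2 * (1 / S.v (x, t) / S.pw (-p) (x, t))) := by field_simp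
        _ ≤ _ := by gcongr ?_ * (?_ * ?_); exact sqb hf)
  have d2 := dw _ (S.wa.x (x, t)) hwa
  have d3 := dw _ (S.wb.x (x, t)) hwb
  have d4 := dw _ (S.ba.x (x, t)) hba
  have d5 := dw _ (S.bb.x (x, t)) hbb
  have d6 := cutoffDeriv_mul_le
    (X := (1 - S.pw (-p) (x, t)) * (S.pw β (x, t) * S.θ.x (x, t) / S.v (x, t)))
    (Y := p * (S.pw β (x, t) * S.pw (-p) (x, t) / S.θ.f (x, t) * S.θ.x (x, t) ^ 2 / S.v (x, t)))
    (Z := C₃) hR (by norm_num : (0:ℝ) < 1 / 4) hx (by positivity) (by positivity) (by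
      calc _ = p * (S.pw β (x, t) * S.pw (-p) (x, t) / S.θ.f (x, t) * S.θ.x (x, t) ^ 2 / S.v (x, t))
            * ((1 - S.pw (-p) (x, t)) ^ 2 * S.pw β (x, t) * S.θ.f (x, t) / S.pw (-p) (x, t)
              / S.v (x, t) / p) := by field_simp
        _ ≤ _ := by gcongr)
  have d7 : -(cutoffDeriv R x * (S.u.f (x, t) * (1 - S.pressure (x, t))
      + (S.wa.f (x, t) * S.ba.f (x, t) + S.wb.f (x, t) * S.bb.f (x, t))))
      ≤ 4 * (C₄ + 2 * M ^ 2 + 1 + M) / R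
        * (|S.u.f (x, t)| + |S.wa.f (x, t)| + |S.wb.f (x, t)|) := by
    refine (neg_le_abs _).trans ?_
    rw [abs_mul]
    have e1 := abs_cutoffDeriv_le hR hx
    have e2 : |1 - S.pressure (x, t)| ≤ C₄ + 2 * M ^ 2 + 1 + M := by
      have := sqb hba
      have := sqb hbb
      have : 0 < S.θ.f (x, t) / S.v (x, t) := by positivity
      unfold pressure
      rw [abs_le]
      constructor <;> linarith [sq_nonneg (S.ba.f (x, t)), sq_nonneg (S.bb.f (x, t))]
    have e3 : M ≤ C₄ + 2 * M ^ 2 + 1 + M := by linarith [sq_nonneg M]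
    calc _ ≤ 4 / R * ((C₄ + 2 * M ^ 2 + 1 + M)
          * (|S.u.f (x, t)| + |S.wa.f (x, t)| + |S.wb.f (x, t)|)) := by
          gcongr
          exact abs_mul_add_mul_add_mul_le e2 (hba.trans e3) (hbb.trans e3)
      _ = _ := by ring
  have eG : S.flux p (x, t) = S.u.f (x, t) * (S.mu (x, t) / S.v (x, t) * S.u.x (x, t))
      + S.wa.f (x, t) * S.wa.x (x, t) / S.v (x, t) + S.wb.f (x, t) * S.wb.x (x, t) / S.v (x, t)
      + S.ba.f (x, t) * S.ba.x (x, t) / S.v (x, t) + S.bb.f (x, t) * S.bb.x (x, t) / S.v (x, t)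
      + (1 - S.pw (-p) (x, t)) * (S.pw β (x, t) * S.θ.x (x, t) / S.v (x, t))
      + (S.u.f (x, t) * (1 - S.pressure (x, t))
      + (S.wa.f (x, t) * S.ba.f (x, t) + S.wb.f (x, t) * S.bb.f (x, t))) := by
    unfold flux
    ring
  have eD : S.diss p (x, t) = S.mu (x, t) * S.u.x (x, t) ^ 2 / S.v (x, t) * S.pw (-p) (x, t)
      + S.wa.x (x, t) ^ 2 / S.v (x, t) * S.pw (-p) (x, t)
      + S.wb.x (x, t) ^ 2 / S.v (x, t) * S.pw (-p) (x, t)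
      + S.ba.x (x, t) ^ 2 / S.v (x, t) * S.pw (-p) (x, t)
      + S.bb.x (x, t) ^ 2 / S.v (x, t) * S.pw (-p) (x, t)
      + p * (S.pw β (x, t) * S.pw (-p) (x, t) / S.θ.f (x, t) * S.θ.x (x, t) ^ 2 / S.v (x, t)) := by
    unfold diss heat
    ring
  have eA : 4 / (1 / 4 * R ^ 2) = 16 / R ^ 2 := by ring
  rw [eA] at d1 d2 d3 d4 d5 d6
  have eC : 16 * (M ^ 2 * C₁ + 4 * (M ^ 2 * C₂) + C₃) / R ^ 2 = 16 / R ^ 2 * (M ^ 2 * C₁)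
    + 4 * (16 / R ^ 2 * (M ^ 2 * C₂)) + 16 / R ^ 2 * C₃ := by ring
  rw [eG, eD, eC]
  linarith

theorem integral_flux_le {p : ℝ} (hα : 0 ≤ α) (hp : 0 < p) : ∃ R₀, 0 < R₀ ∧ ∀ R, R₀ ≤ R →
    ∀ t ∈ Icc 0 T, ∫ x in (-R)..R, -(cutoffDeriv R x * S.flux p (x, t)) ≤
      1 / 4 * (∫ x in (-R)..R, cutoff R x * S.diss p (x, t)) + 1 := by
  obtain ⟨A, B, hA, hB, h⟩ := S.flux_le hα hp
  obtain ⟨M, hM1, hM⟩ := S.exists_state_bound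
  set ε := 1 / (12 * (B + 1)) with hε
  have hε0 : 0 < ε := by positivity
  obtain ⟨N, hN⟩ := S.far ε hε0
  set L := M * (1 + N ^ 2) * Real.pi with hL
  have hL0 : 0 ≤ L := by have := Real.pi_pos; positivity
  refine ⟨2 * (2 * A + 3 * B * L) + 1, by positivity, fun R hR t ht => ?_⟩
  have hR0 : 0 < R := by
    have : 0 ≤ 2 * (2 * A + 3 * B * L) := by positivity
    linarith
  have hi := intervalIntegral_le_comb₃ (c₁ := 1 / 4) (c₂ := A / R ^ 2) (c₃ := B / R)
    (by linarith : -R ≤ R)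
    (f := fun x => -(cutoffDeriv R x * S.flux p (x, t)))
    (g₁ := fun x => cutoff R x * S.diss p (x, t)) (g₂ := fun _ => 1)
    (g₃ := fun x => |S.u.f (x, t)| + |S.wa.f (x, t)| + |S.wb.f (x, t)|)
    (by fun_prop) (by fun_prop) (by fun_prop) (by fun_prop)
    (fun x hx => by simpa only [mul_one] using h R hR0 x hx t ht)
  have hu := integral_abs_le_of_far (h := fun x => S.u.f (x, t)) (by fun_prop)
    (fun x => (hM x t ht).2.2.1) hε0.le (fun x hx => (hN (x, t) hx).2.1.le) hR0.le
  have hwa := integral_abs_le_of_far (h := fun x => S.wa.f (x, t)) (by fun_prop)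
    (fun x => (hM x t ht).2.2.2.1) hε0.le (fun x hx => (hN (x, t) hx).2.2.2.1.le) hR0.le
  have hwb := integral_abs_le_of_far (h := fun x => S.wb.f (x, t)) (by fun_prop)
    (fun x => (hM x t ht).2.2.2.2.1) hε0.le (fun x hx => (hN (x, t) hx).2.2.2.2.1.le) hR0.le
  rw [← hL] at hu hwa hwb
  rw [intervalIntegral.integral_add (Continuous.intervalIntegrable (by fun_prop) _ _)
    (Continuous.intervalIntegrable (by fun_prop) _ _),
    intervalIntegral.integral_add (Continuous.intervalIntegrable (by fun_prop) _ _)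
    (Continuous.intervalIntegrable (by fun_prop) _ _), intervalIntegral.integral_const] at hi
  refine hi.trans ?_
  have e1 : B / R * ((∫ x in (-R)..R, |S.u.f (x, t)|) + (∫ x in (-R)..R, |S.wa.f (x, t)|)
      + ∫ x in (-R)..R, |S.wb.f (x, t)|) ≤ B / R * (6 * R * ε + 3 * L) := by
    refine mul_le_mul_of_nonneg_left ?_ (by positivity)
    linarith
  have e2 : B / R * (6 * R * ε + 3 * L) = B / (B + 1) / 2 + 3 * B * L / R := by
    rw [hε]; field_simp; ring
  have e3 : B / (B + 1) ≤ 1 := by rw [div_le_one (by positivity)]; linarith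
  have e4 : A / R ^ 2 * ((R - -R) • 1) = 2 * A / R := by
    simp only [smul_eq_mul]; field_simp; ring
  have e5 : 2 * A / R + 3 * B * L / R ≤ 1 / 2 := by
    rw [← add_div, div_le_iff₀ hR0]
    linarith
  rw [e4]
  linarith

end MHDFlow

end Qualitative

section BasicEnergy

variable {α β T K δ : ℝ}

theorem integral_le_of_symm {f : ℝ → ℝ} (hf : Continuous f) (h0 : ∀ x, 0 ≤ f x) {C : ℝ}
    (h : ∀ r, 0 ≤ r → ∫ x in (-r)..r, f x ≤ C) {a b : ℝ} (hab : a ≤ b) :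
    ∫ x in a..b, f x ≤ C := by
  refine le_trans ?_ (h (max |a| |b|) (by positivity))
  refine intervalIntegral.integral_mono_interval ?_ hab ?_ (Eventually.of_forall h0)
    (hf.intervalIntegrable _ _)
  · linarith [le_max_left |a| |b|, neg_abs_le a]
  · linarith [le_max_right |a| |b|, le_abs_self b]

theorem sq_le_two_mul_of_integral_unit {f f' : ℝ → ℝ} (hf : ∀ x, HasDerivAt f (f' x) x)
    (hc : Continuous f') {x C : ℝ} (h : ∫ y in x..(x + 1), (f y ^ 2 + f' y ^ 2) ≤ C) :
    f x ^ 2 ≤ 2 * C := by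
  have hfc : Continuous f := continuous_iff_continuousAt.2 fun x => (hf x).continuousAt
  have h1 : ∫ y in x..(x + 1), f y ^ 2 ≤ C :=
    (intervalIntegral_mono_of_continuous (by linarith) (by fun_prop) (by fun_prop)
      fun y _ => by linarith [sq_nonneg (f' y)]).trans h
  obtain ⟨y, hy, hfy⟩ := exists_le_of_integral_unit_le (f := fun y => f y ^ 2) (by fun_prop) h1
  have h2 : ∫ z in x..y, 2 * f z * f' z = f y ^ 2 - f x ^ 2 := by
    refine intervalIntegral.integral_eq_sub_of_hasDerivAt (f := fun z => f z ^ 2)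
      (fun z _ => ?_) (Continuous.intervalIntegrable (by fun_prop) _ _)
    exact ((hf z).pow 2).congr_deriv (by ring)
  have h3 : -(∫ z in x..y, (f z ^ 2 + f' z ^ 2)) ≤ ∫ z in x..y, 2 * f z * f' z := by
    rw [← intervalIntegral.integral_neg]
    exact intervalIntegral_mono_of_continuous hy.1 (by fun_prop) (by fun_prop)
      fun z _ => by linarith [sq_nonneg (f z + f' z)]
  have h4 : ∫ z in x..y, (f z ^ 2 + f' z ^ 2) ≤ ∫ z in x..(x + 1), (f z ^ 2 + f' z ^ 2) :=
    intervalIntegral.integral_mono_interval le_rfl hy.1 hy.2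
      (Eventually.of_forall fun z => by positivity) (Continuous.intervalIntegrable (by fun_prop) _ _)
  linarith

/-- The convex function `z - log z - 1`. -/
def thermal (z : ℝ) : ℝ := z - Real.log z - 1

theorem hasDerivAt_thermal {z : ℝ} (hz : 0 < z) : HasDerivAt thermal (1 - z ^ (-(1:ℝ))) z := by
  rw [Real.rpow_neg_one]
  exact ((hasDerivAt_id z).sub (Real.hasDerivAt_log hz.ne')).sub_const 1

theorem thermal_nonneg {z : ℝ} (hz : 0 < z) : 0 ≤ thermal z := by
  unfold thermal
  linarith [Real.log_le_sub_one_of_pos hz]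

theorem thermal_le {z : ℝ} (hz : 0 < z) : thermal z ≤ (z - 1) ^ 2 / z := by
  unfold thermal
  have h := Real.log_le_sub_one_of_pos (inv_pos.2 hz)
  rw [Real.log_inv] at h
  have : (z - 1) ^ 2 / z = z - 2 + z⁻¹ := by field_simp; ring
  linarith

theorem le_two_mul_thermal_add {z : ℝ} (hz : 0 < z) : z ≤ 2 * (thermal z + 1) := by
  unfold thermal
  have h := Real.log_le_sub_one_of_pos (by positivity : 0 < z / 2)
  rw [Real.log_div hz.ne' two_ne_zero] at h
  have := Real.log_two_lt_d9
  linarith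

namespace MHDFlow

theorem Adm.integral_le {S : MHDFlow α β T} (hS : S.Adm K δ) {f : ℝ → ℝ} (hf : Continuous f)
    {c : ℝ} (hc : 0 ≤ c)
    (h : ∀ x, f x ≤ c * ((S.v (x, 0) - 1) ^ 2 + S.u.f (x, 0) ^ 2
    + (S.θ.f (x, 0) - 1) ^ 2 + (S.ba.f (x, 0) ^ 2 + S.bb.f (x, 0) ^ 2)
    + (S.wa.f (x, 0) ^ 2 + S.wb.f (x, 0) ^ 2) + S.vx (x, 0) ^ 2 + S.u.x (x, 0) ^ 2
    + S.θ.x (x, 0) ^ 2 + (S.ba.x (x, 0) ^ 2 + S.bb.x (x, 0) ^ 2)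
    + (S.wa.x (x, 0) ^ 2 + S.wb.x (x, 0) ^ 2))) {a b : ℝ} (hab : a ≤ b) :
    ∫ x in a..b, f x ≤ c * K ^ 2 := by
  refine (intervalIntegral_mono_of_continuous hab hf (by fun_prop) fun x _ => h x).trans ?_
  rw [intervalIntegral.integral_const_mul]
  exact mul_le_mul_of_nonneg_left (integral_le_of_symm (by fun_prop) (fun x => by positivity)
    hS.bound hab) hc

theorem Adm.v_le {S : MHDFlow α β T} (hS : S.Adm K δ) (x : ℝ) : S.v (x, 0) ≤ 2 + 2 * K ^ 2 := by
  have := sq_le_two_mul_of_integral_unit (f := fun x => S.v (x, 0) - 1) (f' := fun x => S.vx (x, 0))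
    (fun x => (S.hvx x 0).sub_const 1) (by fun_prop) (x := x) (hS.integral_le (by fun_prop)
      zero_le_one (fun x => by
        linarith [sq_nonneg (S.u.f (x, 0)), sq_nonneg (S.θ.f (x, 0) - 1),
          sq_nonneg (S.ba.f (x, 0)), sq_nonneg (S.bb.f (x, 0)),
          sq_nonneg (S.wa.f (x, 0)), sq_nonneg (S.wb.f (x, 0)), sq_nonneg (S.u.x (x, 0)),
          sq_nonneg (S.θ.x (x, 0)), sq_nonneg (S.ba.x (x, 0)), sq_nonneg (S.bb.x (x, 0)),
          sq_nonneg (S.wa.x (x, 0)), sq_nonneg (S.wb.x (x, 0))]) (by linarith))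
  nlinarith [sq_nonneg (S.v (x, 0) - 1 - 1)]

theorem Adm.θ_le {S : MHDFlow α β T} (hS : S.Adm K δ) (x : ℝ) : S.θ.f (x, 0) ≤ 2 + 2 * K ^ 2 := by
  have := sq_le_two_mul_of_integral_unit (f := fun x => S.θ.f (x, 0) - 1)
    (f' := fun x => S.θ.x (x, 0))
    (fun x => (S.θ.hx x 0).sub_const 1) (by fun_prop) (x := x) (hS.integral_le (by fun_prop)
      zero_le_one (fun x => by
        linarith [sq_nonneg (S.v (x, 0) - 1), sq_nonneg (S.u.f (x, 0)),
          sq_nonneg (S.ba.f (x, 0)), sq_nonneg (S.bb.f (x, 0)),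
          sq_nonneg (S.wa.f (x, 0)), sq_nonneg (S.wb.f (x, 0)), sq_nonneg (S.vx (x, 0)),
          sq_nonneg (S.u.x (x, 0)), sq_nonneg (S.ba.x (x, 0)), sq_nonneg (S.bb.x (x, 0)),
          sq_nonneg (S.wa.x (x, 0)), sq_nonneg (S.wb.x (x, 0))]) (by linarith))
  nlinarith [sq_nonneg (S.θ.f (x, 0) - 1 - 1)]

theorem energy_nonneg (S : MHDFlow α β T) {H : ℝ → ℝ} (hH : ∀ z, 0 < z → 0 ≤ H z) (q : ℝ × ℝ) :
    0 ≤ S.energy H q := by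
  have h1 := S.v_pos q
  have h2 := hH _ (S.θ_pos q)
  have h3 := thermal_nonneg h1
  unfold thermal at h3
  unfold energy
  positivity

theorem Adm.integral_energy_le {S : MHDFlow α β T} (hS : S.Adm K δ) (hδ : 0 < δ) {a b : ℝ}
    (hab : a ≤ b) :
    ∫ x in a..b, S.energy thermal (x, 0) ≤ (1 + (2 + 2 * K ^ 2) + δ⁻¹) * K ^ 2 := by
  have hE := S.continuous_energy (fun _ => hasDerivAt_thermal)
  refine hS.integral_le (by fun_prop) (by positivity) (fun x => ?_) hab
  have hv := S.v_pos (x, 0)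
  have hθ := S.θ_pos (x, 0)
  have h1 : thermal (S.v (x, 0)) ≤ δ⁻¹ * (S.v (x, 0) - 1) ^ 2 := by
    refine (thermal_le hv).trans ?_
    rw [div_eq_inv_mul]
    have := hS.v_ge x
    gcongr
  have h2 : thermal (S.θ.f (x, 0)) ≤ δ⁻¹ * (S.θ.f (x, 0) - 1) ^ 2 := by
    refine (thermal_le hθ).trans ?_
    rw [div_eq_inv_mul]
    have := hS.θ_ge x
    gcongr
  have h3 : S.v (x, 0) * (S.ba.f (x, 0) ^ 2 + S.bb.f (x, 0) ^ 2)
      ≤ (2 + 2 * K ^ 2) * (S.ba.f (x, 0) ^ 2 + S.bb.f (x, 0) ^ 2) := by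
    have := hS.v_le x
    gcongr
  rw [show S.energy thermal (x, 0) = (S.u.f (x, 0) ^ 2 + (S.wa.f (x, 0) ^ 2 + S.wb.f (x, 0) ^ 2)
    + S.v (x, 0) * (S.ba.f (x, 0) ^ 2 + S.bb.f (x, 0) ^ 2)) / 2
    + thermal (S.v (x, 0)) + thermal (S.θ.f (x, 0)) from rfl]
  have hd : 0 < δ⁻¹ := by positivity
  set U := S.u.f (x, 0) ^ 2 + (S.wa.f (x, 0) ^ 2 + S.wb.f (x, 0) ^ 2)
  set V := (S.v (x, 0) - 1) ^ 2
  set Θ := (S.θ.f (x, 0) - 1) ^ 2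
  set B := S.ba.f (x, 0) ^ 2 + S.bb.f (x, 0) ^ 2
  have hU : 0 ≤ U := by positivity
  have hV : 0 ≤ V := by positivity
  have hΘ : 0 ≤ Θ := by positivity
  have hB : 0 ≤ B := by positivity
  have hKB : 0 ≤ (2 + 2 * K ^ 2) * B := by positivity
  calc _ ≤ 1 * U + (2 + 2 * K ^ 2) * B + δ⁻¹ * (V + Θ) := by linarith
    _ ≤ (1 + (2 + 2 * K ^ 2) + δ⁻¹) * (U + B + (V + Θ)) := by
      have : 0 ≤ 1 * (B + (V + Θ)) + (2 + 2 * K ^ 2) * (U + (V + Θ)) + δ⁻¹ * (U + B) := by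
        positivity
      linarith
    _ ≤ _ := by
      refine mul_le_mul_of_nonneg_left ?_ (by positivity)
      simp only [U]
      nlinarith [sq_nonneg (S.vx (x, 0)), sq_nonneg (S.u.x (x, 0)), sq_nonneg (S.θ.x (x, 0)),
        sq_nonneg (S.ba.x (x, 0)), sq_nonneg (S.bb.x (x, 0)), sq_nonneg (S.wa.x (x, 0)),
        sq_nonneg (S.wb.x (x, 0))]

theorem energy_balance (S : MHDFlow α β T) {p : ℝ} (hα : 0 ≤ α) (hp : 0 < p) {H : ℝ → ℝ}
    (hH : ∀ z, 0 < z → HasDerivAt H (1 - z ^ (-p)) z) :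
    ∃ R₀, 0 < R₀ ∧ ∀ R, R₀ ≤ R → ∀ t ∈ Ioo 0 T,
      HasDerivAt (fun s => ∫ x in (-R)..R, cutoff R x * S.energy H (x, s))
        (∫ x in (-R)..R, cutoff R x * S.energyDot p (x, t)) t ∧
      (∫ x in (-R)..R, cutoff R x * S.energyDot p (x, t))
        + 3 / 4 * (∫ x in (-R)..R, cutoff R x * S.diss p (x, t)) ≤
      (∫ x in (-R)..R, cutoff R x * ((S.θ.f (x, t) * S.pw (-p) (x, t) - 1) * S.u.x (x, t)
        / S.v (x, t))) + 1 := by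
  obtain ⟨R₀, hR₀, h⟩ := S.integral_flux_le hα hp
  refine ⟨R₀, hR₀, fun R hR t ht => ⟨?_, ?_⟩⟩
  · have hE := S.continuous_energy hH
    exact hasDerivAt_integral_of_continuous (f := fun x s => cutoff R x * S.energy H (x, s))
      (g := fun x s => cutoff R x * S.energyDot p (x, s)) (by fun_prop) (by fun_prop)
      (fun x s hs => (S.hasDerivAt_energy hH x hs).const_mul _) ht
  · have hR0 : 0 < R := hR₀.trans_le hR
    have hv := S.v_ne
    have h1 := h R hR t (Ioo_subset_Icc_self ht)
    have h2 := integral_cutoff_flux hR0 (G := fun x => S.flux p (x, t))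
      (fun x => S.hasDerivAt_flux p x t) (by fun_prop (disch := intro; exact hv _))
    have h3 : ∫ x in (-R)..R, cutoff R x * S.energyDot p (x, t) =
        (∫ x in (-R)..R, (cutoffDeriv R x * S.flux p (x, t) + cutoff R x *
          (S.energyDot p (x, t) + S.diss p (x, t)
            - (S.θ.f (x, t) * S.pw (-p) (x, t) - 1) * S.u.x (x, t) / S.v (x, t))))
        + (∫ x in (-R)..R, -(cutoffDeriv R x * S.flux p (x, t)))
        - (∫ x in (-R)..R, cutoff R x * S.diss p (x, t))
        + ∫ x in (-R)..R, cutoff R x * ((S.θ.f (x, t) * S.pw (-p) (x, t) - 1) * S.u.x (x, t)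
        / S.v (x, t)) := by
      have ii : ∀ {f : ℝ → ℝ}, Continuous f → IntervalIntegrable f volume (-R) R :=
        fun hf => hf.intervalIntegrable _ _
      rw [← intervalIntegral.integral_add (ii (by fun_prop (disch := intro; exact hv _)))
        (ii (by fun_prop)), ← intervalIntegral.integral_sub
        (ii (by fun_prop (disch := intro; exact hv _))) (ii (by fun_prop)),
        ← intervalIntegral.integral_add (ii (by fun_prop (disch := intro; exact hv _)))
        (ii (by fun_prop (disch := intro; exact hv _)))]
      refine intervalIntegral.integral_congr fun x _ => ?_
      ring
    rw [h3, h2]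
    linarith

/-- The basic energy estimate. -/
theorem exists_energy_bound (hα : 0 ≤ α) (β : ℝ) (hT : 0 < T) (K : ℝ) (hδ : 0 < δ) :
    ∃ C, 0 < C ∧ ∀ S : MHDFlow α β T, S.Adm K δ → ∀ t ∈ Icc 0 T, ∀ a b, a ≤ b →
      ∫ x in a..b, S.energy thermal (x, t) ≤ C := by
  refine ⟨2 * ((1 + (2 + 2 * K ^ 2) + δ⁻¹) * K ^ 2 + T), by positivity, fun S hS t ht a b hab => ?_⟩
  have hE := S.continuous_energy (fun _ => hasDerivAt_thermal)
  have hE0 := S.energy_nonneg (fun _ => thermal_nonneg)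
  refine integral_le_of_symm (by fun_prop) (fun x => hE0 _) (fun r hr => ?_) hab
  obtain ⟨R₀, hR₀, h⟩ := S.energy_balance (p := 1) hα one_pos (fun _ => hasDerivAt_thermal)
  set R := max R₀ (2 * r)
  have hR0 : 0 < R := hR₀.trans_le (le_max_left _ _)
  have hg := gronwall_with_dissipation (A := 0) (B := T) (a := fun _ => 0) (g := fun _ => 1) hT
    (y := fun s => ∫ x in (-R)..R, cutoff R x * S.energy thermal (x, s))
    (y' := fun s => ∫ x in (-R)..R, cutoff R x * S.energyDot 1 (x, s))
    (z := fun s => 3 / 4 * ∫ x in (-R)..R, cutoff R x * S.diss 1 (x, s))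
    (by fun_prop) (by fun_prop) (by fun_prop) (by fun_prop)
    (fun s hs => (h R (le_max_left _ _) s hs).1) (fun s hs => by
      refine (h R (le_max_left _ _) s hs).2.trans ?_
      have h0 : ∀ x, (S.θ.f (x, s) * S.pw (-1) (x, s) - 1) * S.u.x (x, s) / S.v (x, s) = 0 := by
        intro x
        rw [pw, Real.rpow_neg_one, mul_inv_cancel₀ (S.θ_ne _)]
        simp
      simp [h0])
    (fun s => mul_nonneg (by norm_num) (intervalIntegral.integral_nonneg (by linarith) fun x _ =>
      mul_nonneg (cutoff_nonneg R x) (S.diss_nonneg hα zero_le_one _)))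
    (fun _ => le_rfl) (fun _ => zero_le_one)
    (intervalIntegral.integral_nonneg (by linarith) fun x _ =>
      mul_nonneg (cutoff_nonneg R x) (hE0 _)) (by simp) (by simp) t ht
  have h1 := integral_le_two_mul_cutoff hR0 hr (le_max_right _ _)
    (f := fun x => S.energy thermal (x, t)) (by fun_prop) (fun x => hE0 _)
  have h2 : 0 ≤ ∫ s in (0:ℝ)..t, 3 / 4 * ∫ x in (-R)..R, cutoff R x * S.diss 1 (x, s) :=
    intervalIntegral.integral_nonneg ht.1 fun s _ => mul_nonneg (by norm_num)
      (intervalIntegral.integral_nonneg (by linarith) fun x _ =>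
      mul_nonneg (cutoff_nonneg R x) (S.diss_nonneg hα zero_le_one _))
  have h3 : ∫ x in (-R)..R, cutoff R x * S.energy thermal (x, 0)
      ≤ (1 + (2 + 2 * K ^ 2) + δ⁻¹) * K ^ 2 := by
    refine le_trans ?_ (hS.integral_energy_le hδ (by linarith : -R ≤ R))
    exact intervalIntegral_mono_of_continuous (by linarith) (by fun_prop) (by fun_prop)
      fun x hx => mul_le_of_le_one_left (hE0 _) (cutoff_le_one hR0 hx)
  simp only [Real.exp_zero, one_mul] at hg
  linarith

end MHDFlow

end BasicEnergy

section VolumeBounds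

variable {α β T K δ : ℝ}

/-- A primitive of `visc α z / z`. -/
def viscPot (α z : ℝ) : ℝ := Real.log z - z ^ (-α)

theorem hasDerivAt_viscPot (α : ℝ) {z : ℝ} (hz : 0 < z) :
    HasDerivAt (viscPot α) (visc α z / z) z := by
  refine ((Real.hasDerivAt_log hz.ne').sub
    (Real.hasDerivAt_rpow_const (p := -α) (Or.inl hz.ne'))).congr_deriv ?_
  rw [visc, Real.rpow_sub_one hz.ne']
  field_simp
  ring

theorem viscPot_le_log {z : ℝ} (hz : 0 < z) : viscPot α z ≤ Real.log z := by
  have : 0 < z ^ (-α) := by positivity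
  unfold viscPot
  linarith

theorem viscPot_le_viscPot (hα : 0 ≤ α) {y z : ℝ} (hy : 0 < y) (h : y ≤ z) :
    viscPot α y ≤ viscPot α z := by
  unfold viscPot
  have h1 := Real.log_le_log hy h
  have h2 : z ^ (-α) ≤ y ^ (-α) := Real.rpow_le_rpow_of_nonpos hy h (by linarith)
  linarith

theorem exp_viscPot_le {z : ℝ} (hz : 0 < z) : Real.exp (viscPot α z) ≤ z := by
  have := Real.exp_le_exp.2 (viscPot_le_log (α := α) hz)
  rwa [Real.exp_log hz] at this

theorem le_exp_viscPot (hα : 0 ≤ α) {C z : ℝ} (hC : 0 < C) (hz : 0 < z) :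
    Real.exp (viscPot α (Real.exp (-2 * C - 1))) * (1 - thermal z / (2 * C))
      ≤ Real.exp (viscPot α z) := by
  rcases le_total (Real.exp (-2 * C - 1)) z with h | h
  · have h1 := Real.exp_le_exp.2 (viscPot_le_viscPot hα (Real.exp_pos _) h)
    refine le_trans (mul_le_of_le_one_right (Real.exp_pos _).le ?_) h1
    have : 0 ≤ thermal z / (2 * C) := div_nonneg (thermal_nonneg hz) (by linarith)
    linarith
  · refine le_trans (mul_nonpos_of_nonneg_of_nonpos (Real.exp_pos _).le ?_) (Real.exp_pos _).le
    have h1 := Real.log_le_log hz h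
    rw [Real.log_exp] at h1
    have h2 : 2 * C ≤ thermal z := by unfold thermal; linarith
    have : 1 ≤ thermal z / (2 * C) := by rwa [le_div_iff₀ (by linarith), one_mul]
    linarith

namespace MHDFlow

/-- The time integral of the pressure. -/
def impulse (S : MHDFlow α β T) (x t : ℝ) : ℝ := ∫ s in (0:ℝ)..t, S.pressure (x, s)

theorem continuous_impulse (S : MHDFlow α β T) : Continuous fun q : ℝ × ℝ => S.impulse q.1 q.2 :=
  intervalIntegral.continuous_parametric_intervalIntegral_of_continuous
    (f := fun (q : ℝ × ℝ) s => S.pressure (q.1, s)) (by fun_prop) continuous_snd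

theorem hasDerivAt_impulse (S : MHDFlow α β T) (x t : ℝ) :
    HasDerivAt (S.impulse x) (S.pressure (x, t)) t :=
  intervalIntegral.integral_hasDerivAt_right
    (Continuous.intervalIntegrable (by fun_prop) _ _)
    (Continuous.stronglyMeasurableAtFilter (by fun_prop) _ _) (Continuous.continuousAt (by fun_prop))

theorem pressure_pos (S : MHDFlow α β T) (q : ℝ × ℝ) : 0 < S.pressure q := by
  have := S.v_pos q
  have := S.θ_pos q
  unfold pressure
  positivity

theorem impulse_nonneg (S : MHDFlow α β T) (x : ℝ) {t : ℝ} (ht : 0 ≤ t) : 0 ≤ S.impulse x t :=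
  intervalIntegral.integral_nonneg ht fun _ _ => (S.pressure_pos _).le

theorem continuous_viscPot (S : MHDFlow α β T) : Continuous fun q => viscPot α (S.v q) :=
  continuous_iff_continuousAt.2 fun q => ContinuousAt.comp (f := S.v)
    (hasDerivAt_viscPot α (S.v_pos q)).continuousAt S.v.continuous.continuousAt

theorem hasDerivAt_visc_flux_x (S : MHDFlow α β T) (x t : ℝ) :
    HasDerivAt (fun y => S.mu (y, t) / S.v (y, t) * S.u.x (y, t) - S.pressure (y, t))
      (S.u.t (x, t)) x := by
  refine (((S.hasDerivAt_mu_div_x x t).mul (S.u.hxx x t)).sub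
    (S.hasDerivAt_pressure_x x t)).congr_deriv ?_
  rw [S.eq_u, mu]
  ring

theorem viscPot_sub_viscPot (S : MHDFlow α β T) (x y : ℝ) {t : ℝ} (ht : t ∈ Icc 0 T) :
    (viscPot α (S.v (y, t)) - viscPot α (S.v (x, t)) - (S.impulse y t - S.impulse x t)
      - ∫ z in x..y, S.u.f (z, t))
    = viscPot α (S.v (y, 0)) - viscPot α (S.v (x, 0)) - ∫ z in x..y, S.u.f (z, 0) := by
  have hF := S.continuous_viscPot
  have hI := S.continuous_impulse
  have h1 : ∀ z, ∀ s ∈ Ioo 0 T, HasDerivAt (fun s => viscPot α (S.v (z, s)))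
      (S.mu (z, s) / S.v (z, s) * S.u.x (z, s)) s := fun z s hs =>
    HasDerivAt.comp (h₂ := viscPot α) s (hasDerivAt_viscPot α (S.v_pos (z, s))) (S.hvt z s hs)
  have hc : ∀ z, Continuous fun s => S.impulse z s := fun z =>
    hI.comp (Continuous.prodMk continuous_const continuous_id)
  have hc' : ∀ z, Continuous fun s => viscPot α (S.v (z, s)) := fun z =>
    hF.comp (Continuous.prodMk continuous_const continuous_id)
  have h2 := intervalIntegral.integral_eq_sub_of_hasDerivAt_of_le ht.1
    (f := fun s => viscPot α (S.v (y, s)) - viscPot α (S.v (x, s))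
      - (S.impulse y s - S.impulse x s) - ∫ z in x..y, S.u.f (z, s)) (f' := fun _ => 0)
    (Continuous.continuousOn ((((hc' y).sub (hc' x)).sub ((hc y).sub (hc x))).sub (by fun_prop)))
    (fun s hs => by
      have hs' : s ∈ Ioo 0 T := ⟨hs.1, hs.2.trans_le ht.2⟩
      refine ((((h1 y s hs').sub (h1 x s hs')).sub ((S.hasDerivAt_impulse y s).sub
        (S.hasDerivAt_impulse x s))).sub
        (hasDerivAt_integral_of_continuous (f := fun z s => S.u.f (z, s))
          (g := fun z s => S.u.t (z, s)) (by fun_prop) (by fun_prop)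
          (fun z s hs => S.u.ht z s hs) hs')).congr_deriv ?_
      have := intervalIntegral.integral_eq_sub_of_hasDerivAt (a := x) (b := y)
        (fun z _ => S.hasDerivAt_visc_flux_x z s) (Continuous.intervalIntegrable (by fun_prop) _ _)
      linarith) (by simp)
  have h3 : ∀ z, S.impulse z 0 = 0 := fun z => intervalIntegral.integral_same
  simp only [intervalIntegral.integral_zero, h3] at h2
  linarith

theorem exists_viscPot_compare (hα : 0 ≤ α) (β : ℝ) (hT : 0 < T) (K : ℝ) (hδ : 0 < δ) :
    ∃ C, 0 < C ∧ ∀ S : MHDFlow α β T, S.Adm K δ → ∀ t ∈ Icc 0 T, ∀ x y, |x - y| ≤ 1 →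
      viscPot α (S.v (y, t)) + S.impulse x t ≤ viscPot α (S.v (x, t)) + S.impulse y t + C := by
  obtain ⟨C, hC, h⟩ := exists_energy_bound hα β hT K hδ
  have hD : 0 < |viscPot α (2 + 2 * K ^ 2)| + |viscPot α δ| + (2 * C + 2) := by positivity
  refine ⟨_, hD, fun S hS t ht x y hxy => ?_⟩
  have hu : ∀ s ∈ Icc 0 T, ∀ a b, a ≤ b → b ≤ a + 1 → |∫ z in a..b, S.u.f (z, s)| ≤ C + 1 := by
    intro s hs a b hab hab'
    refine (intervalIntegral.abs_integral_le_integral_abs hab).trans ?_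
    have hE := S.continuous_energy (fun _ => hasDerivAt_thermal)
    refine (intervalIntegral_le_comb₂ (g₁ := fun z => S.energy thermal (z, s)) (c₁ := 1)
      (g₂ := fun _ => 1) (c₂ := 1) hab (by fun_prop) (by fun_prop) (by fun_prop)
      fun z _ => ?_).trans ?_
    · have h1 := S.energy_nonneg (H := fun _ => 0) (fun _ _ => le_rfl) (z, s)
      have h2 := thermal_nonneg (S.θ_pos (z, s))
      have h3 := thermal_nonneg (S.v_pos (z, s))
      have hv := S.v_pos (z, s)
      have h4 : 0 ≤ S.v (z, s) * (S.ba.f (z, s) ^ 2 + S.bb.f (z, s) ^ 2) := by positivity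
      unfold energy
      unfold thermal at h3
      have h5 : |S.u.f (z, s)| ≤ (S.u.f (z, s) ^ 2 + 1) / 2 := by
        nlinarith [sq_nonneg (|S.u.f (z, s)| - 1), sq_abs (S.u.f (z, s))]
      linarith [sq_nonneg (S.wa.f (z, s)), sq_nonneg (S.wb.f (z, s))]
    · have := h S hS s hs a b hab
      simp only [intervalIntegral.integral_const, smul_eq_mul]
      linarith
  have hu' : ∀ s ∈ Icc 0 T, |∫ z in x..y, S.u.f (z, s)| ≤ C + 1 := by
    intro s hs
    rcases le_total x y with hx | hx
    · exact hu s hs x y hx (by linarith [abs_le.1 hxy])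
    · rw [intervalIntegral.integral_symm, abs_neg]
      exact hu s hs y x hx (by linarith [abs_le.1 hxy])
  have h1 := S.viscPot_sub_viscPot x y ht
  have h2 := abs_le.1 (hu' t ht)
  have h3 := abs_le.1 (hu' 0 ⟨le_rfl, hT.le⟩)
  have h4 := viscPot_le_viscPot hα (S.v_pos (y, 0)) (hS.v_le y)
  have h5 := viscPot_le_viscPot hα hδ (hS.v_ge x)
  linarith [le_abs_self (viscPot α (2 + 2 * K ^ 2)), neg_abs_le (viscPot α δ)]

theorem integral_v_le {S : MHDFlow α β T} {C a b t : ℝ}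
    (h : ∫ x in a..b, S.energy thermal (x, t) ≤ C) (hab : a ≤ b) :
    ∫ x in a..b, thermal (S.v (x, t)) ≤ C := by
  have hE := S.continuous_energy (fun _ => hasDerivAt_thermal)
  refine (intervalIntegral_mono_of_continuous hab ?_ (by fun_prop) fun x _ => ?_).trans h
  · have := S.v_ne
    unfold thermal
    fun_prop (disch := intro; exact S.v_ne _)
  · have h2 := thermal_nonneg (S.θ_pos (x, t))
    have hv := S.v_pos (x, t)
    unfold energy
    have : 0 ≤ (S.u.f (x, t) ^ 2 + (S.wa.f (x, t) ^ 2 + S.wb.f (x, t) ^ 2)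
      + S.v (x, t) * (S.ba.f (x, t) ^ 2 + S.bb.f (x, t) ^ 2)) / 2 := by positivity
    rw [show thermal (S.v (x, t)) = S.v (x, t) - Real.log (S.v (x, t)) - 1 from rfl]
    linarith

/-- The specific volume is bounded below, and above in terms of the impulse. -/
theorem exists_volume_bounds (hα : 0 ≤ α) (β : ℝ) (hT : 0 < T) (K : ℝ) (hδ : 0 < δ) :
    ∃ c C, 0 < c ∧ 0 < C ∧ ∀ S : MHDFlow α β T, S.Adm K δ → ∀ x, ∀ t ∈ Icc 0 T,
      c ≤ S.v (x, t) ∧ S.v (x, t) ≤ C * Real.exp (S.impulse x t) := by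
  obtain ⟨E, hE, hen⟩ := exists_energy_bound hα β hT K hδ
  obtain ⟨C₂, hC₂, hcomp⟩ := exists_viscPot_compare hα β hT K hδ
  set c₃ := Real.exp (viscPot α (Real.exp (-2 * E - 1))) / 2 with hc₃
  have hc₃0 : 0 < c₃ := by positivity
  set C₃ := Real.exp C₂ / c₃ with hC₃
  have hC₃0 : 0 < C₃ := by positivity
  set C₄ := C₃ * (2 * E + 2) with hC₄
  have hC₄0 : 0 < C₄ := by positivity
  set c := (C₃ * Real.exp (C₄ * T))⁻¹ with hc
  have hc0 : 0 < c := by positivity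
  set D := Real.exp (c ^ (-α)) * (Real.exp C₂ * (2 * (E + 1))) with hD
  refine ⟨c, D, hc0, by positivity, fun S hS => ?_⟩
  have hF := S.continuous_viscPot
  have hI := S.continuous_impulse
  have hPhi : Continuous fun q : ℝ × ℝ => Real.exp (S.impulse q.1 q.2) := hI.rexp
  have hEc := S.continuous_energy (fun _ => hasDerivAt_thermal)
  have hEF : Continuous fun q : ℝ × ℝ => Real.exp (viscPot α (S.v q)) := hF.rexp
  have hΦt : ∀ t, Continuous fun y => Real.exp (S.impulse y t) := fun t =>
    hPhi.comp (Continuous.prodMk continuous_id continuous_const)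
  have hEFt : ∀ t, Continuous fun y => Real.exp (viscPot α (S.v (y, t))) := fun t =>
    hEF.comp (Continuous.prodMk continuous_id continuous_const)
  have hth : ∀ t, Continuous fun y => thermal (S.v (y, t)) := fun t => by
    unfold thermal
    fun_prop (disch := intro; exact S.v_ne _)
  have hlow : ∀ a, ∀ t ∈ Icc 0 T, c₃ ≤ ∫ y in a..(a + 1), Real.exp (viscPot α (S.v (y, t))) := by
    intro a t ht
    have h1 := integral_v_le (hen S hS t ht a (a + 1) (by linarith)) (by linarith)
    have h2 : ∫ y in a..(a + 1), 2 * c₃ * (1 - thermal (S.v (y, t)) / (2 * E))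
        ≤ ∫ y in a..(a + 1), Real.exp (viscPot α (S.v (y, t))) := by
      have := hth t
      refine intervalIntegral_mono_of_continuous (by linarith) (by fun_prop) (hEFt t) fun y _ => ?_
      have := le_exp_viscPot hα hE (S.v_pos (y, t))
      rwa [hc₃, mul_div_cancel₀ _ two_ne_zero]
    rw [intervalIntegral.integral_const_mul, intervalIntegral.integral_sub
      (by simp) ((hth t).div_const _ |>.intervalIntegrable _ _),
      intervalIntegral.integral_div, intervalIntegral.integral_const] at h2
    have h3 : (∫ y in a..(a + 1), thermal (S.v (y, t))) / (2 * E) ≤ 1 / 2 := by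
      rw [div_le_iff₀ (by linarith)]
      linarith
    refine le_trans ?_ h2
    rw [add_sub_cancel_left, one_smul]
    nlinarith
  have hstar : ∀ a, ∀ t ∈ Icc 0 T, ∀ x ∈ Icc a (a + 1), Real.exp (S.impulse x t)
      ≤ C₃ * S.v (x, t) * ∫ y in a..(a + 1), Real.exp (S.impulse y t) := by
    intro a t ht x hx
    have h1 : ∫ y in a..(a + 1), Real.exp (S.impulse x t) * Real.exp (viscPot α (S.v (y, t)))
        ≤ ∫ y in a..(a + 1), (Real.exp C₂ * S.v (x, t)) * Real.exp (S.impulse y t) := by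
      refine intervalIntegral_mono_of_continuous (by linarith) (continuous_const.mul (hEFt t))
        (continuous_const.mul (hΦt t)) fun y hy => ?_
      have h2 := Real.exp_le_exp.2 (hcomp S hS t ht x y
        (abs_le.2 ⟨by linarith [hx.1, hy.2], by linarith [hx.2, hy.1]⟩))
      rw [Real.exp_add, Real.exp_add, Real.exp_add] at h2
      calc _ ≤ _ := (mul_comm _ _).trans_le h2
        _ ≤ S.v (x, t) * Real.exp (S.impulse y t) * Real.exp C₂ := by
          gcongr
          exact exp_viscPot_le (S.v_pos _)
        _ = _ := by ring
    rw [intervalIntegral.integral_const_mul, intervalIntegral.integral_const_mul] at h1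
    have h3 := (mul_le_mul_of_nonneg_left (hlow a t ht) (Real.exp_pos (S.impulse x t)).le).trans h1
    rw [hC₃, div_mul_eq_mul_div, div_mul_eq_mul_div, le_div_iff₀ hc₃0]
    exact h3
  have hZ : ∀ a, ∀ t ∈ Icc 0 T, ∫ y in a..(a + 1), Real.exp (S.impulse y t)
      ≤ Real.exp (C₄ * T) := by
    intro a t ht
    have hZ0 : ∀ t, 0 ≤ ∫ y in a..(a + 1), Real.exp (S.impulse y t) := fun t =>
      intervalIntegral.integral_nonneg (by linarith) fun y _ => (Real.exp_pos _).le
    have hPP : Continuous fun q : ℝ × ℝ => S.pressure q * Real.exp (S.impulse q.1 q.2) :=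
      S.continuous_pressure.mul hPhi
    have hsw : Continuous fun q : ℝ × ℝ => q.swap := continuous_swap
    have hg := gronwall_with_dissipation (A := C₄ * T) (B := 0) (a := fun _ => C₄)
      (g := fun _ => 0) hT (y := fun s => ∫ y in a..(a + 1), Real.exp (S.impulse y s))
      (y' := fun s => ∫ y in a..(a + 1), S.pressure (y, s) * Real.exp (S.impulse y s))
      (z := fun _ => 0)
      (intervalIntegral.continuous_parametric_intervalIntegral_of_continuous'
        (f := fun s y => Real.exp (S.impulse y s)) (hPhi.comp hsw) _ _)
      (by fun_prop) (by fun_prop) (by fun_prop)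
      (fun s hs => by
        exact hasDerivAt_integral_of_continuous (f := fun y s => Real.exp (S.impulse y s))
          (g := fun y s => S.pressure (y, s) * Real.exp (S.impulse y s)) hPhi hPP
          (fun y r hr => ((S.hasDerivAt_impulse y r).exp).congr_deriv (mul_comm _ _)) hs)
      (fun s hs => by
        have hs' := Ioo_subset_Icc_self hs
        have h1 : ∫ y in a..(a + 1), S.pressure (y, s) * Real.exp (S.impulse y s)
            ≤ ∫ y in a..(a + 1), (C₃ * ∫ y in a..(a + 1), Real.exp (S.impulse y s))
              * (2 * S.energy thermal (y, s) + 2) := by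
          refine intervalIntegral_mono_of_continuous (by linarith)
            (hPP.comp (Continuous.prodMk continuous_id continuous_const)) (by fun_prop)
            fun y hy => ?_
          have hv := S.v_pos (y, s)
          have hPv : S.pressure (y, s) * S.v (y, s) ≤ 2 * S.energy thermal (y, s) + 2 := by
            have h2 := le_two_mul_thermal_add (S.θ_pos (y, s))
            have h3 := thermal_nonneg hv
            have h4 : S.pressure (y, s) * S.v (y, s) = S.θ.f (y, s)
              + S.v (y, s) * (S.ba.f (y, s) ^ 2 + S.bb.f (y, s) ^ 2) / 2 := by
              unfold pressure
              field_simp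
            have h5 : 0 ≤ S.v (y, s) * (S.ba.f (y, s) ^ 2 + S.bb.f (y, s) ^ 2) := by positivity
            unfold energy
            unfold thermal at h3
            linarith [sq_nonneg (S.u.f (y, s)), sq_nonneg (S.wa.f (y, s)),
              sq_nonneg (S.wb.f (y, s))]
          calc _ ≤ S.pressure (y, s) * (C₃ * S.v (y, s)
                * ∫ y in a..(a + 1), Real.exp (S.impulse y s)) :=
                mul_le_mul_of_nonneg_left (hstar a s hs' y hy) (S.pressure_pos _).le
            _ = (C₃ * ∫ y in a..(a + 1), Real.exp (S.impulse y s))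
                * (S.pressure (y, s) * S.v (y, s)) := by ring
            _ ≤ _ := mul_le_mul_of_nonneg_left hPv (mul_nonneg hC₃0.le (hZ0 s))
        rw [intervalIntegral.integral_const_mul, intervalIntegral.integral_add
          (Continuous.intervalIntegrable (by fun_prop) _ _) (by simp),
          intervalIntegral.integral_const_mul, intervalIntegral.integral_const,
          add_sub_cancel_left, one_smul] at h1
        have h2 := hen S hS s hs' a (a + 1) (by linarith)
        rw [add_zero, add_zero]
        refine h1.trans ?_
        rw [hC₄]
        calc _ ≤ (C₃ * ∫ y in a..(a + 1), Real.exp (S.impulse y s)) * (2 * E + 2) := by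
              refine mul_le_mul_of_nonneg_left ?_ (mul_nonneg hC₃0.le (hZ0 s))
              linarith
          _ = _ := by ring)
      (fun _ => le_rfl) (fun _ => hC₄0.le) (fun _ => le_rfl) (hZ0 0) (by simp [mul_comm]) (by simp) t ht
    have h3 : ∀ z, S.impulse z 0 = 0 := fun z => intervalIntegral.integral_same
    simpa [h3] using hg
  have hvlow : ∀ x, ∀ t ∈ Icc 0 T, c ≤ S.v (x, t) := by
    intro x t ht
    have h1 := hstar x t ht x ⟨le_rfl, by linarith⟩
    have h2 : 1 ≤ Real.exp (S.impulse x t) := Real.one_le_exp (S.impulse_nonneg x ht.1)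
    have hv := S.v_pos (x, t)
    have h3 : C₃ * S.v (x, t) * (∫ y in x..(x + 1), Real.exp (S.impulse y t))
        ≤ C₃ * S.v (x, t) * Real.exp (C₄ * T) :=
      mul_le_mul_of_nonneg_left (hZ x t ht) (by positivity)
    rw [hc, inv_le_iff_one_le_mul₀ (by positivity)]
    linarith
  refine fun x t ht => ⟨hvlow x t ht, ?_⟩
  obtain ⟨y, hy, hy'⟩ := exists_le_of_integral_unit_le (hth t)
    (integral_v_le (hen S hS t ht x (x + 1) (by linarith)) (by linarith))
  have h1 := hcomp S hS t ht y x (abs_le.2 ⟨by linarith [hy.1], by linarith [hy.2]⟩)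
  have h2 : Real.log (S.v (x, t)) - c ^ (-α) ≤ viscPot α (S.v (x, t)) := by
    have : S.v (x, t) ^ (-α) ≤ c ^ (-α) :=
      Real.rpow_le_rpow_of_nonpos hc0 (hvlow x t ht) (by linarith)
    unfold viscPot
    linarith
  have h3 := viscPot_le_log (α := α) (S.v_pos (y, t))
  have h4 := S.impulse_nonneg y ht.1
  have h5 : Real.log (S.v (x, t)) ≤
      c ^ (-α) + (C₂ + Real.log (S.v (y, t))) + S.impulse x t := by linarith
  have h6 := Real.exp_le_exp.2 h5
  rw [Real.exp_log (S.v_pos _), Real.exp_add, Real.exp_add, Real.exp_add,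
    Real.exp_log (S.v_pos _)] at h6
  refine h6.trans ?_
  rw [hD]
  have := (le_two_mul_thermal_add (S.v_pos (y, t)))
  have h7 : S.v (y, t) ≤ 2 * (E + 1) := by linarith
  gcongr

end MHDFlow

end VolumeBounds

section TemperatureLower

variable {α β T K δ : ℝ}

theorem deriv_eq_zero_and_nonneg_of_min {f f' : ℝ → ℝ} {x c : ℝ}
    (hf : ∀ y, HasDerivAt f (f' y) y) (hf' : HasDerivAt f' c x) (h : ∀ y, f x ≤ f y) :
    f' x = 0 ∧ 0 ≤ c := by
  have h0 : f' x = 0 :=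
    IsLocalMin.hasDerivAt_eq_zero (Filter.Eventually.of_forall h) (hf x)
  refine ⟨h0, ?_⟩
  by_contra! hc
  have h1 := (hasDerivAt_iff_tendsto_slope.1 hf').eventually (gt_mem_nhds hc)
  have h2 : ∀ᶠ y in nhdsWithin x (Ioi x), slope f' x y < 0 :=
    h1.filter_mono (nhdsWithin_mono _ fun y hy => ne_of_gt hy)
  obtain ⟨b, hb, hb'⟩ := mem_nhdsGT_iff_exists_Ioo_subset.1 h2
  have hb0 : x < b := hb
  obtain ⟨ξ, hξ, hξ'⟩ := exists_hasDerivAt_eq_slope f f' (by linarith : x < (x + b) / 2)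
    (fun y _ => (hf y).continuousAt.continuousWithinAt) fun y _ => hf y
  have h3 : slope f' x ξ < 0 := hb' ⟨hξ.1, by linarith [hξ.2]⟩
  rw [slope_def_field, h0, sub_zero, hξ'] at h3
  have h4 : 0 ≤ (f ((x + b) / 2) - f x) / ((x + b) / 2 - x) / (ξ - x) :=
    div_nonneg (div_nonneg (sub_nonneg.2 (h _)) (by linarith)) (by linarith [hξ.1])
  linarith

theorem nonneg_Icc_of_Ico {f : ℝ → ℝ} (hf : Continuous f) (hT : 0 < T)
    (h : ∀ t ∈ Ico 0 T, 0 ≤ f t) : ∀ t ∈ Icc 0 T, 0 ≤ f t := by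
  intro t ht
  rw [← closure_Ico hT.ne] at ht
  exact le_on_closure (f := fun _ => 0) h continuousOn_const hf.continuousOn ht

namespace MHDFlow

/-- The temperature is bounded below. -/
theorem exists_temperature_lower_bound (hα : 0 ≤ α) (β : ℝ) (hT : 0 < T) (K : ℝ) (hδ : 0 < δ)
    (hδ₁ : δ ≤ 1) : ∃ c, 0 < c ∧ ∀ S : MHDFlow α β T, S.Adm K δ → ∀ x, ∀ t ∈ Icc 0 T,
      c ≤ S.θ.f (x, t) := by
  obtain ⟨c, C, hc, hC, hv⟩ := exists_volume_bounds hα β hT K hδ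
  set B := δ / c with hB
  have hB0 : 0 < B := by positivity
  refine ⟨δ / 2 * Real.exp (-B * T), by positivity, fun S hS => ?_⟩
  obtain ⟨R, hR⟩ := S.far (1 / 4) (by norm_num)
  have hlam : ∀ t, 0 ≤ t → δ / 2 * Real.exp (-B * t) ≤ δ / 2 := fun t ht =>
    mul_le_of_le_one_right (by linarith) (Real.exp_le_one_iff.2 (by nlinarith))
  have key : ∀ x, ∀ t ∈ Ico 0 T, 0 ≤ S.θ.f (x, t) - δ / 2 * Real.exp (-B * t) := by
    refine nonneg_of_barrier (R := R) (f := fun x t => S.θ.f (x, t) - δ / 2 * Real.exp (-B * t))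
      (ft := fun x t => S.θ.t (x, t) - δ / 2 * (Real.exp (-B * t) * -B))
      (by fun_prop) (fun x => ?_) (fun x t ht hx => ?_) (fun x t ht => ?_) fun x t ht h0 hmin => ?_
    · have := hS.θ_ge x
      simp only [mul_zero, Real.exp_zero]
      linarith
    · have := (abs_lt.1 (hR (x, t) hx).2.2.1).1
      have := hlam t ht.1
      linarith
    · have h1 : HasDerivAt (fun s => Real.exp (-B * s)) (Real.exp (-B * t) * -B) t := by
        simpa using ((hasDerivAt_id t).const_mul (-B)).exp
      exact (S.θ.ht x t ht).sub (h1.const_mul _)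
    · obtain ⟨hx0, hxx⟩ := deriv_eq_zero_and_nonneg_of_min (f := fun y => S.θ.f (y, t))
        (fun y => S.θ.hx y t) (S.θ.hxx x t) (x := x) fun y => by linarith [hmin y]
      have hl : S.θ.f (x, t) = δ / 2 * Real.exp (-B * t) := by linarith
      have hv0 := S.v_pos (x, t)
      have hvc := (hv S hS x t (Ioo_subset_Icc_self ht)).1
      have hθ0 := S.θ_pos (x, t)
      have hθδ := (hl.trans_le (hlam t ht.1.le))
      have hmu : 1 ≤ visc α (S.v (x, t)) := S.one_le_mu hα (x, t)
      have hpw : 0 < S.θ.f (x, t) ^ β := Real.rpow_pos_of_pos hθ0 β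
      rw [S.eq_θ, hx0]
      have h1 : δ / 2 * (Real.exp (-B * t) * -B) = -(B * S.θ.f (x, t)) := by rw [hl]; ring
      rw [h1]
      set θ := S.θ.f (x, t)
      set v := S.v (x, t)
      set u := S.u.x (x, t)
      have h2 : θ ^ β * S.θ.xx (x, t) / v + β * θ ^ (β - 1) * 0 ^ 2 / v
          - θ ^ β * 0 * S.vx (x, t) / v ^ 2 - θ / v * u
          + (visc α v * u ^ 2 + (S.wa.x (x, t) ^ 2 + S.wb.x (x, t) ^ 2)
            + (S.ba.x (x, t) ^ 2 + S.bb.x (x, t) ^ 2)) / v - -(B * θ)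
          = θ ^ β * S.θ.xx (x, t) / v + ((visc α v - 1) * u ^ 2
            + (S.wa.x (x, t) ^ 2 + S.wb.x (x, t) ^ 2)
            + (S.ba.x (x, t) ^ 2 + S.bb.x (x, t) ^ 2)) / v + (u - θ / 2) ^ 2 / v
            + (B - θ / (4 * v)) * θ := by
        field_simp
        ring
      rw [h2]
      have h3 : 0 ≤ visc α v - 1 := by linarith
      have h4 : 0 < B - θ / (4 * v) := by
        rw [hB, sub_pos, div_lt_div_iff₀ (by positivity) hc]
        nlinarith
      positivity
  intro x t ht
  have h1 := nonneg_Icc_of_Ico (f := fun t => S.θ.f (x, t) - δ / 2 * Real.exp (-B * t))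
    (by fun_prop) hT (key x) t ht
  have h2 : Real.exp (-B * T) ≤ Real.exp (-B * t) := Real.exp_le_exp.2 (by nlinarith [ht.2])
  nlinarith

end MHDFlow

end TemperatureLower

section Dissipation

variable {α β T K δ : ℝ}

theorem abs_le_young {a : ℝ} (ha : 0 < a) (x : ℝ) : |x| ≤ a * x ^ 2 + 1 / (4 * a) := by
  have : a * x ^ 2 + 1 / (4 * a) - |x| = (2 * a * |x| - 1) ^ 2 / (4 * a) := by
    rw [← sq_abs x]
    field_simp
    ring
  have h2 : 0 ≤ (2 * a * |x| - 1) ^ 2 / (4 * a) := by positivity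
  linarith

theorem sub_le_integral_abs_deriv {f f' : ℝ → ℝ} (hf : ∀ x, HasDerivAt f (f' x) x)
    (hc : Continuous f') {a b x y : ℝ} (hx : x ∈ Icc a b) (hy : y ∈ Icc a b) :
    f x - f y ≤ ∫ z in a..b, |f' z| := by
  have h : ∀ {y x}, a ≤ y → y ≤ x → x ≤ b → |f x - f y| ≤ ∫ z in a..b, |f' z| := by
    intro y x hay hyx hxb
    rw [← intervalIntegral.integral_eq_sub_of_hasDerivAt (fun z _ => hf z)
      (hc.intervalIntegrable _ _)]
    refine (intervalIntegral.abs_integral_le_integral_abs hyx).trans ?_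
    exact intervalIntegral.integral_mono_interval hay hyx hxb
      (Eventually.of_forall fun z => abs_nonneg _) (hc.abs.intervalIntegrable _ _)
  rcases le_total y x with hyx | hyx
  · exact (le_abs_self _).trans (h hy.1 hyx hx.2)
  · refine (le_abs_self _).trans ?_
    rw [abs_sub_comm]
    exact h hx.1 hyx hy.2

theorem exists_rpow_le_mul_add {q : ℝ} (hq0 : 0 < q) (hq : q < 1) {ε : ℝ} (hε : 0 < ε) :
    ∃ C, 0 < C ∧ ∀ z, 0 < z → z ^ q ≤ ε * z + C := by
  set M := ε ^ (-(1 / (1 - q))) with hM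
  have hM0 : 0 < M := by positivity
  refine ⟨M ^ q, by positivity, fun z hz => ?_⟩
  rcases le_total z M with h | h
  · have := Real.rpow_le_rpow hz.le h hq0.le
    have : 0 < ε * z := by positivity
    linarith
  · have h1 : z ^ (q - 1) ≤ M ^ (q - 1) := Real.rpow_le_rpow_of_nonpos hM0 h (by linarith)
    have h2 : M ^ (q - 1) = ε := by
      have h1q : 1 - q ≠ 0 := by linarith
      rw [hM, ← Real.rpow_mul hε.le, show -(1 / (1 - q)) * (q - 1) = 1 by field_simp; ring,
        Real.rpow_one]
    have h3 : z ^ q = z ^ (q - 1) * z := by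
      rw [Real.rpow_sub_one hz.ne', div_mul_cancel₀ _ hz.ne']
    rw [h3]
    have h4 : z ^ (q - 1) * z ≤ ε * z := by
      rw [← h2]
      gcongr
    have : 0 < M ^ q := by positivity
    linarith

theorem sq_sub_one_le_thermal {z : ℝ} (hz : 0 < z) : (z - 1) ^ 2 ≤ 2 * (z + 1) * thermal z := by
  have key : (z - 1) ^ 2 / (2 * (z + 1)) ≤ thermal z := by
    have hd : ∀ y, 0 < y → HasDerivAt (fun y => thermal y - (y - 1) ^ 2 / (2 * (y + 1)))
        ((y - 1) * (y ^ 2 + y + 2) / (2 * y * (y + 1) ^ 2)) y := by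
      intro y hy
      refine ((hasDerivAt_thermal hy).sub ((((hasDerivAt_id y).sub_const 1).pow 2).div
        (((hasDerivAt_id y).add_const 1).const_mul 2) (by simp; positivity))).congr_deriv ?_
      rw [Real.rpow_neg_one]
      simp
      field_simp
      ring
    have h1 : thermal 1 = 0 := by simp [thermal]
    have hc : ContinuousOn (fun y => thermal y - (y - 1) ^ 2 / (2 * (y + 1))) (Ioi 0) :=
      fun y hy => (hd y hy).continuousAt.continuousWithinAt
    rcases le_total 1 z with h | h
    · have := monotoneOn_of_deriv_nonneg (convex_Icc 1 z)
        (hc.mono fun y hy => lt_of_lt_of_le one_pos hy.1)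
        (fun y hy => (hd y (by rw [interior_Icc] at hy; linarith [hy.1])).differentiableAt.differentiableWithinAt)
        (fun y hy => by
          rw [interior_Icc] at hy
          rw [(hd y (by linarith [hy.1])).deriv]
          have h1 : 0 < y - 1 := by linarith [hy.1]
          have h2 : 0 < y := by linarith
          positivity) (left_mem_Icc.2 h) (right_mem_Icc.2 h) h
      simp only [h1, sub_self] at this
      norm_num at this
      linarith
    · have := antitoneOn_of_deriv_nonpos (convex_Icc z 1)
        (hc.mono fun y hy => lt_of_lt_of_le hz hy.1)
        (fun y hy => (hd y (by rw [interior_Icc] at hy; linarith [hy.1])).differentiableAt.differentiableWithinAt)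
        (fun y hy => by
          rw [interior_Icc] at hy
          have h2 : 0 < y := by linarith [hy.1]
          rw [(hd y h2).deriv]
          have h1 : y - 1 ≤ 0 := by linarith [hy.2]
          exact div_nonpos_of_nonpos_of_nonneg (mul_nonpos_of_nonpos_of_nonneg h1 (by positivity))
            (by positivity)) (left_mem_Icc.2 h) (right_mem_Icc.2 h) h
      simp only [h1, sub_self] at this
      norm_num at this
      linarith
  rw [div_le_iff₀ (by positivity)] at key
  linarith

/-- The primitive of `1 - z ^ (-p)` vanishing at `1`. -/
def thermalPow (p z : ℝ) : ℝ := z - 1 - (z ^ (1 - p) - 1) / (1 - p)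

theorem hasDerivAt_thermalPow {p : ℝ} (hp : p < 1) {z : ℝ} (hz : 0 < z) :
    HasDerivAt (thermalPow p) (1 - z ^ (-p)) z := by
  refine (((hasDerivAt_id z).sub_const 1).sub (((Real.hasDerivAt_rpow_const (p := 1 - p)
    (Or.inl hz.ne')).sub_const 1).div_const (1 - p))).congr_deriv ?_
  rw [mul_div_cancel_left₀ _ (by linarith : 1 - p ≠ 0)]
  congr 2
  ring

theorem thermalPow_nonneg {p : ℝ} (hp0 : 0 ≤ p) (hp : p < 1) {z : ℝ} (hz : 0 < z) :
    0 ≤ thermalPow p z := by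
  have := rpow_one_add_le_one_add_mul_self (s := z - 1) (p := 1 - p) (by linarith) (by linarith)
    (by linarith)
  rw [add_sub_cancel] at this
  have h1 : (z ^ (1 - p) - 1) / (1 - p) ≤ z - 1 := by
    rw [div_le_iff₀ (by linarith)]
    linarith
  unfold thermalPow
  linarith

theorem thermalPow_le {p : ℝ} (hp : p < 1) {z : ℝ} (hz : 0 < z) : thermalPow p z ≤ thermal z := by
  have h1 := Real.add_one_le_exp (Real.log z * (1 - p))
  rw [← Real.rpow_def_of_pos hz] at h1
  have h2 : Real.log z ≤ (z ^ (1 - p) - 1) / (1 - p) := by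
    rw [le_div_iff₀ (by linarith)]
    linarith
  unfold thermalPow thermal
  linarith

theorem abs_rpow_sub_one_le {q : ℝ} (hq0 : 0 ≤ q) (hq : q ≤ 1) {z : ℝ} (hz : 0 < z) :
    |z ^ q - 1| ≤ |z - 1| := by
  rcases le_total 1 z with h | h
  · have h1 : 1 ≤ z ^ q := Real.one_le_rpow h hq0
    have h2 : z ^ q ≤ z ^ (1:ℝ) := Real.rpow_le_rpow_of_exponent_le h hq
    rw [Real.rpow_one] at h2
    rw [abs_of_nonneg (by linarith), abs_of_nonneg (by linarith)]
    linarith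
  · have h1 : z ^ q ≤ 1 := Real.rpow_le_one hz.le h hq0
    have h2 : z ^ (1:ℝ) ≤ z ^ q := Real.rpow_le_rpow_of_exponent_ge hz h hq
    rw [Real.rpow_one] at h2
    rw [abs_of_nonpos (by linarith), abs_of_nonpos (by linarith)]
    linarith

theorem rpow_mul_sq_le {p : ℝ} (hp0 : 0 ≤ p) (hp : p ≤ 1) {z : ℝ} (hz : 0 < z) :
    z ^ p * (z ^ (1 - p) - 1) ^ 2 ≤ 6 * (1 + z ^ (1 - p)) * thermal z := by
  have hq : 0 < z ^ (1 - p) := by positivity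
  have hpz : 0 < z ^ p := by positivity
  have hzz : z ^ p * z ^ (1 - p) = z := by
    rw [← Real.rpow_add hz, add_sub_cancel, Real.rpow_one]
  have hth := thermal_nonneg hz
  have h1 := abs_rpow_sub_one_le (q := 1 - p) (by linarith) (by linarith) hz
  have h3 := sq_sub_one_le_thermal hz
  have h2 : z ^ p * (z ^ (1 - p) - 1) ^ 2 ≤ |z ^ (1 - p) - 1| * |z - 1| := by
    have h4 : z ^ p * |z ^ (1 - p) - 1| ≤ |z - 1| := by
      rw [show z ^ p * |z ^ (1 - p) - 1| = |z - z ^ p| by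
        rw [show z - z ^ p = z ^ p * (z ^ (1 - p) - 1) by rw [mul_sub, hzz, mul_one], abs_mul,
          abs_of_pos hpz]]
      rcases le_total 1 z with h | h
      · have h5 : 1 ≤ z ^ p := Real.one_le_rpow h hp0
        have h6 : z ^ p ≤ z ^ (1:ℝ) := Real.rpow_le_rpow_of_exponent_le h hp
        rw [Real.rpow_one] at h6
        rw [abs_of_nonneg (by linarith), abs_of_nonneg (by linarith)]
        linarith
      · have h5 : z ^ p ≤ 1 := Real.rpow_le_one hz.le h hp0
        have h6 : z ^ (1:ℝ) ≤ z ^ p := Real.rpow_le_rpow_of_exponent_ge hz h hp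
        rw [Real.rpow_one] at h6
        rw [abs_of_nonpos (by linarith), abs_of_nonpos (by linarith)]
        linarith
    calc _ = |z ^ (1 - p) - 1| * (z ^ p * |z ^ (1 - p) - 1|) := by rw [← sq_abs]; ring
      _ ≤ _ := mul_le_mul_of_nonneg_left h4 (abs_nonneg _)
  refine h2.trans ?_
  rcases le_total z 2 with h | h
  · calc _ ≤ |z - 1| * |z - 1| := mul_le_mul_of_nonneg_right h1 (abs_nonneg _)
      _ = (z - 1) ^ 2 := by rw [abs_mul_abs_self]; ring
      _ ≤ 2 * (z + 1) * thermal z := h3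
      _ ≤ 6 * (1 + z ^ (1 - p)) * thermal z := mul_le_mul_of_nonneg_right (by linarith) hth
  · have h5 : 1 ≤ z ^ (1 - p) := Real.one_le_rpow (by linarith) (by linarith)
    have h6 : z - 1 ≤ 6 * thermal z := by
      have : (z - 1) * (z - 1) ≤ (z - 1) * (6 * thermal z) := by nlinarith
      exact le_of_mul_le_mul_left this (by linarith)
    rw [abs_of_nonneg (by linarith : 0 ≤ z ^ (1 - p) - 1), abs_of_nonneg (by linarith : 0 ≤ z - 1)]
    calc _ ≤ (z ^ (1 - p) - 1) * (6 * thermal z) := mul_le_mul_of_nonneg_left h6 (by linarith)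
      _ ≤ _ := by nlinarith

namespace MHDFlow

theorem continuous_thermal_comp {f : ℝ → ℝ} (hf : Continuous f) (h : ∀ x, 0 < f x) :
    Continuous fun x => thermal (f x) := by
  have : ∀ x, f x ≠ 0 := fun x => (h x).ne'
  unfold thermal
  fun_prop (disch := assumption)

theorem thermal_θ_le_energy (S : MHDFlow α β T) (q : ℝ × ℝ) :
    thermal (S.θ.f q) ≤ S.energy thermal q := by
  have hv := S.v_pos q
  have h3 := thermal_nonneg hv
  have : 0 ≤ (S.u.f q ^ 2 + (S.wa.f q ^ 2 + S.wb.f q ^ 2)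
      + S.v q * (S.ba.f q ^ 2 + S.bb.f q ^ 2)) / 2 := by positivity
  unfold energy
  unfold thermal at h3 ⊢
  linarith

theorem integral_thermal_θ_le {S : MHDFlow α β T} {C a b t : ℝ}
    (h : ∫ x in a..b, S.energy thermal (x, t) ≤ C) (hab : a ≤ b) :
    ∫ x in a..b, thermal (S.θ.f (x, t)) ≤ C := by
  have hE := S.continuous_energy (fun _ => hasDerivAt_thermal)
  exact (intervalIntegral_mono_of_continuous hab
    (continuous_thermal_comp (by fun_prop) fun x => S.θ_pos _) (by fun_prop)
    fun x _ => S.thermal_θ_le_energy _).trans h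

theorem integral_le_of_thermal {f : ℝ → ℝ} (hf : Continuous f) (h0 : ∀ x, 0 < f x) {a C : ℝ}
    (h : ∫ x in a..(a + 1), thermal (f x) ≤ C) : ∫ x in a..(a + 1), f x ≤ 2 * C + 2 := by
  have := intervalIntegral_le_comb₂ (a := a) (b := a + 1) (c₁ := 2) (c₂ := 2)
    (g₁ := fun x => thermal (f x)) (g₂ := fun _ => 1) (by linarith) hf
    (continuous_thermal_comp hf h0) continuous_const
    fun x _ => by linarith [le_two_mul_thermal_add (h0 x)]
  simp only [intervalIntegral.integral_const, smul_eq_mul] at this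
  linarith

theorem unit_integral_θ_le {S : MHDFlow α β T} {C a t : ℝ}
    (h : ∫ x in a..(a + 1), S.energy thermal (x, t) ≤ C) :
    ∫ x in a..(a + 1), S.θ.f (x, t) ≤ 2 * C + 2 :=
  integral_le_of_thermal (by fun_prop) (fun x => S.θ_pos _) (integral_thermal_θ_le h (by linarith))

theorem unit_integral_v_le {S : MHDFlow α β T} {C a t : ℝ}
    (h : ∫ x in a..(a + 1), S.energy thermal (x, t) ≤ C) :
    ∫ x in a..(a + 1), S.v (x, t) ≤ 2 * C + 2 :=
  integral_le_of_thermal (by fun_prop) (fun x => S.v_pos _) (integral_v_le h (by linarith))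

theorem exists_θ_le {S : MHDFlow α β T} {C a t : ℝ}
    (h : ∫ x in a..(a + 1), S.energy thermal (x, t) ≤ C) :
    ∃ y ∈ Icc a (a + 1), S.θ.f (y, t) ≤ 2 * C + 2 := by
  obtain ⟨y, hy, hy'⟩ := exists_le_of_integral_unit_le (f := fun x => S.θ.f (x, t)) (by fun_prop)
    (unit_integral_θ_le h)
  exact ⟨y, hy, hy'⟩

theorem exists_unit_interval {R x : ℝ} (hR : 1 ≤ R) (hx : x ∈ Icc (-R) R) :
    ∃ a, -R ≤ a ∧ a + 1 ≤ R ∧ x ∈ Icc a (a + 1) := by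
  rcases le_total x 0 with h | h
  · exact ⟨x, hx.1, by linarith, le_rfl, by linarith⟩
  · exact ⟨x - 1, by linarith, by linarith [hx.2], by linarith, by linarith⟩

theorem rpow_le_pw_mul_pw (S : MHDFlow α β T) {p c : ℝ} (hpβ : p ≤ β) (hc : 0 < c) {q : ℝ × ℝ}
    (h : c ≤ S.θ.f q) : c ^ (β - p) ≤ S.pw β q * S.pw (-p) q := by
  rw [pw, pw, ← Real.rpow_add (S.θ_pos q)]
  exact Real.rpow_le_rpow hc.le h (by linarith)

theorem exists_cutoff_sup_bound (hα : 0 ≤ α) (hT : 0 < T) (K : ℝ) (hδ : 0 < δ)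
    (hδ₁ : δ ≤ 1) {p : ℝ} (hp : 0 < p) (hpβ : p ≤ β) :
    ∃ A B, 0 < A ∧ 0 < B ∧ ∀ S : MHDFlow α β T, S.Adm K δ → ∀ t ∈ Icc 0 T, ∀ R, 1 ≤ R →
      ∀ x ∈ Icc (-R) R, cutoff R x * S.θ.f (x, t)
        ≤ A + B * ∫ x in (-R)..R, cutoff R x * S.diss p (x, t) := by
  obtain ⟨E, hE, hen⟩ := exists_energy_bound hα β hT K hδ
  obtain ⟨c, hc, hθ⟩ := exists_temperature_lower_bound hα β hT K hδ hδ₁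
  set k := c ^ (β - p) with hk
  have hk0 : 0 < k := by positivity
  set l := (2 * E + 2) / (2 * k) with hl
  have hl0 : 0 < l := by positivity
  refine ⟨20 * (E + 1), 2 * (l / p), by positivity, by positivity, fun S hS t ht R hR => ?_⟩
  have hR0 : 0 < R := by linarith
  obtain ⟨x₀, hx₀, hmax⟩ := isCompact_Icc.exists_isMaxOn (nonempty_Icc.2 (by linarith : -R ≤ R))
    (f := fun x => cutoff R x * S.θ.f (x, t)) (Continuous.continuousOn (by fun_prop))
  refine fun x hx => (hmax hx).trans ?_
  obtain ⟨a, ha, haR, hxa⟩ := exists_unit_interval hR hx₀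
  have hen' := hen S hS t ht a (a + 1) (by linarith)
  obtain ⟨y, hy, hy'⟩ := exists_θ_le hen'
  set s := cutoff R x₀ * S.θ.f (x₀, t) with hs
  have h1 := sub_le_integral_abs_deriv (f := fun x => cutoff R x * S.θ.f (x, t))
    (f' := fun x => cutoffDeriv R x * S.θ.f (x, t) + cutoff R x * S.θ.x (x, t))
    (fun x => (hasDerivAt_cutoff R x).mul (S.θ.hx x t)) (by fun_prop) hxa hy
  have h2 := intervalIntegral_le_comb₃ (a := a) (b := a + 1)
    (f := fun x => |cutoffDeriv R x * S.θ.f (x, t) + cutoff R x * S.θ.x (x, t)|)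
    (c₁ := 4) (c₂ := l / p) (c₃ := s / (4 * (l * k)))
    (g₁ := fun x => S.θ.f (x, t)) (g₂ := fun x => cutoff R x * S.diss p (x, t))
    (g₃ := fun x => S.v (x, t)) (by linarith) (by fun_prop) (by fun_prop) (by fun_prop)
    (by fun_prop) (fun x hx => by
      have hxR : x ∈ Icc (-R) R := ⟨by linarith [hx.1], by linarith [hx.2]⟩
      have hθ0 := S.θ_pos (x, t)
      have hv0 := S.v_pos (x, t)
      have hc0 := cutoff_nonneg R x
      have h3 : |cutoffDeriv R x| ≤ 4 := (abs_cutoffDeriv_le hR0 hxR).trans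
        ((div_le_iff₀ hR0).2 (by linarith))
      have h4 := S.rpow_le_pw_mul_pw hpβ hc (hθ S hS x t ht)
      rw [← hk] at h4
      have h5 : l * k * (S.θ.x (x, t) ^ 2 / (S.θ.f (x, t) * S.v (x, t)))
          ≤ l / p * S.diss p (x, t) := by
        have h6 : p * (k / S.θ.f (x, t) * S.θ.x (x, t) ^ 2 / S.v (x, t)) ≤ S.diss p (x, t) := by
          have := S.heat_nonneg hα (x, t)
          have := S.pw_pos (-p) (x, t)
          have : 0 ≤ S.heat (x, t) * S.pw (-p) (x, t) := by positivity
          have : p * (k / S.θ.f (x, t) * S.θ.x (x, t) ^ 2 / S.v (x, t))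
            ≤ p * (S.pw β (x, t) * S.pw (-p) (x, t) / S.θ.f (x, t)
              * S.θ.x (x, t) ^ 2 / S.v (x, t)) := by gcongr
          unfold diss
          linarith
        calc _ = l / p * (p * (k / S.θ.f (x, t) * S.θ.x (x, t) ^ 2 / S.v (x, t))) := by
              field_simp
          _ ≤ _ := mul_le_mul_of_nonneg_left h6 (by positivity)
      have h6 := abs_le_young (a := l * k / (S.θ.f (x, t) * S.v (x, t))) (by positivity)
        (S.θ.x (x, t))
      have h7 : cutoff R x * S.θ.f (x, t) ≤ s := hmax hxR
      calc |cutoffDeriv R x * S.θ.f (x, t) + cutoff R x * S.θ.x (x, t)|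
          ≤ |cutoffDeriv R x| * S.θ.f (x, t) + cutoff R x * |S.θ.x (x, t)| := by
            refine (abs_add_le _ _).trans_eq ?_
            rw [abs_mul, abs_mul, abs_of_pos hθ0, abs_of_nonneg hc0]
        _ ≤ 4 * S.θ.f (x, t) + cutoff R x * (l * k * (S.θ.x (x, t) ^ 2
            / (S.θ.f (x, t) * S.v (x, t))) + S.θ.f (x, t) * S.v (x, t) / (4 * (l * k))) := by
            have : l * k / (S.θ.f (x, t) * S.v (x, t)) * S.θ.x (x, t) ^ 2
              + 1 / (4 * (l * k / (S.θ.f (x, t) * S.v (x, t))))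
              = l * k * (S.θ.x (x, t) ^ 2
            / (S.θ.f (x, t) * S.v (x, t))) + S.θ.f (x, t) * S.v (x, t) / (4 * (l * k)) := by
              field_simp
            rw [this] at h6
            gcongr
        _ ≤ 4 * S.θ.f (x, t) + cutoff R x * (l / p * S.diss p (x, t))
            + cutoff R x * S.θ.f (x, t) * S.v (x, t) / (4 * (l * k)) := by
            have := mul_le_mul_of_nonneg_left h5 hc0
            have e : cutoff R x * (S.θ.f (x, t) * S.v (x, t) / (4 * (l * k)))
              = cutoff R x * S.θ.f (x, t) * S.v (x, t) / (4 * (l * k)) := by ring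
            rw [mul_add, e]
            linarith
        _ ≤ 4 * S.θ.f (x, t) + cutoff R x * (l / p * S.diss p (x, t))
            + s * S.v (x, t) / (4 * (l * k)) := by gcongr
        _ = _ := by ring)
  have h3 := unit_integral_θ_le hen'
  have h4 := unit_integral_v_le hen'
  have h5 : ∫ x in a..(a + 1), cutoff R x * S.diss p (x, t)
      ≤ ∫ x in (-R)..R, cutoff R x * S.diss p (x, t) :=
    intervalIntegral.integral_mono_interval ha (by linarith) haR
      (Eventually.of_forall fun x => mul_nonneg (cutoff_nonneg R x) (S.diss_nonneg hα hp.le _))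
      (Continuous.intervalIntegrable (by fun_prop) _ _)
  have h6 : cutoff R y * S.θ.f (y, t) ≤ 2 * E + 2 :=
    (mul_le_of_le_one_left (S.θ_pos _).le (cutoff_le_one hR0 ⟨by linarith [hy.1],
      by linarith [hy.2]⟩)).trans hy'
  have hs0 : 0 ≤ s := mul_nonneg (cutoff_nonneg _ _) (S.θ_pos _).le
  have h7 : s / (4 * (l * k)) * ∫ x in a..(a + 1), S.v (x, t) ≤ s / 2 := by
    calc _ ≤ s / (4 * (l * k)) * (2 * E + 2) := mul_le_mul_of_nonneg_left h4 (by positivity)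
      _ = s / 2 := by rw [hl]; field_simp; ring
  have h8 : l / p * ∫ x in a..(a + 1), cutoff R x * S.diss p (x, t)
      ≤ l / p * ∫ x in (-R)..R, cutoff R x * S.diss p (x, t) :=
    mul_le_mul_of_nonneg_left h5 (by positivity)
  linarith

end MHDFlow

end Dissipation

section DissipationBound

variable {α β T K δ : ℝ}

theorem cross_term_le {p z u v : ℝ} (hp0 : 0 ≤ p) (hp : p ≤ 1) (hz : 0 < z) (hv : 0 < v) :
    (z * z ^ (-p) - 1) * u / v
      ≤ 1 / 4 * (u ^ 2 / v * z ^ (-p)) + 6 * (1 + z ^ (1 - p)) * thermal z / v := by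
  have e : z * z ^ (-p) = z ^ (1 - p) := by
    rw [sub_eq_add_neg, Real.rpow_add hz, Real.rpow_one]
  have h1 := rpow_mul_sq_le hp0 hp hz
  have h2 : z ^ p * z ^ (-p) = 1 := by rw [← Real.rpow_add hz, add_neg_cancel, Real.rpow_zero]
  have hpz : 0 < z ^ p := by positivity
  rw [e]
  set X := z ^ (1 - p) - 1
  have h3 : X * u ≤ 1 / 4 * (u ^ 2 * z ^ (-p)) + z ^ p * X ^ 2 := by
    have h4 : z ^ (-p) = (z ^ p)⁻¹ := Real.rpow_neg hz.le p
    have : 1 / 4 * (u ^ 2 * z ^ (-p)) + z ^ p * X ^ 2 - X * u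
        = (z ^ p)⁻¹ * (u / 2 - z ^ p * X) ^ 2 := by
      rw [h4]
      field_simp
      ring
    have h5 : 0 ≤ (z ^ p)⁻¹ * (u / 2 - z ^ p * X) ^ 2 := by positivity
    linarith
  calc X * u / v ≤ (1 / 4 * (u ^ 2 * z ^ (-p)) + 6 * (1 + z ^ (1 - p)) * thermal z) / v := by
        gcongr
        linarith
    _ = _ := by ring

namespace MHDFlow

/-- The sum of the squares of the derivatives of the velocities and of the magnetic field. -/
def gradSq (S : MHDFlow α β T) (q : ℝ × ℝ) : ℝ :=
  S.u.x q ^ 2 + (S.wa.x q ^ 2 + S.wb.x q ^ 2) + (S.ba.x q ^ 2 + S.bb.x q ^ 2)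

/-- The dissipation density controlled by the weighted energy estimate. -/
def dens (S : MHDFlow α β T) (q : ℝ × ℝ) : ℝ :=
  S.θ.x q ^ 2 / (S.v q * S.θ.f q) + S.gradSq q * S.pw (-(1 / 2)) q / S.v q

@[fun_prop]
theorem continuous_gradSq (S : MHDFlow α β T) : Continuous S.gradSq := by
  unfold gradSq
  fun_prop

@[fun_prop]
theorem continuous_dens (S : MHDFlow α β T) : Continuous S.dens := by
  unfold dens
  have h : ∀ q, S.v q * S.θ.f q ≠ 0 := fun q => mul_ne_zero (S.v_ne q) (S.θ_ne q)
  have := S.v_ne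
  fun_prop (disch := assumption)

theorem gradSq_nonneg (S : MHDFlow α β T) (q : ℝ × ℝ) : 0 ≤ S.gradSq q := by
  unfold gradSq
  positivity

theorem dens_nonneg (S : MHDFlow α β T) (q : ℝ × ℝ) : 0 ≤ S.dens q := by
  have := S.v_pos q
  have := S.θ_pos q
  have := S.gradSq_nonneg q
  have := S.pw_pos (-(1 / 2)) q
  unfold dens
  positivity

theorem gradSq_div_le_heat (S : MHDFlow α β T) (hα : 0 ≤ α) (q : ℝ × ℝ) :
    S.gradSq q / S.v q ≤ S.heat q := by
  have hv := S.v_pos q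
  have := S.one_le_mu hα q
  unfold gradSq heat
  have : 1 * S.u.x q ^ 2 ≤ S.mu q * S.u.x q ^ 2 := by gcongr
  gcongr
  linarith

theorem dens_le_diss (S : MHDFlow α β T) (hα : 0 ≤ α) {p c : ℝ} (hp : 0 < p) (hpβ : p ≤ β)
    (hp2 : p ≤ 1 / 2) (hc : 0 < c) {q : ℝ × ℝ} (h : c ≤ S.θ.f q) :
    S.dens q ≤ (c ^ (p - 1 / 2) + 1 / (p * c ^ (β - p))) * S.diss p q := by
  have hv := S.v_pos q
  have hθ := S.θ_pos q
  have hg := S.gradSq_nonneg q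
  have hpw := S.pw_pos (-p) q
  have hheat := S.heat_nonneg hα q
  have hk := S.rpow_le_pw_mul_pw hpβ hc h
  have hc1 : 0 < c ^ (β - p) := by positivity
  have hc2 : 0 < c ^ (p - 1 / 2) := by positivity
  have h1 : S.pw (-(1 / 2)) q ≤ c ^ (p - 1 / 2) * S.pw (-p) q := by
    have : S.pw (-(1 / 2)) q = S.θ.f q ^ (p - 1 / 2) * S.pw (-p) q := by
      rw [pw, pw, ← Real.rpow_add hθ]
      congr 1
      ring
    rw [this]
    exact mul_le_mul_of_nonneg_right (Real.rpow_le_rpow_of_nonpos hc h (by linarith)) hpw.le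
  have h2 : S.gradSq q * S.pw (-(1 / 2)) q / S.v q
      ≤ c ^ (p - 1 / 2) * (S.heat q * S.pw (-p) q) := by
    calc _ = S.gradSq q / S.v q * S.pw (-(1 / 2)) q := by ring
      _ ≤ S.heat q * (c ^ (p - 1 / 2) * S.pw (-p) q) :=
        mul_le_mul (S.gradSq_div_le_heat hα q) h1 (S.pw_pos _ q).le hheat
      _ = _ := by ring
  set Y := p * (S.pw β q * S.pw (-p) q / S.θ.f q * S.θ.x q ^ 2 / S.v q) with hY
  have h3 : S.θ.x q ^ 2 / (S.v q * S.θ.f q) ≤ 1 / (p * c ^ (β - p)) * Y := by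
    calc _ = 1 / (p * c ^ (β - p)) * (p * (c ^ (β - p) / S.θ.f q * S.θ.x q ^ 2 / S.v q)) := by
          field_simp
      _ ≤ _ := by
        rw [hY]
        gcongr
  have hY0 : 0 ≤ Y := by
    have := S.pw_pos β q
    positivity
  have e : S.diss p q = S.heat q * S.pw (-p) q + Y := rfl
  rw [e]
  unfold dens
  have h4 : 0 ≤ c ^ (p - 1 / 2) * Y + 1 / (p * c ^ (β - p)) * (S.heat q * S.pw (-p) q) := by
    positivity
  linarith

theorem exists_integral_diss_bound (hα : 0 ≤ α) (hT : 0 < T) (K : ℝ) (hδ : 0 < δ)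
    (hδ₁ : δ ≤ 1) {p : ℝ} (hp : 0 < p) (hpβ : p ≤ β) (hp1 : p < 1) :
    ∃ C, 0 < C ∧ ∀ S : MHDFlow α β T, S.Adm K δ → ∀ r, 0 ≤ r →
      ∫ t in (0:ℝ)..T, (∫ x in (-r)..r, S.diss p (x, t)) ≤ C := by
  obtain ⟨E, hE, hen⟩ := exists_energy_bound hα β hT K hδ
  obtain ⟨c, C₀, hc, hC₀, hv⟩ := exists_volume_bounds hα β hT K hδ
  obtain ⟨A, B, hA, hB, hsup⟩ := exists_cutoff_sup_bound hα hT K hδ hδ₁ hp hpβ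
  set ε := c / (24 * B * E) with hε
  have hε0 : 0 < ε := by positivity
  obtain ⟨Cε, hCε, hrp⟩ := exists_rpow_le_mul_add (q := 1 - p) (by linarith) (by linarith) hε0
  set G := 1 + 6 / c * ((1 + Cε) + ε * A) * E with hG
  refine ⟨8 * (E + G * T), by positivity, fun S hS r hr => ?_⟩
  have hH0 : ∀ q, 0 ≤ S.energy (thermalPow p) q :=
    S.energy_nonneg fun z hz => thermalPow_nonneg hp.le hp1 hz
  have hEc := S.continuous_energy (fun _ => hasDerivAt_thermal)
  have hEp := S.continuous_energy (fun _ => hasDerivAt_thermalPow hp1)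
  obtain ⟨R₀, hR₀, hbal⟩ := S.energy_balance hα hp (fun _ => hasDerivAt_thermalPow hp1)
  set R := max (max R₀ 1) (2 * r)
  have hR0 : R₀ ≤ R := (le_max_left _ _).trans (le_max_left _ _)
  have hR1 : 1 ≤ R := (le_max_right _ _).trans (le_max_left _ _)
  have hR2 : 2 * r ≤ R := le_max_right _ _
  have hRpos : 0 < R := by linarith
  have hI0 : ∀ s, 0 ≤ ∫ x in (-R)..R, cutoff R x * S.diss p (x, s) := fun s =>
    intervalIntegral.integral_nonneg (by linarith) fun x _ =>
      mul_nonneg (cutoff_nonneg R x) (S.diss_nonneg hα hp.le _)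
  have hg := gronwall_with_dissipation (A := 0) (B := G * T) (a := fun _ => 0) (g := fun _ => G) hT
    (y := fun s => ∫ x in (-R)..R, cutoff R x * S.energy (thermalPow p) (x, s))
    (y' := fun s => ∫ x in (-R)..R, cutoff R x * S.energyDot p (x, s))
    (z := fun s => 1 / 4 * ∫ x in (-R)..R, cutoff R x * S.diss p (x, s))
    (by fun_prop) (by fun_prop) (by fun_prop) (by fun_prop)
    (fun s hs => (hbal R hR0 s hs).1) (fun s hs => by
      have hs' := Ioo_subset_Icc_self hs
      have h1 := (hbal R hR0 s hs).2
      set I := ∫ x in (-R)..R, cutoff R x * S.diss p (x, s)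
      have h2 : ∫ x in (-R)..R, thermal (S.θ.f (x, s)) ≤ E :=
        integral_thermal_θ_le (hen S hS s hs' _ _ (by linarith)) (by linarith)
      have h3 := intervalIntegral_le_comb₂ (a := -R) (b := R)
        (f := fun x => cutoff R x * ((S.θ.f (x, s) * S.pw (-p) (x, s) - 1) * S.u.x (x, s)
          / S.v (x, s))) (c₁ := 1 / 4) (g₁ := fun x => cutoff R x * S.diss p (x, s))
        (c₂ := 6 / c * ((1 + Cε) + ε * (A + B * I))) (g₂ := fun x => thermal (S.θ.f (x, s)))
        (by linarith) (by fun_prop (disch := intro; exact S.v_ne _)) (by fun_prop)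
        (continuous_thermal_comp (by fun_prop) fun x => S.θ_pos _) (fun x hx => by
          have hx0 := cutoff_nonneg R x
          have hx1 := cutoff_le_one hRpos hx
          have hv0 := S.v_pos (x, s)
          have hθ0 := S.θ_pos (x, s)
          have hth := thermal_nonneg hθ0
          have h4 : S.u.x (x, s) ^ 2 / S.v (x, s) * S.pw (-p) (x, s) ≤ S.diss p (x, s) := by
            have h5 : S.u.x (x, s) ^ 2 / S.v (x, s) ≤ S.heat (x, s) := by
              refine le_trans ?_ (S.gradSq_div_le_heat hα _)
              unfold gradSq
              gcongr
              have : 0 ≤ (S.wa.x (x, s) ^ 2 + S.wb.x (x, s) ^ 2)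
                + (S.ba.x (x, s) ^ 2 + S.bb.x (x, s) ^ 2) := by positivity
              linarith
            have h6 := mul_le_mul_of_nonneg_right h5 (S.pw_pos (-p) (x, s)).le
            have h7 : 0 ≤ p * (S.pw β (x, s) * S.pw (-p) (x, s) / S.θ.f (x, s)
              * S.θ.x (x, s) ^ 2 / S.v (x, s)) := by
              have := S.pw_pos β (x, s)
              have := S.pw_pos (-p) (x, s)
              positivity
            unfold diss
            linarith
          have h5 := cross_term_le (u := S.u.x (x, s)) hp.le hp1.le hθ0 hv0
          have h6 := hrp _ hθ0
          have h7 := hsup S hS s hs' R hR1 x hx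
          have h8 := (hv S hS x s hs').1
          rw [show S.θ.f (x, s) ^ (-p) = S.pw (-p) (x, s) from rfl] at h5
          calc _ ≤ cutoff R x * (1 / 4 * S.diss p (x, s)
                + 6 * (1 + S.θ.f (x, s) ^ (1 - p)) * thermal (S.θ.f (x, s)) / S.v (x, s)) := by
                refine mul_le_mul_of_nonneg_left (h5.trans ?_) hx0
                linarith
            _ = 1 / 4 * (cutoff R x * S.diss p (x, s)) + cutoff R x * (
                6 * (1 + S.θ.f (x, s) ^ (1 - p)) * thermal (S.θ.f (x, s)) / S.v (x, s)) := by ring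
            _ ≤ 1 / 4 * (cutoff R x * S.diss p (x, s)) + cutoff R x * (
                6 * (1 + (ε * S.θ.f (x, s) + Cε)) * thermal (S.θ.f (x, s)) / c) := by gcongr
            _ = 1 / 4 * (cutoff R x * S.diss p (x, s)) + 6 / c * (
                ((1 + Cε) * cutoff R x + ε * (cutoff R x * S.θ.f (x, s)))
                  * thermal (S.θ.f (x, s))) := by ring
            _ ≤ 1 / 4 * (cutoff R x * S.diss p (x, s)) + 6 / c * (
                ((1 + Cε) * 1 + ε * (A + B * I)) * thermal (S.θ.f (x, s))) := by gcongr
            _ = _ := by ring)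
      have h4 : 6 / c * ((1 + Cε) + ε * (A + B * I)) * (∫ x in (-R)..R, thermal (S.θ.f (x, s)))
          ≤ 6 / c * ((1 + Cε) + ε * (A + B * I)) * E := by
        have : 0 ≤ I := hI0 s
        exact mul_le_mul_of_nonneg_left h2 (by positivity)
      have h5 : 6 / c * ((1 + Cε) + ε * (A + B * I)) * E = G - 1 + 1 / 4 * I := by
        rw [hG, hε]
        field_simp
        ring
      rw [zero_mul, zero_add]
      linarith)
    (fun s => mul_nonneg (by norm_num) (hI0 s))
    (fun _ => le_rfl) (fun _ => by positivity)
    (intervalIntegral.integral_nonneg (by linarith) fun x _ =>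
      mul_nonneg (cutoff_nonneg R x) (hH0 _)) (by simp) (by simp [mul_comm]) T ⟨hT.le, le_rfl⟩
  have h1 : ∫ x in (-R)..R, cutoff R x * S.energy (thermalPow p) (x, 0) ≤ E := by
    refine le_trans ?_ (hen S hS 0 ⟨le_rfl, hT.le⟩ (-R) R (by linarith))
    refine intervalIntegral_mono_of_continuous (by linarith) (by fun_prop) (by fun_prop)
      fun x hx => (mul_le_of_le_one_left (hH0 _) (cutoff_le_one hRpos hx)).trans ?_
    unfold energy
    gcongr
    exact thermalPow_le hp1 (S.θ_pos _)
  have h2 : 0 ≤ ∫ x in (-R)..R, cutoff R x * S.energy (thermalPow p) (x, T) :=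
    intervalIntegral.integral_nonneg (by linarith) fun x _ =>
      mul_nonneg (cutoff_nonneg R x) (hH0 _)
  have h3 := intervalIntegral_mono_of_continuous hT.le
    (f := fun t => ∫ x in (-r)..r, S.diss p (x, t))
    (g := fun t => 8 * (1 / 4 * ∫ x in (-R)..R, cutoff R x * S.diss p (x, t)))
    (by fun_prop) (by fun_prop) fun t ht => by
      have := integral_le_two_mul_cutoff hRpos hr hR2 (f := fun x => S.diss p (x, t))
        (by fun_prop) (fun x => S.diss_nonneg hα hp.le _)
      linarith
  rw [intervalIntegral.integral_const_mul] at h3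
  rw [Real.exp_zero, one_mul] at hg
  linarith

/-- The space-time dissipation estimate. -/
theorem exists_integral_dens_bound (hα : 0 ≤ α) (hβ : 0 < β) (hT : 0 < T) (K : ℝ) (hδ : 0 < δ)
    (hδ₁ : δ ≤ 1) :
    ∃ C, 0 < C ∧ ∀ S : MHDFlow α β T, S.Adm K δ → ∀ r, 0 ≤ r →
      ∫ t in (0:ℝ)..T, (∫ x in (-r)..r, S.dens (x, t)) ≤ C := by
  obtain ⟨c, hc, hθ⟩ := exists_temperature_lower_bound hα β hT K hδ hδ₁
  set p := min β (1 / 2)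
  have hp : 0 < p := lt_min hβ (by norm_num)
  have hpβ : p ≤ β := min_le_left _ _
  have hp2 : p ≤ 1 / 2 := min_le_right _ _
  obtain ⟨C, hC, h⟩ := exists_integral_diss_bound hα hT K hδ hδ₁ hp hpβ (by linarith)
  set κ := c ^ (p - 1 / 2) + 1 / (p * c ^ (β - p))
  have hκ : 0 < κ := by positivity
  refine ⟨κ * C, by positivity, fun S hS r hr => ?_⟩
  refine le_trans ?_ (mul_le_mul_of_nonneg_left (h S hS r hr) hκ.le)
  rw [← intervalIntegral.integral_const_mul]
  refine intervalIntegral_mono_of_continuous hT.le (by fun_prop) (by fun_prop) fun t ht => ?_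
  rw [← intervalIntegral.integral_const_mul]
  exact intervalIntegral_mono_of_continuous (by linarith) (by fun_prop) (by fun_prop) fun x _ =>
    S.dens_le_diss hα hp hpβ hp2 hc (hθ S hS x t ht)

end MHDFlow

end DissipationBound

section SupBounds

variable {α β T K δ : ℝ}

theorem abs_two_mul_le {k : ℝ} (hk : 0 < k) (x y : ℝ) : |2 * (x * y)| ≤ x ^ 2 / k + k * y ^ 2 := by
  have h1 : x ^ 2 / k + k * y ^ 2 - 2 * (x * y) = (x - k * y) ^ 2 / k := by
    field_simp
    ring
  have h2 : x ^ 2 / k + k * y ^ 2 + 2 * (x * y) = (x + k * y) ^ 2 / k := by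
    field_simp
    ring
  have h3 : 0 ≤ (x - k * y) ^ 2 / k := by positivity
  have h4 : 0 ≤ (x + k * y) ^ 2 / k := by positivity
  exact abs_le.2 ⟨by linarith, by linarith⟩

theorem abs_two_mul_add_le {k : ℝ} (hk : 0 < k) (x₁ x₂ y₁ y₂ : ℝ) :
    |2 * (x₁ * y₁ + x₂ * y₂)| ≤ (x₁ ^ 2 + x₂ ^ 2) / k + k * (y₁ ^ 2 + y₂ ^ 2) := by
  rw [mul_add]
  refine (abs_add_le _ _).trans ((add_le_add (abs_two_mul_le hk _ _)
    (abs_two_mul_le hk _ _)).trans_eq ?_)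
  ring

namespace MHDFlow

/-- The square of the magnetic field. -/
def magSq (S : MHDFlow α β T) (q : ℝ × ℝ) : ℝ := S.ba.f q ^ 2 + S.bb.f q ^ 2

@[fun_prop]
theorem continuous_magSq (S : MHDFlow α β T) : Continuous S.magSq := by
  unfold magSq
  fun_prop

theorem magSq_nonneg (S : MHDFlow α β T) (q : ℝ × ℝ) : 0 ≤ S.magSq q := by
  unfold magSq
  positivity

theorem hasDerivAt_magSq (S : MHDFlow α β T) (x t : ℝ) : HasDerivAt (fun y => S.magSq (y, t))
    (2 * (S.ba.x (x, t) * S.ba.f (x, t) + S.bb.x (x, t) * S.bb.f (x, t))) x :=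
  (((S.ba.hx x t).pow 2).add ((S.bb.hx x t).pow 2)).congr_deriv (by ring)

theorem pw_neg_half (S : MHDFlow α β T) (q : ℝ × ℝ) :
    S.pw (-(1 / 2)) q = (√(S.θ.f q))⁻¹ := by
  rw [pw, Real.rpow_neg (S.θ_pos q).le, ← Real.sqrt_eq_rpow]

theorem θ_x_sq_div_le_dens (S : MHDFlow α β T) (q : ℝ × ℝ) :
    S.θ.x q ^ 2 / (S.v q * S.θ.f q) ≤ S.dens q := by
  have := S.v_pos q
  have := S.gradSq_nonneg q
  have := S.pw_pos (-(1 / 2)) q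
  have : 0 ≤ S.gradSq q * S.pw (-(1 / 2)) q / S.v q := by positivity
  unfold dens
  linarith

theorem gradSq_div_le_dens (S : MHDFlow α β T) (q : ℝ × ℝ) :
    S.gradSq q / (S.v q * √(S.θ.f q)) ≤ S.dens q := by
  have h1 := S.v_pos q
  have h2 := S.θ_pos q
  have : 0 ≤ S.θ.x q ^ 2 / (S.v q * S.θ.f q) := by positivity
  have h3 : 0 < √(S.θ.f q) := Real.sqrt_pos.2 h2
  have e : S.gradSq q / (S.v q * √(S.θ.f q)) = S.gradSq q * S.pw (-(1 / 2)) q / S.v q := by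
    rw [S.pw_neg_half]
    field_simp
  unfold dens
  linarith

theorem integral_dens_nonneg (S : MHDFlow α β T) {a b : ℝ} (hab : a ≤ b) (t : ℝ) :
    0 ≤ ∫ x in a..b, S.dens (x, t) :=
  intervalIntegral.integral_nonneg hab fun _ _ => S.dens_nonneg _

theorem unit_integral_v_mul_magSq_le {S : MHDFlow α β T} {C a t : ℝ}
    (h : ∫ x in a..(a + 1), S.energy thermal (x, t) ≤ C) :
    ∫ x in a..(a + 1), S.v (x, t) * S.magSq (x, t) ≤ 2 * C := by
  have hE := S.continuous_energy (fun _ => hasDerivAt_thermal)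
  have := intervalIntegral_mono_of_continuous (a := a) (b := a + 1) (by linarith)
    (f := fun x => S.v (x, t) * S.magSq (x, t)) (g := fun x => 2 * S.energy thermal (x, t))
    (by fun_prop) (by fun_prop) fun x _ => by
      have h1 := thermal_nonneg (S.v_pos (x, t))
      have h2 := thermal_nonneg (S.θ_pos (x, t))
      unfold energy magSq
      unfold thermal at h1
      linarith [sq_nonneg (S.u.f (x, t)), sq_nonneg (S.wa.f (x, t)), sq_nonneg (S.wb.f (x, t))]
  rw [intervalIntegral.integral_const_mul] at this
  linarith

theorem exists_magSq_le {S : MHDFlow α β T} {C a t c : ℝ} (hc : 0 < c)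
    (hv : ∀ x, c ≤ S.v (x, t)) (h : ∫ x in a..(a + 1), S.energy thermal (x, t) ≤ C) :
    ∃ y ∈ Icc a (a + 1), S.magSq (y, t) ≤ 2 * C / c := by
  obtain ⟨y, hy, hy'⟩ := exists_le_of_integral_unit_le
    (f := fun x => S.v (x, t) * S.magSq (x, t)) (by fun_prop) (unit_integral_v_mul_magSq_le h)
  refine ⟨y, hy, ?_⟩
  rw [le_div_iff₀ hc]
  have := mul_le_mul_of_nonneg_right (hv y) (S.magSq_nonneg (y, t))
  linarith

/-- The temperature is bounded by the local dissipation. -/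
theorem exists_θ_sup_bound (hα : 0 ≤ α) (β : ℝ) (hT : 0 < T) (K : ℝ) (hδ : 0 < δ) :
    ∃ C, 0 < C ∧ ∀ S : MHDFlow α β T, S.Adm K δ → ∀ t ∈ Icc 0 T, ∀ a, ∀ x ∈ Icc a (a + 1),
      S.θ.f (x, t) ≤ C * (1 + ∫ z in a..(a + 1), S.dens (z, t)) := by
  obtain ⟨E, hE, hen⟩ := exists_energy_bound hα β hT K hδ
  refine ⟨4 * (E + 1), by positivity, fun S hS t ht a => ?_⟩
  obtain ⟨x₀, hx₀, hmax⟩ := isCompact_Icc.exists_isMaxOn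
    (nonempty_Icc.2 (by linarith : a ≤ a + 1))
    (f := fun x => S.θ.f (x, t)) (Continuous.continuousOn (by fun_prop))
  refine fun x hx => (hmax hx).trans ?_
  have hen' := hen S hS t ht a (a + 1) (by linarith)
  obtain ⟨y, hy, hy'⟩ := exists_θ_le hen'
  set s := S.θ.f (x₀, t) with hs
  have hs0 : 0 < s := S.θ_pos _
  have h1 := sub_le_integral_abs_deriv (f := fun x => S.θ.f (x, t))
    (f' := fun x => S.θ.x (x, t)) (fun x => S.θ.hx x t) (by fun_prop) hx₀ hy
  have h2 := intervalIntegral_le_comb₂ (a := a) (b := a + 1) (f := fun x => |S.θ.x (x, t)|)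
    (c₁ := E + 1) (c₂ := s / (4 * (E + 1))) (g₁ := fun x => S.dens (x, t))
    (g₂ := fun x => S.v (x, t)) (by linarith) (by fun_prop) (by fun_prop) (by fun_prop)
    fun z hz => by
      have hv := S.v_pos (z, t)
      have hθ := S.θ_pos (z, t)
      have h3 := abs_le_young (a := (E + 1) / (S.v (z, t) * S.θ.f (z, t))) (by positivity)
        (S.θ.x (z, t))
      have h4 := S.θ_x_sq_div_le_dens (z, t)
      have h5 : S.θ.f (z, t) ≤ s := hmax hz
      calc _ ≤ _ := h3
        _ = (E + 1) * (S.θ.x (z, t) ^ 2 / (S.v (z, t) * S.θ.f (z, t)))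
          + S.θ.f (z, t) / (4 * (E + 1)) * S.v (z, t) := by field_simp
        _ ≤ _ := by gcongr
  have h3 := unit_integral_v_le hen'
  have h4 : s / (4 * (E + 1)) * (∫ x in a..(a + 1), S.v (x, t)) ≤ s / 2 := by
    calc _ ≤ s / (4 * (E + 1)) * (2 * E + 2) := mul_le_mul_of_nonneg_left h3 (by positivity)
      _ = s / 2 := by field_simp; ring
  have h5 : 0 ≤ (E + 1) * ∫ z in a..(a + 1), S.dens (z, t) :=
    mul_nonneg (by linarith) (S.integral_dens_nonneg (by linarith) t)
  linarith

/-- The magnetic field is bounded by the local dissipation. -/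
theorem exists_magSq_sup_bound (hα : 0 ≤ α) (β : ℝ) (hT : 0 < T) (K : ℝ) (hδ : 0 < δ) :
    ∃ C, 0 < C ∧ ∀ S : MHDFlow α β T, S.Adm K δ → ∀ t ∈ Icc 0 T, ∀ a, ∀ x ∈ Icc a (a + 1),
      S.magSq (x, t) ≤ C * (1 + ∫ z in a..(a + 1), S.dens (z, t)) := by
  obtain ⟨E, hE, hen⟩ := exists_energy_bound hα β hT K hδ
  obtain ⟨c, C₀, hc, hC₀, hv⟩ := exists_volume_bounds hα β hT K hδ
  obtain ⟨C₁, hC₁, hθ⟩ := exists_θ_sup_bound hα β hT K hδ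
  refine ⟨2 * E / c + 1 + 2 * E * (1 + C₁), by positivity, fun S hS t ht a x hx => ?_⟩
  have hen' := hen S hS t ht a (a + 1) (by linarith)
  obtain ⟨y, hy, hy'⟩ := exists_magSq_le hc (fun x => (hv S hS x t ht).1) hen'
  have h1 := sub_le_integral_abs_deriv (f := fun x => S.magSq (x, t))
    (fun x => S.hasDerivAt_magSq x t) (by fun_prop) hx hy
  set d := ∫ z in a..(a + 1), S.dens (z, t) with hd
  have hd0 : 0 ≤ d := S.integral_dens_nonneg (by linarith) t
  have h2 := intervalIntegral_le_comb₂ (a := a) (b := a + 1)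
    (f := fun x => |2 * (S.ba.x (x, t) * S.ba.f (x, t) + S.bb.x (x, t) * S.bb.f (x, t))|)
    (c₁ := 1) (c₂ := 1 + C₁ * (1 + d)) (g₁ := fun x => S.dens (x, t))
    (g₂ := fun x => S.v (x, t) * S.magSq (x, t)) (by linarith) (by fun_prop) (by fun_prop)
    (by fun_prop) fun z hz => by
      have hv := S.v_pos (z, t)
      have hθ0 := S.θ_pos (z, t)
      have hm := S.magSq_nonneg (z, t)
      have hr : 0 < √(S.θ.f (z, t)) := Real.sqrt_pos.2 hθ0
      have h4 := S.gradSq_div_le_dens (z, t)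
      have h5 := hθ S hS t ht a z hz
      have h6 : √(S.θ.f (z, t)) ≤ 1 + S.θ.f (z, t) := by
        rw [Real.sqrt_le_left (by positivity)]
        nlinarith
      have h7 := abs_two_mul_add_le (k := S.v (z, t) * √(S.θ.f (z, t))) (by positivity)
        (S.ba.x (z, t)) (S.bb.x (z, t)) (S.ba.f (z, t)) (S.bb.f (z, t))
      have h8 : (S.ba.x (z, t) ^ 2 + S.bb.x (z, t) ^ 2) / (S.v (z, t) * √(S.θ.f (z, t)))
          ≤ S.gradSq (z, t) / (S.v (z, t) * √(S.θ.f (z, t))) := by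
        unfold gradSq
        have : 0 ≤ S.u.x (z, t) ^ 2 + (S.wa.x (z, t) ^ 2 + S.wb.x (z, t) ^ 2) := by positivity
        exact div_le_div_of_nonneg_right (by linarith) (by positivity)
      rw [show S.ba.f (z, t) ^ 2 + S.bb.f (z, t) ^ 2 = S.magSq (z, t) from rfl] at h7
      have h9 : S.v (z, t) * √(S.θ.f (z, t)) * S.magSq (z, t)
          ≤ (1 + C₁ * (1 + d)) * (S.v (z, t) * S.magSq (z, t)) := by
        calc _ = √(S.θ.f (z, t)) * (S.v (z, t) * S.magSq (z, t)) := by ring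
          _ ≤ _ := by
            refine mul_le_mul_of_nonneg_right ?_ (by positivity)
            linarith
      linarith
  have h3 := unit_integral_v_mul_magSq_le hen'
  have h4 := mul_le_mul_of_nonneg_left h3 (by positivity : 0 ≤ 1 + C₁ * (1 + d))
  have h5 : 0 ≤ 2 * E / c * d := by positivity
  have h6 : 0 ≤ 2 * E * d := by positivity
  linarith

theorem integral_impulse_dens_le {S : MHDFlow α β T} {C a : ℝ} (hT : 0 < T)
    (h : ∀ r, 0 ≤ r → ∫ t in (0:ℝ)..T, (∫ x in (-r)..r, S.dens (x, t)) ≤ C) {t : ℝ}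
    (ht : t ∈ Icc 0 T) : ∫ s in (0:ℝ)..t, (∫ x in a..(a + 1), S.dens (x, s)) ≤ C := by
  refine le_trans ?_ (h (|a| + 1) (by positivity))
  refine (intervalIntegral.integral_mono_interval le_rfl ht.1 ht.2 (Eventually.of_forall fun s =>
    S.integral_dens_nonneg (by linarith) s) (Continuous.intervalIntegrable (by fun_prop) _ _)).trans
    (intervalIntegral_mono_of_continuous hT.le (by fun_prop) (by fun_prop) fun s _ => ?_)
  exact intervalIntegral.integral_mono_interval (by linarith [neg_abs_le a]) (by linarith)
    (by linarith [le_abs_self a]) (Eventually.of_forall fun s => S.dens_nonneg _)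
    (Continuous.intervalIntegrable (by fun_prop) _ _)

/-- The specific volume is bounded above and below. -/
theorem exists_v_bounds (hα : 0 ≤ α) (hβ : 0 < β) (hT : 0 < T) (K : ℝ) (hδ : 0 < δ)
    (hδ₁ : δ ≤ 1) : ∃ c C, 0 < c ∧ 0 < C ∧ ∀ S : MHDFlow α β T, S.Adm K δ → ∀ x, ∀ t ∈ Icc 0 T,
      c ≤ S.v (x, t) ∧ S.v (x, t) ≤ C := by
  obtain ⟨c, C₀, hc, hC₀, hv⟩ := exists_volume_bounds hα β hT K hδ
  obtain ⟨C₁, hC₁, hθ⟩ := exists_θ_sup_bound hα β hT K hδ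
  obtain ⟨C₂, hC₂, hb⟩ := exists_magSq_sup_bound hα β hT K hδ
  obtain ⟨D, hD, hdens⟩ := exists_integral_dens_bound hα hβ hT K hδ hδ₁
  refine ⟨c, C₀ * Real.exp ((C₁ / c + C₂) * (T + D)), hc, by positivity,
    fun S hS x t ht => ⟨(hv S hS x t ht).1, (hv S hS x t ht).2.trans ?_⟩⟩
  have h1 : S.impulse x t ≤ (C₁ / c + C₂) * (T + D) := by
    have h2 := intervalIntegral_le_comb₂ (a := 0) (b := t) (f := fun s => S.pressure (x, s))
      (c₁ := C₁ / c + C₂) (c₂ := C₁ / c + C₂) (g₁ := fun _ => 1)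
      (g₂ := fun s => ∫ z in x..(x + 1), S.dens (z, s)) ht.1 (by fun_prop) (by fun_prop)
      (by fun_prop) fun s hs => by
        have hs' : s ∈ Icc 0 T := ⟨hs.1, hs.2.trans ht.2⟩
        have hx : x ∈ Icc x (x + 1) := ⟨le_rfl, by linarith⟩
        have h3 := hθ S hS s hs' x x hx
        have h4 := hb S hS s hs' x x hx
        have h5 := (hv S hS x s hs').1
        have h6 := S.θ_pos (x, s)
        have h7 := S.magSq_nonneg (x, s)
        have hd0 := S.integral_dens_nonneg (by linarith : x ≤ x + 1) s
        set d := ∫ z in x..(x + 1), S.dens (z, s)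
        calc S.pressure (x, s) = S.θ.f (x, s) / S.v (x, s) + S.magSq (x, s) / 2 := rfl
          _ ≤ C₁ * (1 + d) / c + C₂ * (1 + d) := by
            exact add_le_add (div_le_div₀ (by positivity) h3 hc h5) (by linarith)
          _ = _ := by ring
    have h3 := integral_impulse_dens_le (a := x) hT (hdens S hS) ht
    have h4 : 0 < C₁ / c + C₂ := by positivity
    have h5 := mul_le_mul_of_nonneg_left h3 h4.le
    have h6 := mul_le_mul_of_nonneg_left ht.2 h4.le
    simp only [intervalIntegral.integral_const, smul_eq_mul] at h2
    unfold impulse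
    linarith
  gcongr

/-- The square of the temperature is bounded by the local dissipation. -/
theorem exists_θ_sq_sup_bound (hα : 0 ≤ α) (hβ : 0 < β) (hT : 0 < T) (K : ℝ) (hδ : 0 < δ)
    (hδ₁ : δ ≤ 1) :
    ∃ C, 0 < C ∧ ∀ S : MHDFlow α β T, S.Adm K δ → ∀ t ∈ Icc 0 T, ∀ a, ∀ x ∈ Icc a (a + 1),
      S.θ.f (x, t) ^ 2 ≤ C * (1 + ∫ z in a..(a + 1), S.dens (z, t)) := by
  obtain ⟨E, hE, hen⟩ := exists_energy_bound hα β hT K hδ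
  obtain ⟨c, V, hc, hV, hv⟩ := exists_v_bounds hα hβ hT K hδ hδ₁
  set l := 2 * V * (2 * E + 2) with hl
  have hl0 : 0 < l := by positivity
  refine ⟨2 * (2 * E + 2) ^ 2 + 2 * l, by positivity, fun S hS t ht a => ?_⟩
  obtain ⟨x₀, hx₀, hmax⟩ := isCompact_Icc.exists_isMaxOn
    (nonempty_Icc.2 (by linarith : a ≤ a + 1))
    (f := fun x => S.θ.f (x, t)) (Continuous.continuousOn (by fun_prop))
  intro x hx
  have hen' := hen S hS t ht a (a + 1) (by linarith)
  obtain ⟨y, hy, hy'⟩ := exists_θ_le hen'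
  set s := S.θ.f (x₀, t) with hs
  have hs0 : 0 < s := S.θ_pos _
  have hxs : S.θ.f (x, t) ^ 2 ≤ s ^ 2 := pow_le_pow_left₀ (S.θ_pos _).le (hmax hx) 2
  have hys : S.θ.f (y, t) ^ 2 ≤ (2 * E + 2) ^ 2 := pow_le_pow_left₀ (S.θ_pos _).le hy' 2
  have h1 := sub_le_integral_abs_deriv (f := fun x => S.θ.f (x, t) ^ 2)
    (f' := fun x => 2 * (S.θ.x (x, t) * S.θ.f (x, t)))
    (fun x => ((S.θ.hx x t).pow 2).congr_deriv (by ring)) (by fun_prop) hx₀ hy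
  have h2 := intervalIntegral_le_comb₂ (a := a) (b := a + 1)
    (f := fun x => |2 * (S.θ.x (x, t) * S.θ.f (x, t))|)
    (c₁ := l) (c₂ := V * s ^ 2 / l) (g₁ := fun x => S.dens (x, t))
    (g₂ := fun x => S.θ.f (x, t)) (by linarith) (by fun_prop) (by fun_prop) (by fun_prop)
    fun z hz => by
      have hv0 := S.v_pos (z, t)
      have hvV := (hv S hS z t ht).2
      have hθ := S.θ_pos (z, t)
      have h3 := abs_two_mul_le (k := S.v (z, t) * S.θ.f (z, t) / l) (by positivity)
        (S.θ.x (z, t)) (S.θ.f (z, t))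
      have h4 := S.θ_x_sq_div_le_dens (z, t)
      have h5 : S.θ.f (z, t) ≤ s := hmax hz
      calc _ ≤ _ := h3
        _ = l * (S.θ.x (z, t) ^ 2 / (S.v (z, t) * S.θ.f (z, t)))
          + S.v (z, t) * S.θ.f (z, t) ^ 2 / l * S.θ.f (z, t) := by field_simp
        _ ≤ _ := by gcongr
  have h3 := unit_integral_θ_le hen'
  have h4 : V * s ^ 2 / l * (∫ x in a..(a + 1), S.θ.f (x, t)) ≤ s ^ 2 / 2 := by
    calc _ ≤ V * s ^ 2 / l * (2 * E + 2) := mul_le_mul_of_nonneg_left h3 (by positivity)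
      _ = s ^ 2 / 2 := by rw [hl]; field_simp
  rw [← hs] at h1
  set d := ∫ z in a..(a + 1), S.dens (z, t)
  have h5 : 0 ≤ d := S.integral_dens_nonneg (by linarith) t
  have h6 : 0 ≤ 2 * (2 * E + 2) ^ 2 * d := by positivity
  linarith

/-- The magnetic field weighted by the square root of the temperature is bounded by the local
dissipation. -/
theorem exists_sqrt_mul_magSq_sup_bound (hα : 0 ≤ α) (hβ : 0 < β) (hT : 0 < T) (K : ℝ)
    (hδ : 0 < δ) (hδ₁ : δ ≤ 1) :
    ∃ C, 0 < C ∧ ∀ S : MHDFlow α β T, S.Adm K δ → ∀ t ∈ Icc 0 T, ∀ a, ∀ x ∈ Icc a (a + 1),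
      √(S.θ.f (x, t)) * S.magSq (x, t) ≤ C * (1 + ∫ z in a..(a + 1), S.dens (z, t)) := by
  obtain ⟨E, hE, hen⟩ := exists_energy_bound hα β hT K hδ
  obtain ⟨c, C₀, hc, hC₀, hv⟩ := exists_volume_bounds hα β hT K hδ
  obtain ⟨C₁, hC₁, hθ⟩ := exists_θ_sq_sup_bound hα hβ hT K hδ hδ₁
  refine ⟨(2 * E / c + 2 * E) * (1 + C₁) + 1, by positivity, fun S hS t ht a x hx => ?_⟩
  have hen' := hen S hS t ht a (a + 1) (by linarith)
  obtain ⟨y, hy, hy'⟩ := exists_magSq_le hc (fun x => (hv S hS x t ht).1) hen'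
  have h1 := sub_le_integral_abs_deriv (f := fun x => S.magSq (x, t))
    (fun x => S.hasDerivAt_magSq x t) (by fun_prop) hx hy
  set d := ∫ z in a..(a + 1), S.dens (z, t) with hd
  have hd0 : 0 ≤ d := S.integral_dens_nonneg (by linarith) t
  obtain ⟨s, hs0, hs⟩ : ∃ s : ℝ, 0 < s ∧ s ^ 4 = C₁ * (1 + d) := by
    refine ⟨√√(C₁ * (1 + d)), by positivity, ?_⟩
    rw [show (4:ℕ) = 2 * 2 by rfl, pow_mul, Real.sq_sqrt (by positivity),
      Real.sq_sqrt (by positivity)]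
  have hsθ : ∀ z ∈ Icc a (a + 1), √(S.θ.f (z, t)) ≤ s := fun z hz => by
    have h2 := hθ S hS t ht a z hz
    rw [← hd, ← hs, show s ^ 4 = (s ^ 2) ^ 2 by ring] at h2
    rw [Real.sqrt_le_left hs0.le]
    exact le_of_sq_le_sq h2 (by positivity)
  have h2 := intervalIntegral_le_comb₂ (a := a) (b := a + 1)
    (f := fun x => s * |2 * (S.ba.x (x, t) * S.ba.f (x, t) + S.bb.x (x, t) * S.bb.f (x, t))|)
    (c₁ := 1) (c₂ := s ^ 3) (g₁ := fun x => S.dens (x, t))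
    (g₂ := fun x => S.v (x, t) * S.magSq (x, t)) (by linarith) (by fun_prop) (by fun_prop)
    (by fun_prop) fun z hz => by
      have hv := S.v_pos (z, t)
      have hθ0 := S.θ_pos (z, t)
      have hm := S.magSq_nonneg (z, t)
      have hr : 0 < √(S.θ.f (z, t)) := Real.sqrt_pos.2 hθ0
      have h4 := S.gradSq_div_le_dens (z, t)
      have h7 := abs_two_mul_add_le (k := s * (S.v (z, t) * √(S.θ.f (z, t)))) (by positivity)
        (S.ba.x (z, t)) (S.bb.x (z, t)) (S.ba.f (z, t)) (S.bb.f (z, t))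
      have h8 : (S.ba.x (z, t) ^ 2 + S.bb.x (z, t) ^ 2) / (S.v (z, t) * √(S.θ.f (z, t)))
          ≤ S.gradSq (z, t) / (S.v (z, t) * √(S.θ.f (z, t))) := by
        unfold gradSq
        have : 0 ≤ S.u.x (z, t) ^ 2 + (S.wa.x (z, t) ^ 2 + S.wb.x (z, t) ^ 2) := by positivity
        exact div_le_div_of_nonneg_right (by linarith) (by positivity)
      rw [show S.ba.f (z, t) ^ 2 + S.bb.f (z, t) ^ 2 = S.magSq (z, t) from rfl] at h7
      calc _ ≤ _ := mul_le_mul_of_nonneg_left h7 hs0.le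
        _ = (S.ba.x (z, t) ^ 2 + S.bb.x (z, t) ^ 2) / (S.v (z, t) * √(S.θ.f (z, t)))
          + s ^ 2 * √(S.θ.f (z, t)) * (S.v (z, t) * S.magSq (z, t)) := by field_simp
        _ ≤ 1 * S.dens (z, t) + s ^ 2 * s * (S.v (z, t) * S.magSq (z, t)) := by
          refine add_le_add (by linarith) ?_
          have := hsθ z hz
          gcongr
        _ = _ := by ring
  rw [intervalIntegral.integral_const_mul, one_mul, ← hd] at h2
  have h3 := unit_integral_v_mul_magSq_le hen'
  have h4 : √(S.θ.f (x, t)) * S.magSq (x, t) ≤ s * S.magSq (x, t) :=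
    mul_le_mul_of_nonneg_right (hsθ x hx) (S.magSq_nonneg _)
  have h5 := mul_le_mul_of_nonneg_left h3 (by positivity : 0 ≤ s ^ 3)
  have h6 := mul_le_mul_of_nonneg_left h1 hs0.le
  have h7 := mul_le_mul_of_nonneg_left hy' hs0.le
  have h8 : s ≤ 1 + s ^ 4 := by nlinarith [sq_nonneg (s ^ 2 - 1 / 2), sq_nonneg (s - 1 / 2)]
  have h9 : s ^ 3 ≤ 1 + s ^ 4 := by nlinarith [sq_nonneg (s ^ 2 - s / 2), sq_nonneg (s - 1)]
  have h10 : s * (2 * E / c) ≤ (1 + s ^ 4) * (2 * E / c) :=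
    mul_le_mul_of_nonneg_right h8 (by positivity)
  have h11 : s ^ 3 * (2 * E) ≤ (1 + s ^ 4) * (2 * E) :=
    mul_le_mul_of_nonneg_right h9 (by positivity)
  rw [hs] at h10 h11
  calc _ ≤ (1 + C₁ * (1 + d)) * (2 * E / c) + (1 + C₁ * (1 + d)) * (2 * E) + d := by linarith
    _ ≤ _ := by
      have : 0 ≤ (2 * E / c + 2 * E) * d := by positivity
      linarith

end MHDFlow

end SupBounds

section VolumeGradient

variable {α β T K δ : ℝ}

theorem hasDerivAt_integral_param {f f' : ℝ × ℝ → ℝ} (hf : Continuous f) (hf' : Continuous f')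
    (h : ∀ x t, HasDerivAt (fun y => f (y, t)) (f' (x, t)) x) (a b x : ℝ) :
    HasDerivAt (fun y => ∫ s in a..b, f (y, s)) (∫ s in a..b, f' (x, s)) x := by
  have h1 := hasDerivAt_integral_of_continuous (T := 2) (a := a) (b := b)
    (f := fun s y => f (x - 1 + y, s)) (g := fun s y => f' (x - 1 + y, s))
    (by fun_prop) (by fun_prop) (fun s y _ => by
      simpa using HasDerivAt.comp_const_add (x - 1) y (h (x - 1 + y) s)) (t := 1)
    ⟨by norm_num, by norm_num⟩
  have h2 : HasDerivAt (fun y => ∫ s in a..b, f (x - 1 + (y - (x - 1)), s))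
      (∫ s in a..b, f' (x - 1 + 1, s)) x := by
    refine HasDerivAt.comp_sub_const (f := fun y => ∫ s in a..b, f (x - 1 + y, s)) x (x - 1) ?_
    rwa [sub_sub_cancel]
  simpa using h2

theorem integral_const_mul_one_add_le {T D a : ℝ} {d : ℝ → ℝ} (hd : Continuous d) (ha : 0 ≤ a)
    (h : ∫ s in (0:ℝ)..T, d s ≤ D) : ∫ s in (0:ℝ)..T, a * (1 + d s) ≤ a * (T + D) := by
  rw [intervalIntegral.integral_const_mul, intervalIntegral.integral_add (by simp)
    (hd.intervalIntegrable _ _)]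
  simp only [intervalIntegral.integral_const, smul_eq_mul]
  gcongr
  linarith

namespace MHDFlow

theorem v_eq_add_integral (S : MHDFlow α β T) (x : ℝ) {t : ℝ} (ht : t ∈ Icc 0 T) :
    S.v (x, t) = S.v (x, 0) + ∫ s in (0:ℝ)..t, S.u.x (x, s) := by
  rw [intervalIntegral.integral_eq_sub_of_hasDerivAt_of_le ht.1 (f := fun s => S.v (x, s))
    (Continuous.continuousOn (by fun_prop)) (fun s hs => S.hvt x s ⟨hs.1, hs.2.trans_le ht.2⟩)
    (Continuous.intervalIntegrable (by fun_prop) _ _)]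
  ring

theorem vx_eq_add_integral (S : MHDFlow α β T) (x : ℝ) {t : ℝ} (ht : t ∈ Icc 0 T) :
    S.vx (x, t) = S.vx (x, 0) + ∫ s in (0:ℝ)..t, S.u.xx (x, s) := by
  refine (S.hvx x t).unique ?_
  have h := (S.hvx x 0).add (hasDerivAt_integral_param S.u.x.continuous S.u.xx.continuous
    (fun x t => S.u.hxx x t) 0 t x)
  exact h.congr_of_eventuallyEq (Eventually.of_forall fun y => S.v_eq_add_integral y ht)

theorem hasDerivAt_vx_t (S : MHDFlow α β T) (x : ℝ) {t : ℝ} (ht : t ∈ Ioo 0 T) :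
    HasDerivAt (fun s => S.vx (x, s)) (S.u.xx (x, t)) t := by
  have h1 : Continuous fun s => S.u.xx (x, s) := by fun_prop
  have h := (h1.integral_hasStrictDerivAt 0 t).hasDerivAt.const_add (S.vx (x, 0))
  refine h.congr_of_eventuallyEq ?_
  filter_upwards [Ioo_mem_nhds ht.1 ht.2] with s hs
  exact S.vx_eq_add_integral x (Ioo_subset_Icc_self hs)

/-- The effective velocity `μ(v) v_x / v - u`. -/
def effVel (S : MHDFlow α β T) (q : ℝ × ℝ) : ℝ := S.mu q / S.v q * S.vx q - S.u.f q

/-- The time derivative of the effective velocity: the gradient of the total pressure. -/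
def effForce (S : MHDFlow α β T) (q : ℝ × ℝ) : ℝ :=
  S.θ.x q / S.v q - S.θ.f q * S.vx q / S.v q ^ 2
    + (S.ba.x q * S.ba.f q + S.bb.x q * S.bb.f q)

@[fun_prop]
theorem continuous_effVel (S : MHDFlow α β T) : Continuous S.effVel := by
  unfold effVel
  have hv := S.v_ne
  fun_prop (disch := assumption)

@[fun_prop]
theorem continuous_effForce (S : MHDFlow α β T) : Continuous S.effForce := by
  unfold effForce
  have hv := S.v_ne
  have hv2 : ∀ q, S.v q ^ 2 ≠ 0 := fun q => pow_ne_zero 2 (S.v_ne q)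
  fun_prop (disch := assumption)

theorem hasDerivAt_effVel (S : MHDFlow α β T) (x : ℝ) {t : ℝ} (ht : t ∈ Ioo 0 T) :
    HasDerivAt (fun s => S.effVel (x, s)) (S.effForce (x, t)) t := by
  have h1 : HasDerivAt (fun s => visc α (S.v (x, s)) / S.v (x, s))
      (viscDivDeriv α (S.v (x, t)) * S.u.x (x, t)) t :=
    HasDerivAt.comp (h₂ := fun z => visc α z / z) t (hasDerivAt_visc_div α (S.v_pos (x, t)))
      (S.hvt x t ht)
  refine ((h1.mul (S.hasDerivAt_vx_t x ht)).sub (S.u.ht x t ht)).congr_deriv ?_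
  rw [S.eq_u (x, t)]
  unfold effForce
  ring

theorem effForce_mul_le {S : MHDFlow α β T} (hα : 0 ≤ α) {c V : ℝ} (hc : 0 < c) {q : ℝ × ℝ}
    (hv : c ≤ S.v q) (hV : S.v q ≤ V) :
    2 * S.effVel q * S.effForce q
      ≤ (S.θ.f q / c + V * (√(S.θ.f q) * S.magSq q)) * S.effVel q ^ 2
        + S.θ.f q / (2 * c) * S.u.f q ^ 2 + 2 * S.dens q := by
  have hv0 := S.v_pos q
  have hθ := S.θ_pos q
  have hr : 0 < √(S.θ.f q) := Real.sqrt_pos.2 hθ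
  have hm0 := S.magSq_nonneg q
  have hmu := S.one_le_mu hα q
  set ψ := S.effVel q with hψ
  have h1 : S.vx q = (ψ + S.u.f q) * S.v q / S.mu q := by
    rw [hψ, effVel]
    field_simp
    ring
  have h2 : 2 * ψ * (S.θ.x q / S.v q) ≤ S.θ.f q / c * ψ ^ 2
      + S.θ.x q ^ 2 / (S.v q * S.θ.f q) := by
    have h := (le_abs_self _).trans (abs_two_mul_le hθ (S.θ.x q) ψ)
    calc 2 * ψ * (S.θ.x q / S.v q) = 2 * (S.θ.x q * ψ) / S.v q := by ring
      _ ≤ (S.θ.x q ^ 2 / S.θ.f q + S.θ.f q * ψ ^ 2) / S.v q := by gcongr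
      _ = S.θ.f q / S.v q * ψ ^ 2 + S.θ.x q ^ 2 / (S.v q * S.θ.f q) := by
        field_simp
        ring
      _ ≤ _ := by gcongr
  have h3 : 2 * ψ * (S.ba.x q * S.ba.f q + S.bb.x q * S.bb.f q)
      ≤ V * (√(S.θ.f q) * S.magSq q) * ψ ^ 2 + S.gradSq q / (S.v q * √(S.θ.f q)) := by
    have h := (le_abs_self _).trans (abs_two_mul_add_le (k := S.v q * √(S.θ.f q))
      (by positivity) (S.ba.x q) (S.bb.x q) (ψ * S.ba.f q) (ψ * S.bb.f q))
    calc _ = 2 * (S.ba.x q * (ψ * S.ba.f q) + S.bb.x q * (ψ * S.bb.f q)) := by ring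
      _ ≤ _ := h
      _ = S.v q * (√(S.θ.f q) * S.magSq q) * ψ ^ 2
          + (S.ba.x q ^ 2 + S.bb.x q ^ 2) / (S.v q * √(S.θ.f q)) := by
        unfold magSq
        ring
      _ ≤ _ := by
        refine add_le_add (by gcongr) (div_le_div_of_nonneg_right ?_ (by positivity))
        unfold gradSq
        nlinarith [sq_nonneg (S.u.x q), sq_nonneg (S.wa.x q), sq_nonneg (S.wb.x q)]
  have h4 : 2 * ψ * -(S.θ.f q * S.vx q / S.v q ^ 2) ≤ S.θ.f q / (2 * c) * S.u.f q ^ 2 := by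
    rw [h1]
    calc _ = S.θ.f q / (S.v q * S.mu q) * (-2 * (ψ ^ 2 + S.u.f q * ψ)) := by
          field_simp
      _ ≤ S.θ.f q / (S.v q * S.mu q) * (S.u.f q ^ 2 / 2) := by
        gcongr
        nlinarith [sq_nonneg (2 * ψ + S.u.f q)]
      _ ≤ S.θ.f q / (c * 1) * (S.u.f q ^ 2 / 2) := by gcongr
      _ = _ := by
        field_simp
  have h5 := S.θ_x_sq_div_le_dens q
  have h6 := S.gradSq_div_le_dens q
  have e : 2 * ψ * S.effForce q = 2 * ψ * (S.θ.x q / S.v q)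
      + 2 * ψ * -(S.θ.f q * S.vx q / S.v q ^ 2)
      + 2 * ψ * (S.ba.x q * S.ba.f q + S.bb.x q * S.bb.f q) := by
    unfold effForce
    ring
  rw [e]
  linarith

theorem unit_integral_dens_le (S : MHDFlow α β T) {r x : ℝ} (hx : x ∈ Icc (-r) r) (t : ℝ) :
    ∫ z in x..(x + 1), S.dens (z, t) ≤ ∫ z in (-(r + 1))..(r + 1), S.dens (z, t) :=
  intervalIntegral.integral_mono_interval (by linarith [hx.1]) (by linarith)
    (by linarith [hx.2]) (Eventually.of_forall fun s => S.dens_nonneg _)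
    (Continuous.intervalIntegrable (by fun_prop) _ _)

theorem integral_u_sq_le {S : MHDFlow α β T} {C a b t : ℝ} (hab : a ≤ b)
    (h : ∫ x in a..b, S.energy thermal (x, t) ≤ C) :
    ∫ x in a..b, S.u.f (x, t) ^ 2 ≤ 2 * C := by
  have hE := S.continuous_energy (fun _ => hasDerivAt_thermal)
  have := intervalIntegral_mono_of_continuous hab
    (f := fun x => S.u.f (x, t) ^ 2) (g := fun x => 2 * S.energy thermal (x, t))
    (by fun_prop) (by fun_prop) fun x _ => by
      have h1 := thermal_nonneg (S.v_pos (x, t))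
      have h2 := thermal_nonneg (S.θ_pos (x, t))
      have h3 := mul_nonneg (S.v_pos (x, t)).le (S.magSq_nonneg (x, t))
      unfold magSq at h3
      unfold energy
      unfold thermal at h1
      linarith [sq_nonneg (S.wa.f (x, t)), sq_nonneg (S.wb.f (x, t))]
  rw [intervalIntegral.integral_const_mul] at this
  linarith

theorem mu_le (hα : 0 ≤ α) (S : MHDFlow α β T) {c : ℝ} (hc : 0 < c) {q : ℝ × ℝ} (hv : c ≤ S.v q) :
    S.mu q ≤ visc α c := by
  unfold mu visc
  have := Real.rpow_le_rpow_of_nonpos hc hv (neg_nonpos.2 hα)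
  gcongr

set_option maxHeartbeats 1000000 in
/-- The gradient of the specific volume is bounded in `L²`. -/
theorem exists_integral_vx_sq_bound (hα : 0 ≤ α) (hβ : 0 < β) (hT : 0 < T) (K : ℝ) (hδ : 0 < δ)
    (hδ₁ : δ ≤ 1) : ∃ C, 0 < C ∧ ∀ S : MHDFlow α β T, S.Adm K δ → ∀ t ∈ Icc 0 T, ∀ r, 0 ≤ r →
      ∫ x in (-r)..r, S.vx (x, t) ^ 2 ≤ C := by
  obtain ⟨E, hE, hen⟩ := exists_energy_bound hα β hT K hδ
  obtain ⟨c, V, hc, hV, hv⟩ := exists_v_bounds hα hβ hT K hδ hδ₁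
  obtain ⟨C₁, hC₁, hθ⟩ := exists_θ_sup_bound hα β hT K hδ
  obtain ⟨C₂, hC₂, hb⟩ := exists_sqrt_mul_magSq_sup_bound hα hβ hT K hδ hδ₁
  obtain ⟨D, hD, hdens⟩ := exists_integral_dens_bound hα hβ hT K hδ hδ₁
  set N := visc α c with hN
  have hN1 : 1 ≤ N := one_le_visc hα hc
  set a₁ := C₁ / c + V * C₂ with ha₁
  have ha₁0 : 0 < a₁ := by positivity
  set a₂ := C₁ / c * E with ha₂
  have ha₂0 : 0 < a₂ := by positivity
  set Y := Real.exp (a₁ * (T + D)) * ((2 * (N / c) ^ 2 + 2) * K ^ 2 + ((a₂ + 2) * (T + D))) with hY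
  have hY0 : 0 ≤ Y := by positivity
  refine ⟨2 * V ^ 2 * Y + 4 * V ^ 2 * E, by positivity, fun S hS t ht r hr => ?_⟩
  have hr' : -r ≤ r := by linarith
  have hd0 : ∀ s, 0 ≤ ∫ z in (-(r + 1))..(r + 1), S.dens (z, s) := fun s =>
    S.integral_dens_nonneg (by linarith) s
  have hdc : Continuous fun s => ∫ z in (-(r + 1))..(r + 1), S.dens (z, s) := by fun_prop
  have hdT := hdens S hS (r + 1) (by linarith)
  have key := gronwall_with_dissipation (A := a₁ * (T + D)) (B := (a₂ + 2) * (T + D))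
    (y := fun s => ∫ x in (-r)..r, S.effVel (x, s) ^ 2)
    (y' := fun s => ∫ x in (-r)..r, 2 * S.effVel (x, s) * S.effForce (x, s)) (z := fun _ => 0)
    (a := fun s => a₁ * (1 + ∫ z in (-(r + 1))..(r + 1), S.dens (z, s)))
    (g := fun s => (a₂ + 2) * (1 + ∫ z in (-(r + 1))..(r + 1), S.dens (z, s))) hT (by fun_prop) (by fun_prop)
    (continuous_const.mul (continuous_const.add hdc))
    (continuous_const.mul (continuous_const.add hdc))
    (fun s hs => hasDerivAt_integral_of_continuous (f := fun x s => S.effVel (x, s) ^ 2)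
      (g := fun x s => 2 * S.effVel (x, s) * S.effForce (x, s)) (by fun_prop) (by fun_prop)
      (fun x s hs => ((S.hasDerivAt_effVel x hs).pow 2).congr_deriv (by ring)) hs)
    (fun s hs => by
      have hs' := Ioo_subset_Icc_self hs
      have hd0' := hd0 s
      have hu := integral_u_sq_le hr' (hen S hS s hs' (-r) r hr')
      have hdr : ∫ z in (-r)..r, S.dens (z, s) ≤ ∫ z in (-(r + 1))..(r + 1), S.dens (z, s) :=
        intervalIntegral.integral_mono_interval (by linarith) hr' (by linarith)
          (Eventually.of_forall fun s => S.dens_nonneg _)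
          (Continuous.intervalIntegrable (by fun_prop) _ _)
      have hun := fun x (hx : x ∈ Icc (-r) r) => S.unit_integral_dens_le hx s
      set d := ∫ z in (-(r + 1))..(r + 1), S.dens (z, s)
      have h := intervalIntegral_le_comb₃ (a := -r) (b := r)
        (f := fun x => 2 * S.effVel (x, s) * S.effForce (x, s))
        (c₁ := a₁ * (1 + d)) (g₁ := fun x => S.effVel (x, s) ^ 2)
        (c₂ := C₁ * (1 + d) / (2 * c)) (g₂ := fun x => S.u.f (x, s) ^ 2)
        (c₃ := 2) (g₃ := fun x => S.dens (x, s)) hr' (by fun_prop) (by fun_prop) (by fun_prop)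
        (by fun_prop) fun x hx => by
          have hx1 : x ∈ Icc x (x + 1) := ⟨le_rfl, by linarith⟩
          have h1 := hθ S hS s hs' x x hx1
          have h2 := hb S hS s hs' x x hx1
          have h3 : S.θ.f (x, s) ≤ C₁ * (1 + d) := h1.trans (by gcongr; exact hun x hx)
          have h4 : √(S.θ.f (x, s)) * S.magSq (x, s) ≤ C₂ * (1 + d) :=
            h2.trans (by gcongr; exact hun x hx)
          refine (effForce_mul_le hα hc (hv S hS x s hs').1 (hv S hS x s hs').2).trans ?_
          have e : a₁ * (1 + d) = C₁ * (1 + d) / c + V * (C₂ * (1 + d)) := by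
            rw [ha₁]
            ring
          rw [e]
          gcongr
      have h5 : C₁ * (1 + d) / (2 * c) * ∫ x in (-r)..r, S.u.f (x, s) ^ 2 ≤ a₂ * (1 + d) := by
        calc _ ≤ C₁ * (1 + d) / (2 * c) * (2 * E) := by gcongr
          _ = _ := by
            rw [ha₂]
            field_simp
      linarith)
    (fun _ => le_rfl) (fun s => mul_nonneg ha₁0.le (by linarith [hd0 s]))
    (fun s => mul_nonneg (by positivity) (by linarith [hd0 s]))
    (intervalIntegral.integral_nonneg hr' fun _ _ => sq_nonneg _)
    (integral_const_mul_one_add_le hdc ha₁0.le hdT)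
    (integral_const_mul_one_add_le hdc (by positivity) hdT) t ht
  have h0 : ∫ x in (-r)..r, S.effVel (x, 0) ^ 2 ≤ (2 * (N / c) ^ 2 + 2) * K ^ 2 :=
    hS.integral_le (f := fun x => S.effVel (x, 0) ^ 2) (by fun_prop) (by positivity) (fun x => by
      have h1 := (hv S hS x 0 ⟨le_rfl, hT.le⟩).1
      have h2 := S.mu_le hα hc h1
      have h3 : (S.mu (x, 0) / S.v (x, 0)) ^ 2 ≤ (N / c) ^ 2 := by
        have := S.one_le_mu hα (x, 0)
        have := S.v_pos (x, 0)
        gcongr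
      have h4 : S.effVel (x, 0) ^ 2 ≤ 2 * (N / c) ^ 2 * S.vx (x, 0) ^ 2 + 2 * S.u.f (x, 0) ^ 2 := by
        have h5 := mul_le_mul_of_nonneg_right h3 (sq_nonneg (S.vx (x, 0)))
        have h6 := sq_nonneg (S.mu (x, 0) / S.v (x, 0) * S.vx (x, 0) + S.u.f (x, 0))
        unfold effVel
        linarith
      refine h4.trans ?_
      have h7 : 2 * (N / c) ^ 2 * S.vx (x, 0) ^ 2 + 2 * S.u.f (x, 0) ^ 2
          ≤ (2 * (N / c) ^ 2 + 2) * (S.u.f (x, 0) ^ 2 + S.vx (x, 0) ^ 2) := by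
        linarith [mul_nonneg (sq_nonneg (N / c)) (sq_nonneg (S.u.f (x, 0))),
          sq_nonneg (S.vx (x, 0))]
      refine h7.trans (mul_le_mul_of_nonneg_left ?_ (by positivity))
      have : 0 ≤ (S.v (x, 0) - 1) ^ 2 + (S.θ.f (x, 0) - 1) ^ 2
        + (S.ba.f (x, 0) ^ 2 + S.bb.f (x, 0) ^ 2) + (S.wa.f (x, 0) ^ 2 + S.wb.f (x, 0) ^ 2)
        + S.u.x (x, 0) ^ 2 + S.θ.x (x, 0) ^ 2 + (S.ba.x (x, 0) ^ 2 + S.bb.x (x, 0) ^ 2)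
        + (S.wa.x (x, 0) ^ 2 + S.wb.x (x, 0) ^ 2) := by positivity
      linarith) hr'
  have h1 : ∫ x in (-r)..r, S.effVel (x, t) ^ 2 ≤ Y := by
    simp only [intervalIntegral.integral_zero, add_zero] at key
    exact key.trans (mul_le_mul_of_nonneg_left (by linarith) (Real.exp_pos _).le)
  have hu := integral_u_sq_le hr' (hen S hS t ht (-r) r hr')
  have h2 := intervalIntegral_le_comb₂ (a := -r) (b := r) (f := fun x => S.vx (x, t) ^ 2)
    (c₁ := 2 * V ^ 2) (g₁ := fun x => S.effVel (x, t) ^ 2)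
    (c₂ := 2 * V ^ 2) (g₂ := fun x => S.u.f (x, t) ^ 2) hr' (by fun_prop) (by fun_prop)
    (by fun_prop) fun x _ => by
      have h3 := S.v_pos (x, t)
      have h4 := S.one_le_mu hα (x, t)
      have h5 : S.vx (x, t) = (S.effVel (x, t) + S.u.f (x, t)) * (S.v (x, t) / S.mu (x, t)) := by
        unfold effVel
        field_simp
        ring
      have h6 : (S.v (x, t) / S.mu (x, t)) ^ 2 ≤ V ^ 2 := by
        have : S.v (x, t) / S.mu (x, t) ≤ V / 1 :=
          div_le_div₀ hV.le (hv S hS x t ht).2 one_pos h4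
        rw [div_one] at this
        gcongr
      calc S.vx (x, t) ^ 2 = (S.effVel (x, t) + S.u.f (x, t)) ^ 2
            * (S.v (x, t) / S.mu (x, t)) ^ 2 := by rw [h5]; ring
        _ ≤ (S.effVel (x, t) + S.u.f (x, t)) ^ 2 * V ^ 2 := by gcongr
        _ ≤ (2 * S.effVel (x, t) ^ 2 + 2 * S.u.f (x, t) ^ 2) * V ^ 2 := by
          gcongr
          linarith [sq_nonneg (S.effVel (x, t) - S.u.f (x, t))]
        _ = _ := by ring
  have h3 := mul_le_mul_of_nonneg_left h1 (by positivity : 0 ≤ 2 * V ^ 2)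
  have h4 := mul_le_mul_of_nonneg_left hu (by positivity : 0 ≤ 2 * V ^ 2)
  linarith

end MHDFlow

end VolumeGradient

section GradientEstimate

variable {α β T K δ : ℝ}

theorem exists_abs_viscDivDeriv_le (α : ℝ) {c : ℝ} (hc : 0 < c) (V : ℝ) :
    ∃ C, ∀ z ∈ Icc c V, |viscDivDeriv α z| ≤ C := by
  have hne : ∀ z ∈ Icc c V, z ≠ 0 := fun z hz => (hc.trans_le hz.1).ne'
  have hp : ∀ s : ℝ, ContinuousOn (fun z : ℝ => z ^ s) (Icc c V) := fun s =>
    continuousOn_id.rpow_const fun z hz => Or.inl (hne z hz)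
  refine isCompact_Icc.exists_bound_of_continuousOn (f := viscDivDeriv α) ?_
  unfold viscDivDeriv visc
  exact ((continuousOn_const.mul (continuousOn_const.mul (hp _))).div continuousOn_id hne).sub
    ((continuousOn_const.add (continuousOn_const.mul (hp _))).div (continuousOn_id.pow 2)
      fun z hz => pow_ne_zero 2 (hne z hz))

/-- A solution whose lower order norms are bounded by `k`. -/
structure MHDFlow.Controlled (S : MHDFlow α β T) (k : ℝ) : Prop where
  one_le : 1 ≤ k
  inv_v_le : ∀ x, ∀ t ∈ Icc 0 T, (S.v (x, t))⁻¹ ≤ k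
  v_le : ∀ x, ∀ t ∈ Icc 0 T, S.v (x, t) ≤ k
  mu_le : ∀ x, ∀ t ∈ Icc 0 T, S.mu (x, t) ≤ k
  viscDivDeriv_le : ∀ x, ∀ t ∈ Icc 0 T, |viscDivDeriv α (S.v (x, t))| ≤ k
  one_le_mul_pw : ∀ x, ∀ t ∈ Icc 0 T, 1 ≤ k * S.pw β (x, t)
  integral_vx_sq_le : ∀ t ∈ Icc 0 T, ∀ r, 0 ≤ r → ∫ x in (-r)..r, S.vx (x, t) ^ 2 ≤ k
  integral_energy_le : ∀ t ∈ Icc 0 T, ∀ a b, a ≤ b → ∫ x in a..b, S.energy thermal (x, t) ≤ k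
  θ_sq_le : ∀ t ∈ Icc 0 T, ∀ a, ∀ x ∈ Icc a (a + 1),
    S.θ.f (x, t) ^ 2 ≤ k * (1 + ∫ z in a..(a + 1), S.dens (z, t))
  integral_dens_le : ∀ r, 0 ≤ r → ∫ t in (0:ℝ)..T, (∫ x in (-r)..r, S.dens (x, t)) ≤ k

namespace MHDFlow

theorem exists_controlled (hα : 0 ≤ α) (hβ : 0 < β) (hT : 0 < T) (K : ℝ) (hδ : 0 < δ)
    (hδ₁ : δ ≤ 1) : ∃ k, ∀ S : MHDFlow α β T, S.Adm K δ → S.Controlled k := by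
  obtain ⟨E, hE, hen⟩ := exists_energy_bound hα β hT K hδ
  obtain ⟨c, V, hc, hV, hv⟩ := exists_v_bounds hα hβ hT K hδ hδ₁
  obtain ⟨c₀, hc₀, hθ⟩ := exists_temperature_lower_bound hα β hT K hδ hδ₁
  obtain ⟨C₁, hC₁, hθ2⟩ := exists_θ_sq_sup_bound hα hβ hT K hδ hδ₁
  obtain ⟨D, hD, hdens⟩ := exists_integral_dens_bound hα hβ hT K hδ hδ₁
  obtain ⟨L, hL, hvx⟩ := exists_integral_vx_sq_bound hα hβ hT K hδ hδ₁
  obtain ⟨M, hM⟩ := exists_abs_viscDivDeriv_le α hc V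
  have hN : 1 ≤ visc α c := one_le_visc hα hc
  have hci : 0 < c⁻¹ := by positivity
  have hpi : 0 < (c₀ ^ β)⁻¹ := by positivity
  have hM0 := abs_nonneg M
  have hM1 := le_abs_self M
  refine ⟨E + c⁻¹ + V + (c₀ ^ β)⁻¹ + C₁ + D + L + |M| + visc α c, fun S hS => ?_⟩
  refine ⟨by linarith, fun x t ht => ?_, fun x t ht => ?_, fun x t ht => ?_, fun x t ht => ?_,
    fun x t ht => ?_, fun t ht r hr => ?_, fun t ht a b hab => ?_, fun t ht a x hx => ?_,
    fun r hr => ?_⟩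
  · have := inv_anti₀ hc (hv S hS x t ht).1
    linarith
  · linarith [(hv S hS x t ht).2]
  · linarith [S.mu_le hα hc (hv S hS x t ht).1]
  · linarith [hM _ (hv S hS x t ht)]
  · have h1 : c₀ ^ β ≤ S.pw β (x, t) := Real.rpow_le_rpow hc₀.le (hθ S hS x t ht) hβ.le
    have h2 : 0 < c₀ ^ β := by positivity
    calc (1:ℝ) = (c₀ ^ β)⁻¹ * c₀ ^ β := by field_simp
      _ ≤ _ := by
        gcongr
        linarith
  · linarith [hvx S hS t ht r hr]
  · linarith [hen S hS t ht a b hab]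
  · have := S.integral_dens_nonneg (by linarith : a ≤ a + 1) t
    exact (hθ2 S hS t ht a x hx).trans (mul_le_mul_of_nonneg_right (by linarith) (by linarith))
  · linarith [hdens S hS r hr]

end MHDFlow

theorem weighted_dirichlet_le {R x k m f' f'' f₁ : ℝ} (hR : 0 < R) (hx : x ∈ Icc (-R) R)
    (hk : 1 ≤ k) (hm : 1 ≤ k * m) (hmk : m ≤ k) :
    -2 * (cutoffDeriv R x * f' + cutoff R x * f'') * f₁
      ≤ -(1 / (2 * k)) * (cutoff R x * f'' ^ 2) + 2 * k * (cutoff R x * (f₁ - m * f'') ^ 2)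
        + 64 * k ^ 3 / R ^ 2 * f' ^ 2 := by
  have hk0 : 0 < k := by linarith
  have h0 := cutoff_nonneg R x
  set φ := cutoff R x
  set g := f₁ - m * f'' with hg
  have hf : f₁ = m * f'' + g := by
    rw [hg]
    ring
  have hm0 : 0 < m := by
    by_contra hm0
    nlinarith [not_lt.1 hm0]
  have h1 := cutoffDeriv_mul_le (ε := 1 / (16 * k ^ 3)) (X := 2 * f' * f₁) (Y := 4 * f₁ ^ 2)
    (Z := f' ^ 2) hR (by positivity) hx (by positivity) (by positivity) (by
      refine le_of_eq ?_
      ring)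
  have e1 : 4 / (1 / (16 * k ^ 3) * R ^ 2) * f' ^ 2 = 64 * k ^ 3 / R ^ 2 * f' ^ 2 := by
    field_simp
    ring
  rw [e1] at h1
  have h2 : f₁ ^ 2 ≤ 2 * k ^ 2 * f'' ^ 2 + 2 * g ^ 2 := by
    have : m ^ 2 ≤ k ^ 2 := by gcongr
    have := mul_le_mul_of_nonneg_right this (sq_nonneg f'')
    rw [hf]
    linarith [sq_nonneg (m * f'' - g)]
  have h3 : 1 / (16 * k ^ 3) * (φ * (4 * f₁ ^ 2))
      ≤ 1 / (2 * k) * (φ * f'' ^ 2) + k * (φ * g ^ 2) := by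
    have h4 : 1 / (16 * k ^ 3) * (φ * (4 * f₁ ^ 2))
        ≤ 1 / (16 * k ^ 3) * (φ * (4 * (2 * k ^ 2 * f'' ^ 2 + 2 * g ^ 2))) := by gcongr
    have h5 : 1 / (16 * k ^ 3) * (φ * (4 * (2 * k ^ 2 * f'' ^ 2 + 2 * g ^ 2)))
        = 1 / (2 * k) * (φ * f'' ^ 2) + 1 / (2 * k ^ 3) * (φ * g ^ 2) := by
      field_simp
      ring
    have h6 : 1 / (2 * k ^ 3) ≤ k := by
      rw [div_le_iff₀ (by positivity)]
      have : 1 ≤ k ^ 4 := one_le_pow₀ hk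
      linarith
    have h7 := mul_le_mul_of_nonneg_right h6 (by positivity : 0 ≤ φ * g ^ 2)
    linarith
  have h4 : -2 * f'' * f₁ ≤ -(1 / k) * f'' ^ 2 + k * g ^ 2 := by
    have h5 : 1 / k ≤ m := by
      rw [div_le_iff₀ hk0]
      linarith
    have h6 : -2 * f'' * f₁ = -2 * m * f'' ^ 2 - 2 * f'' * g := by
      rw [hf]
      ring
    have h7 := (abs_le.1 (abs_two_mul_le (k := k) hk0 f'' g)).1
    have h8 : f'' ^ 2 / k = 1 / k * f'' ^ 2 := by ring
    have h9 := mul_le_mul_of_nonneg_right h5 (sq_nonneg f'')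
    linarith
  have h5 := mul_le_mul_of_nonneg_left h4 h0
  have h6 : 1 / (2 * k) * (φ * f'' ^ 2) = 1 / k * (φ * f'' ^ 2) / 2 := by
    field_simp
  linarith

theorem weighted_dirichlet_source_le {R x k m f' f'' f₁ W : ℝ} (hR : 0 < R)
    (hx : x ∈ Icc (-R) R) (hk : 1 ≤ k) (hm : 1 ≤ k ^ 2 * m) (hmk : m ≤ k ^ 2)
    (hg : (f₁ - m * f'') ^ 2 ≤ 4 * k ^ 6 * W) :
    -2 * (cutoffDeriv R x * f' + cutoff R x * f'') * f₁
      ≤ -(1 / (2 * k ^ 2)) * (cutoff R x * f'' ^ 2) + 8 * k ^ 8 * (cutoff R x * W)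
        + 64 * k ^ 6 / R ^ 2 * f' ^ 2 := by
  have h1 := weighted_dirichlet_le (f' := f') (f'' := f'') (f₁ := f₁) hR hx
    (one_le_pow₀ hk : 1 ≤ k ^ 2) hm hmk
  have h2 := mul_le_mul_of_nonneg_left hg
    (by have := cutoff_nonneg R x; positivity : 0 ≤ 2 * k ^ 2 * cutoff R x)
  rw [show (k ^ 2) ^ 3 = k ^ 6 by ring] at h1
  linarith

theorem sum_source_le (s u a b wa wb z z' A B : ℝ) :
    (s ^ 2 * u ^ 2 + z' ^ 2 + z ^ 2 * s ^ 2 + (a ^ 2 + b ^ 2) * (A ^ 2 + B ^ 2))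
      + ((a ^ 2 + s ^ 2 * wa ^ 2) + (b ^ 2 + s ^ 2 * wb ^ 2))
      + ((s ^ 2 * a ^ 2 + wa ^ 2 + u ^ 2 * A ^ 2) + (s ^ 2 * b ^ 2 + wb ^ 2 + u ^ 2 * B ^ 2))
      ≤ s ^ 2 * (u ^ 2 + (wa ^ 2 + wb ^ 2) + (a ^ 2 + b ^ 2)) + z' ^ 2 + z ^ 2 * s ^ 2
        + (A ^ 2 + B ^ 2) * (u ^ 2 + (wa ^ 2 + wb ^ 2) + (a ^ 2 + b ^ 2))
        + (u ^ 2 + (wa ^ 2 + wb ^ 2) + (a ^ 2 + b ^ 2)) := by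
  have : 0 ≤ (A ^ 2 + B ^ 2) * (wa ^ 2 + wb ^ 2) + u ^ 2 := by positivity
  linarith

theorem add₄_sq_le (a b c d : ℝ) : (a + b + c + d) ^ 2 ≤ 4 * (a ^ 2 + b ^ 2 + c ^ 2 + d ^ 2) := by
  linarith [sq_nonneg (a - b), sq_nonneg (a - c), sq_nonneg (a - d), sq_nonneg (b - c),
    sq_nonneg (b - d), sq_nonneg (c - d)]

theorem pow_le_pow_six {k r : ℝ} (hk : 1 ≤ k) (hr : 0 ≤ r) (hrk : r ≤ k) {n : ℕ} (hn : n ≤ 6) :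
    r ^ n ≤ k ^ 6 :=
  (pow_le_pow_left₀ hr hrk n).trans (pow_le_pow_right₀ hk hn)

theorem momentum_source_sq_le {k r m s z z' ux ax a' bx b' : ℝ} (hk : 1 ≤ k) (hr : 0 ≤ r)
    (hrk : r ≤ k) (hm : |m| ≤ k) :
    (m * s * ux - (z' * r - z * s * r ^ 2 + ax * a' + bx * b')) ^ 2
      ≤ 4 * k ^ 6 * (s ^ 2 * ux ^ 2 + z' ^ 2 + z ^ 2 * s ^ 2
        + (ax ^ 2 + bx ^ 2) * (a' ^ 2 + b' ^ 2)) := by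
  have h1 := add₄_sq_le (m * s * ux) (-(z' * r)) (z * s * r ^ 2) (-(ax * a' + bx * b'))
  have h2 := pow_le_pow_six hk hr hrk (n := 2) (by norm_num)
  have h4 := pow_le_pow_six hk hr hrk (n := 4) (by norm_num)
  have h3 : m ^ 2 ≤ k ^ 6 := by
    rw [← sq_abs]
    exact pow_le_pow_six hk (abs_nonneg m) hm (by norm_num)
  have h6 : 1 ≤ k ^ 6 := one_le_pow₀ hk
  have i1 := mul_le_mul_of_nonneg_right h3 (by positivity : 0 ≤ s ^ 2 * ux ^ 2)
  have i2 := mul_le_mul_of_nonneg_right h2 (sq_nonneg z')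
  have i3 := mul_le_mul_of_nonneg_right h4 (by positivity : 0 ≤ z ^ 2 * s ^ 2)
  have i4 := mul_le_mul_of_nonneg_right h6
    (by positivity : 0 ≤ (ax ^ 2 + bx ^ 2) * (a' ^ 2 + b' ^ 2))
  have i5 : (ax * a' + bx * b') ^ 2 ≤ (ax ^ 2 + bx ^ 2) * (a' ^ 2 + b' ^ 2) := by
    linarith [sq_nonneg (ax * b' - bx * a')]
  have e : m * s * ux - (z' * r - z * s * r ^ 2 + ax * a' + bx * b')
      = m * s * ux + -(z' * r) + z * s * r ^ 2 + -(ax * a' + bx * b') := by ring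
  rw [e]
  linarith

theorem transverse_source_sq_le {k r s b' w' : ℝ} (hk : 1 ≤ k) (hr : 0 ≤ r) (hrk : r ≤ k) :
    (b' - s * w' * r ^ 2) ^ 2 ≤ 4 * k ^ 6 * (b' ^ 2 + s ^ 2 * w' ^ 2) := by
  have h4 := pow_le_pow_six hk hr hrk (n := 4) (by norm_num)
  have h6 : 1 ≤ k ^ 6 := one_le_pow₀ hk
  have i1 := mul_le_mul_of_nonneg_right h4 (by positivity : 0 ≤ s ^ 2 * w' ^ 2)
  have i2 := mul_le_mul_of_nonneg_right h6 (sq_nonneg b')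
  have i3 : 0 ≤ k ^ 6 * (b' ^ 2 + s ^ 2 * w' ^ 2) := by positivity
  linarith [sq_nonneg (b' + s * w' * r ^ 2)]

theorem induction_source_sq_le {k r s b b' w' u' : ℝ} (hk : 1 ≤ k) (hr : 0 ≤ r) (hrk : r ≤ k) :
    ((-(s * b' * r ^ 2) + w' - u' * b) * r) ^ 2
      ≤ 4 * k ^ 6 * (s ^ 2 * b' ^ 2 + w' ^ 2 + u' ^ 2 * b ^ 2) := by
  have h1 := add₄_sq_le (-(s * b' * r ^ 3)) (w' * r) (-(u' * b * r)) 0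
  have h6 := pow_le_pow_six hk hr hrk (n := 6) (by norm_num)
  have h2 := pow_le_pow_six hk hr hrk (n := 2) (by norm_num)
  have i1 := mul_le_mul_of_nonneg_right h6 (by positivity : 0 ≤ s ^ 2 * b' ^ 2)
  have i2 := mul_le_mul_of_nonneg_right h2 (sq_nonneg w')
  have i3 := mul_le_mul_of_nonneg_right h2 (by positivity : 0 ≤ u' ^ 2 * b ^ 2)
  have e : (-(s * b' * r ^ 2) + w' - u' * b) * r
      = -(s * b' * r ^ 3) + w' * r + -(u' * b * r) + 0 := by ring
  rw [e]
  linarith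

namespace MHDFlow

/-- The sum of the squares of the second derivatives of the velocities and the magnetic field. -/
def hessSq (S : MHDFlow α β T) (q : ℝ × ℝ) : ℝ :=
  S.u.xx q ^ 2 + (S.wa.xx q ^ 2 + S.wb.xx q ^ 2) + (S.ba.xx q ^ 2 + S.bb.xx q ^ 2)

/-- The bound for the squares of the lower order terms of the momentum and induction equations. -/
def sourceSq (S : MHDFlow α β T) (q : ℝ × ℝ) : ℝ :=
  S.vx q ^ 2 * S.gradSq q + S.θ.x q ^ 2 + S.θ.f q ^ 2 * S.vx q ^ 2 + S.magSq q * S.gradSq q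
    + S.gradSq q

/-- The integrand of the time derivative of the weighted Dirichlet energy. -/
def dirichletDot (S : MHDFlow α β T) (R : ℝ) (q : ℝ × ℝ) : ℝ :=
  -2 * (cutoffDeriv R q.1 * S.u.x q + cutoff R q.1 * S.u.xx q) * S.u.t q
    + (-2 * (cutoffDeriv R q.1 * S.wa.x q + cutoff R q.1 * S.wa.xx q) * S.wa.t q
    + -2 * (cutoffDeriv R q.1 * S.wb.x q + cutoff R q.1 * S.wb.xx q) * S.wb.t q)
    + (-2 * (cutoffDeriv R q.1 * S.ba.x q + cutoff R q.1 * S.ba.xx q) * S.ba.t q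
    + -2 * (cutoffDeriv R q.1 * S.bb.x q + cutoff R q.1 * S.bb.xx q) * S.bb.t q)

@[fun_prop]
theorem continuous_hessSq (S : MHDFlow α β T) : Continuous S.hessSq := by
  unfold hessSq
  fun_prop

@[fun_prop]
theorem continuous_sourceSq (S : MHDFlow α β T) : Continuous S.sourceSq := by
  unfold sourceSq
  fun_prop

@[fun_prop]
theorem continuous_dirichletDot (S : MHDFlow α β T) (R : ℝ) : Continuous (S.dirichletDot R) := by
  unfold dirichletDot
  fun_prop

set_option maxHeartbeats 1000000 in
theorem dirichletDot_le {S : MHDFlow α β T} {k R x t : ℝ} (hα : 0 ≤ α) (hS : S.Controlled k)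
    (hR : 0 < R) (hx : x ∈ Icc (-R) R) (ht : t ∈ Icc 0 T) :
    S.dirichletDot R (x, t) ≤ -(1 / (2 * k ^ 2)) * (cutoff R x * S.hessSq (x, t))
      + 8 * k ^ 8 * (cutoff R x * S.sourceSq (x, t))
      + 64 * k ^ 6 / R ^ 2 * S.gradSq (x, t) := by
  have hk := hS.one_le
  have hk2 : 1 ≤ k ^ 2 := one_le_pow₀ hk
  have hφ := cutoff_nonneg R x
  have hv := S.v_pos (x, t)
  have hvk := hS.v_le x t ht
  have hr0 : 0 ≤ (S.v (x, t))⁻¹ := by positivity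
  have hrk := hS.inv_v_le x t ht
  have hvr : S.v (x, t) * (S.v (x, t))⁻¹ = 1 := mul_inv_cancel₀ hv.ne'
  have hmu1 := S.one_le_mu hα (x, t)
  have hmuk := hS.mu_le x t ht
  have hkr : 1 ≤ k * (S.v (x, t))⁻¹ := by
    rw [← hvr]
    gcongr
  have eu := S.eq_u (x, t)
  have ewa := S.eq_wa (x, t)
  have ewb := S.eq_wb (x, t)
  have eba := S.eq_ba (x, t)
  have ebb := S.eq_bb (x, t)
  have hvd := hS.viscDivDeriv_le x t ht
  set r := (S.v (x, t))⁻¹ with hr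
  have h1r : 1 ≤ k ^ 2 * r := by nlinarith
  have hrk2 : r ≤ k ^ 2 := by nlinarith
  have h1r2 : 1 ≤ k ^ 2 * r ^ 2 := by
    rw [← mul_pow]
    exact one_le_pow₀ hkr
  have hr2k : r ^ 2 ≤ k ^ 2 := by gcongr
  have g1 : S.u.t (x, t) - S.mu (x, t) * r * S.u.xx (x, t)
      = viscDivDeriv α (S.v (x, t)) * S.vx (x, t) * S.u.x (x, t)
        - (S.θ.x (x, t) * r - S.θ.f (x, t) * S.vx (x, t) * r ^ 2
          + S.ba.x (x, t) * S.ba.f (x, t) + S.bb.x (x, t) * S.bb.f (x, t)) := by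
    rw [eu, hr, mu]
    field_simp
    ring
  have g2 : S.wa.t (x, t) - r * S.wa.xx (x, t)
      = S.ba.x (x, t) - S.vx (x, t) * S.wa.x (x, t) * r ^ 2 := by
    rw [ewa, hr]
    field_simp
    ring
  have g3 : S.wb.t (x, t) - r * S.wb.xx (x, t)
      = S.bb.x (x, t) - S.vx (x, t) * S.wb.x (x, t) * r ^ 2 := by
    rw [ewb, hr]
    field_simp
    ring
  have g4 : S.ba.t (x, t) - r ^ 2 * S.ba.xx (x, t)
      = (-(S.vx (x, t) * S.ba.x (x, t) * r ^ 2) + S.wa.x (x, t)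
        - S.u.x (x, t) * S.ba.f (x, t)) * r := by
    have : S.ba.t (x, t) = S.v (x, t) * S.ba.t (x, t) * r := by
      rw [mul_comm, ← mul_assoc, mul_comm r, hvr, one_mul]
    rw [this, eba, hr]
    field_simp
    ring
  have g5 : S.bb.t (x, t) - r ^ 2 * S.bb.xx (x, t)
      = (-(S.vx (x, t) * S.bb.x (x, t) * r ^ 2) + S.wb.x (x, t)
        - S.u.x (x, t) * S.bb.f (x, t)) * r := by
    have : S.bb.t (x, t) = S.v (x, t) * S.bb.t (x, t) * r := by
      rw [mul_comm, ← mul_assoc, mul_comm r, hvr, one_mul]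
    rw [this, ebb, hr]
    field_simp
    ring
  have s1 := momentum_source_sq_le (m := viscDivDeriv α (S.v (x, t))) (s := S.vx (x, t))
    (z := S.θ.f (x, t)) (z' := S.θ.x (x, t)) (ux := S.u.x (x, t)) (ax := S.ba.x (x, t))
    (a' := S.ba.f (x, t)) (bx := S.bb.x (x, t)) (b' := S.bb.f (x, t)) hk hr0 hrk hvd
  have s2 := transverse_source_sq_le (s := S.vx (x, t)) (b' := S.ba.x (x, t))
    (w' := S.wa.x (x, t)) hk hr0 hrk
  have s3 := transverse_source_sq_le (s := S.vx (x, t)) (b' := S.bb.x (x, t))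
    (w' := S.wb.x (x, t)) hk hr0 hrk
  have s4 := induction_source_sq_le (s := S.vx (x, t)) (b := S.ba.f (x, t)) (b' := S.ba.x (x, t))
    (w' := S.wa.x (x, t)) (u' := S.u.x (x, t)) hk hr0 hrk
  have s5 := induction_source_sq_le (s := S.vx (x, t)) (b := S.bb.f (x, t)) (b' := S.bb.x (x, t))
    (w' := S.wb.x (x, t)) (u' := S.u.x (x, t)) hk hr0 hrk
  rw [← g1] at s1
  rw [← g2] at s2
  rw [← g3] at s3
  rw [← g4] at s4
  rw [← g5] at s5
  have h1 := weighted_dirichlet_source_le (f' := S.u.x (x, t)) hR hx hk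
    (h1r.trans (by
      calc k ^ 2 * r = k ^ 2 * (1 * r) := by ring
        _ ≤ _ := by gcongr))
    (by
      rw [sq]
      gcongr) s1
  have h2 := weighted_dirichlet_source_le (f' := S.wa.x (x, t)) hR hx hk h1r hrk2 s2
  have h3 := weighted_dirichlet_source_le (f' := S.wb.x (x, t)) hR hx hk h1r hrk2 s3
  have h4 := weighted_dirichlet_source_le (f' := S.ba.x (x, t)) hR hx hk h1r2 hr2k s4
  have h5 := weighted_dirichlet_source_le (f' := S.bb.x (x, t)) hR hx hk h1r2 hr2k s5
  have hsum := sum_source_le (S.vx (x, t)) (S.u.x (x, t)) (S.ba.x (x, t)) (S.bb.x (x, t))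
    (S.wa.x (x, t)) (S.wb.x (x, t)) (S.θ.f (x, t)) (S.θ.x (x, t)) (S.ba.f (x, t)) (S.bb.f (x, t))
  refine (add_le_add (add_le_add h1 (add_le_add h2 h3)) (add_le_add h4 h5)).trans ?_
  have fin := mul_le_mul_of_nonneg_left hsum
    (by positivity : 0 ≤ 8 * k ^ 8 * cutoff R x)
  unfold hessSq sourceSq gradSq magSq
  generalize S.u.x (x, t) = a₁ at *
  generalize S.wa.x (x, t) = a₂ at *
  generalize S.wb.x (x, t) = a₃ at *
  generalize S.ba.x (x, t) = a₄ at *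
  generalize S.bb.x (x, t) = a₅ at *
  linarith

end MHDFlow

end GradientEstimate

section GradientBound

variable {α β T K δ : ℝ}

theorem θ_source_le {k r φ z th g h u d : ℝ} (hk : 1 ≤ k) (hr : 0 ≤ r) (hrk : r ≤ k) (hφ : 0 ≤ φ)
    (hzt : z ≤ 2 * (th + 1)) (hth : 0 ≤ th) (hh : 0 ≤ h) (hhg : h ≤ k ^ 2 * g)
    (hu : u ^ 2 ≤ g) (hd : z ^ 2 ≤ d) :
    2 * φ * ((z - 1) * (h - z * r * u))
      ≤ 4 * k ^ 2 * (φ * g * th) + 5 * k ^ 2 * (φ * g) + d * (φ * (z - 1) ^ 2) := by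
  have hg : 0 ≤ g := (sq_nonneg u).trans hu
  have hk2 : r ^ 2 ≤ k ^ 2 := by gcongr
  have h1 : (z - 1) * h ≤ 2 * (th + 1) * (k ^ 2 * g) := by
    calc (z - 1) * h ≤ z * h := by gcongr; linarith
      _ ≤ _ := by gcongr
  have h2 : -2 * ((z - 1) * (z * r * u)) ≤ (z - 1) ^ 2 * d + k ^ 2 * g := by
    have i1 := sq_nonneg ((z - 1) * z + r * u)
    have i2 := mul_le_mul_of_nonneg_left hd (sq_nonneg (z - 1))
    have i3 : r ^ 2 * u ^ 2 ≤ k ^ 2 * g := by gcongr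
    linarith
  have h3 := mul_le_mul_of_nonneg_left h1 hφ
  have h4 := mul_le_mul_of_nonneg_left h2 hφ
  linarith

namespace MHDFlow

/-- An upper bound for the weighted supremum of the squared first derivatives. -/
def gradSup (S : MHDFlow α β T) (R ε t : ℝ) : ℝ :=
  ε * (∫ y in (-R)..R, cutoff R y * S.hessSq (y, t))
    + ε⁻¹ * (∫ y in (-R)..R, cutoff R y * S.gradSq (y, t)) + 4 / R * ∫ y in (-R)..R, S.gradSq (y, t)

theorem hessSq_nonneg (S : MHDFlow α β T) (q : ℝ × ℝ) : 0 ≤ S.hessSq q := by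
  unfold hessSq
  positivity

@[fun_prop]
theorem continuous_gradSup (S : MHDFlow α β T) (R ε : ℝ) : Continuous (S.gradSup R ε) := by
  unfold gradSup
  fun_prop

theorem gradSup_nonneg (S : MHDFlow α β T) {R ε : ℝ} (hR : 0 < R) (hε : 0 < ε) (t : ℝ) :
    0 ≤ S.gradSup R ε t := by
  have h1 := intervalIntegral.integral_nonneg (μ := volume) (by linarith : -R ≤ R)
    fun y _ => mul_nonneg (cutoff_nonneg R y) (S.hessSq_nonneg (y, t))
  have h2 := intervalIntegral.integral_nonneg (μ := volume) (by linarith : -R ≤ R)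
    fun y _ => mul_nonneg (cutoff_nonneg R y) (S.gradSq_nonneg (y, t))
  have h3 := intervalIntegral.integral_nonneg (μ := volume) (by linarith : -R ≤ R)
    fun y _ => S.gradSq_nonneg (y, t)
  unfold gradSup
  positivity

theorem integral_sum_of_five {a b : ℝ} {f₁ f₂ f₃ f₄ f₅ : ℝ → ℝ} (h₁ : Continuous f₁)
    (h₂ : Continuous f₂) (h₃ : Continuous f₃) (h₄ : Continuous f₄) (h₅ : Continuous f₅) :
    ∫ x in a..b, (f₁ x + (f₂ x + f₃ x) + (f₄ x + f₅ x))
      = (∫ x in a..b, f₁ x) + ((∫ x in a..b, f₂ x) + ∫ x in a..b, f₃ x)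
        + ((∫ x in a..b, f₄ x) + ∫ x in a..b, f₅ x) := by
  have i₁ := h₁.intervalIntegrable (μ := volume) a b
  have i₂ := h₂.intervalIntegrable (μ := volume) a b
  have i₃ := h₃.intervalIntegrable (μ := volume) a b
  have i₄ := h₄.intervalIntegrable (μ := volume) a b
  have i₅ := h₅.intervalIntegrable (μ := volume) a b
  rw [intervalIntegral.integral_add (i₁.add (i₂.add i₃)) (i₄.add i₅),
    intervalIntegral.integral_add i₁ (i₂.add i₃), intervalIntegral.integral_add i₂ i₃,
    intervalIntegral.integral_add i₄ i₅]

theorem integral_cutoff_mul_hessSq (S : MHDFlow α β T) (R t : ℝ) :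
    ∫ y in (-R)..R, cutoff R y * S.hessSq (y, t)
      = (∫ y in (-R)..R, cutoff R y * S.u.xx (y, t) ^ 2)
        + ((∫ y in (-R)..R, cutoff R y * S.wa.xx (y, t) ^ 2)
          + ∫ y in (-R)..R, cutoff R y * S.wb.xx (y, t) ^ 2)
        + ((∫ y in (-R)..R, cutoff R y * S.ba.xx (y, t) ^ 2)
          + ∫ y in (-R)..R, cutoff R y * S.bb.xx (y, t) ^ 2) := by
  rw [← integral_sum_of_five (by fun_prop) (by fun_prop) (by fun_prop) (by fun_prop) (by fun_prop)]
  simp only [hessSq, mul_add]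

theorem integral_cutoff_mul_gradSq (S : MHDFlow α β T) (R t : ℝ) :
    ∫ y in (-R)..R, cutoff R y * S.gradSq (y, t)
      = (∫ y in (-R)..R, cutoff R y * S.u.x (y, t) ^ 2)
        + ((∫ y in (-R)..R, cutoff R y * S.wa.x (y, t) ^ 2)
          + ∫ y in (-R)..R, cutoff R y * S.wb.x (y, t) ^ 2)
        + ((∫ y in (-R)..R, cutoff R y * S.ba.x (y, t) ^ 2)
          + ∫ y in (-R)..R, cutoff R y * S.bb.x (y, t) ^ 2) := by
  rw [← integral_sum_of_five (by fun_prop) (by fun_prop) (by fun_prop) (by fun_prop) (by fun_prop)]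
  simp only [gradSq, mul_add]

theorem cutoff_mul_gradSq_le_gradSup (S : MHDFlow α β T) {R ε x : ℝ} (hR : 0 < R) (hε : 0 < ε)
    (hx : x ∈ Icc (-R) R) (t : ℝ) : cutoff R x * S.gradSq (x, t) ≤ S.gradSup R ε t := by
  have h1 := cutoff_mul_sq_le hR hε (fun y => S.u.hxx y t) (by fun_prop) hx
  have h2 := cutoff_mul_sq_le hR hε (fun y => S.wa.hxx y t) (by fun_prop) hx
  have h3 := cutoff_mul_sq_le hR hε (fun y => S.wb.hxx y t) (by fun_prop) hx
  have h4 := cutoff_mul_sq_le hR hε (fun y => S.ba.hxx y t) (by fun_prop) hx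
  have h5 := cutoff_mul_sq_le hR hε (fun y => S.bb.hxx y t) (by fun_prop) hx
  have e : ∫ y in (-R)..R, S.gradSq (y, t)
      = (∫ y in (-R)..R, S.u.x (y, t) ^ 2)
        + ((∫ y in (-R)..R, S.wa.x (y, t) ^ 2) + ∫ y in (-R)..R, S.wb.x (y, t) ^ 2)
        + ((∫ y in (-R)..R, S.ba.x (y, t) ^ 2) + ∫ y in (-R)..R, S.bb.x (y, t) ^ 2) :=
    integral_sum_of_five (by fun_prop) (by fun_prop) (by fun_prop) (by fun_prop) (by fun_prop)
  rw [gradSup, integral_cutoff_mul_hessSq, integral_cutoff_mul_gradSq, e, gradSq]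
  refine le_of_eq_of_le (by ring) ((add_le_add (add_le_add h1 (add_le_add h2 h3))
    (add_le_add h4 h5)).trans (le_of_eq ?_))
  ring

theorem hasDerivAt_integral_cutoff_mul_gradSq (S : MHDFlow α β T) {R t : ℝ} (hR : 0 < R)
    (ht : t ∈ Ioo 0 T) :
    HasDerivAt (fun s => ∫ x in (-R)..R, cutoff R x * S.gradSq (x, s))
      (∫ x in (-R)..R, S.dirichletDot R (x, t)) t := by
  have key : ∀ f : StripFn T, HasDerivAt (fun s => ∫ x in (-R)..R, cutoff R x * f.x (x, s) ^ 2)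
      (∫ x in (-R)..R, -2 * (cutoffDeriv R x * f.x (x, t) + cutoff R x * f.xx (x, t)) * f.t (x, t))
      t := fun f =>
    hasDerivAt_weighted_dirichlet (f := fun x s => f.f (x, s)) (fx := fun x s => f.x (x, s))
      (fxx := fun x s => f.xx (x, s)) (ft := fun x s => f.t (x, s)) (hasDerivAt_cutoff R)
      (by fun_prop) (cutoff_left hR) (cutoff_right hR) (by fun_prop) (by fun_prop) (by fun_prop)
      f.hx f.hxx f.ht ht
  simp only [integral_cutoff_mul_gradSq]
  refine (((key S.u).add ((key S.wa).add (key S.wb))).add ((key S.ba).add (key S.bb))).congr_deriv ?_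
  exact (integral_sum_of_five (by fun_prop) (by fun_prop) (by fun_prop) (by fun_prop)
    (by fun_prop)).symm

theorem θ_sq_le_of_mem {S : MHDFlow α β T} {k R x t : ℝ} (hS : S.Controlled k) (ht : t ∈ Icc 0 T)
    (hx : x ∈ Icc (-R) R) :
    S.θ.f (x, t) ^ 2 ≤ k * (1 + ∫ y in (-(R + 1))..(R + 1), S.dens (y, t)) := by
  have hk := hS.one_le
  refine (hS.θ_sq_le t ht x x ⟨le_rfl, by linarith⟩).trans ?_
  have := S.unit_integral_dens_le hx t
  gcongr

theorem magSq_le {S : MHDFlow α β T} {k x t : ℝ} (hS : S.Controlled k) (ht : t ∈ Icc 0 T) :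
    S.magSq (x, t) ≤ 2 * k * S.energy thermal (x, t) := by
  have hv := S.v_pos (x, t)
  have h1 := thermal_nonneg (S.θ_pos (x, t))
  have h2 := thermal_nonneg hv
  have h3 := hS.inv_v_le x t ht
  have hk := hS.one_le
  have h4 : 1 ≤ k * S.v (x, t) := by
    calc 1 = (S.v (x, t))⁻¹ * S.v (x, t) := by field_simp
      _ ≤ _ := by gcongr
  have h5 : S.v (x, t) * S.magSq (x, t) ≤ 2 * S.energy thermal (x, t) := by
    have : 0 ≤ S.u.f (x, t) ^ 2 + (S.wa.f (x, t) ^ 2 + S.wb.f (x, t) ^ 2) := by positivity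
    unfold energy magSq
    unfold thermal at h1 h2 ⊢
    linarith
  calc S.magSq (x, t) ≤ k * S.v (x, t) * S.magSq (x, t) :=
        le_mul_of_one_le_left (S.magSq_nonneg _) h4
    _ = k * (S.v (x, t) * S.magSq (x, t)) := by ring
    _ ≤ k * (2 * S.energy thermal (x, t)) := by gcongr
    _ = _ := by ring

theorem integral_cutoff_mul_sourceSq_le {S : MHDFlow α β T} {k R ε t : ℝ} (hS : S.Controlled k)
    (hR : 0 < R) (hε : 0 < ε) (ht : t ∈ Icc 0 T) :
    ∫ x in (-R)..R, cutoff R x * S.sourceSq (x, t)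
      ≤ 3 * k ^ 2 * S.gradSup R ε t + k ^ 2 * (1 + ∫ y in (-(R + 1))..(R + 1), S.dens (y, t))
        + (∫ x in (-R)..R, cutoff R x * S.θ.x (x, t) ^ 2)
        + ∫ x in (-R)..R, cutoff R x * S.gradSq (x, t) := by
  have hk := hS.one_le
  have hE := S.continuous_energy (fun _ => hasDerivAt_thermal)
  have hG := S.gradSup_nonneg hR hε t
  set G := S.gradSup R ε t
  set D := ∫ y in (-(R + 1))..(R + 1), S.dens (y, t) with hD
  have hD0 : 0 ≤ D := S.integral_dens_nonneg (by linarith) t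
  have h := intervalIntegral_le_comb₃ (a := -R) (b := R)
    (f := fun x => cutoff R x * S.sourceSq (x, t)) (c₁ := G + k * (1 + D)) (c₂ := 2 * k * G)
    (c₃ := 1) (g₁ := fun x => S.vx (x, t) ^ 2) (g₂ := fun x => S.energy thermal (x, t))
    (g₃ := fun x => cutoff R x * S.θ.x (x, t) ^ 2 + cutoff R x * S.gradSq (x, t))
    (by linarith) (by fun_prop) (by fun_prop) (by fun_prop) (by fun_prop) fun x hx => by
      have h1 := S.cutoff_mul_gradSq_le_gradSup hR hε hx t
      have h2 := θ_sq_le_of_mem hS ht hx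
      have h3 := magSq_le (x := x) hS ht
      have h4 := mul_le_mul_of_nonneg_right h1 (sq_nonneg (S.vx (x, t)))
      have h5 := mul_le_mul h1 h3 (S.magSq_nonneg _) hG
      have h6 := mul_le_mul_of_nonneg_right h2 (sq_nonneg (S.vx (x, t)))
      have h7 : cutoff R x * (S.θ.f (x, t) ^ 2 * S.vx (x, t) ^ 2)
          ≤ 1 * (S.θ.f (x, t) ^ 2 * S.vx (x, t) ^ 2) := by
        have := cutoff_le_one hR hx
        gcongr
      rw [sourceSq]
      linarith
  rw [intervalIntegral.integral_add (Continuous.intervalIntegrable (by fun_prop) _ _)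
    (Continuous.intervalIntegrable (by fun_prop) _ _)] at h
  have h1 := mul_le_mul_of_nonneg_left (hS.integral_vx_sq_le t ht R hR.le)
    (by positivity : 0 ≤ G + k * (1 + D))
  have h2 := mul_le_mul_of_nonneg_left (hS.integral_energy_le t ht (-R) R (by linarith))
    (by positivity : 0 ≤ 2 * k * G)
  have h3 : G * k ≤ k ^ 2 * G := by
    have : k ≤ k ^ 2 := by nlinarith
    nlinarith
  linarith

theorem hasDerivAt_heatFlux (S : MHDFlow α β T) (x t : ℝ) :
    HasDerivAt (fun y => S.pw β (y, t) * S.θ.x (y, t) / S.v (y, t))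
      (S.θ.t (x, t) + S.θ.f (x, t) * (S.v (x, t))⁻¹ * S.u.x (x, t) - S.heat (x, t)) x := by
  refine (((S.hasDerivAt_pw_x β x t).mul (S.θ.hxx x t)).div (S.hvx x t) (S.v_ne _)).congr_deriv ?_
  have hv := S.v_ne (x, t)
  have hθ := S.θ_ne (x, t)
  rw [S.eq_θ (x, t), Real.rpow_sub_one hθ]
  simp only [heat, mu, pw, Pi.mul_apply]
  field_simp
  ring

/-- The integrand of the time derivative of the weighted square norm of `θ - 1`, up to an exact
derivative. -/
def excessDot (S : MHDFlow α β T) (R : ℝ) (q : ℝ × ℝ) : ℝ :=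
  2 * cutoff R q.1 * ((S.θ.f q - 1) * (S.heat q - S.θ.f q * (S.v q)⁻¹ * S.u.x q))
    - 2 * (cutoff R q.1 * (S.pw β q * S.θ.x q ^ 2 / S.v q))
    - cutoffDeriv R q.1 * (2 * (S.θ.f q - 1) * (S.pw β q * S.θ.x q / S.v q))

@[fun_prop]
theorem continuous_excessDot (S : MHDFlow α β T) (R : ℝ) : Continuous (S.excessDot R) := by
  unfold excessDot
  have := S.v_ne
  fun_prop (disch := assumption)

theorem hasDerivAt_integral_cutoff_mul_excess (S : MHDFlow α β T) {R t : ℝ} (hR : 0 < R)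
    (ht : t ∈ Ioo 0 T) :
    HasDerivAt (fun s => ∫ x in (-R)..R, cutoff R x * (S.θ.f (x, s) - 1) ^ 2)
      (∫ x in (-R)..R, S.excessDot R (x, t)) t := by
  have hv := S.v_ne
  refine (hasDerivAt_integral_of_continuous (T := T)
    (f := fun x s => cutoff R x * (S.θ.f (x, s) - 1) ^ 2)
    (g := fun x s => cutoff R x * (2 * (S.θ.f (x, s) - 1) * S.θ.t (x, s))) (by fun_prop)
    (by fun_prop) (fun x s hs => ?_) ht).congr_deriv ?_
  · refine ((((S.θ.ht x s hs).sub_const 1).pow 2).const_mul (cutoff R x)).congr_deriv ?_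
    simp
  · have hF : ∀ x, HasDerivAt
        (fun y => 2 * (S.θ.f (y, t) - 1) * (S.pw β (y, t) * S.θ.x (y, t) / S.v (y, t)))
        (2 * S.θ.x (x, t) * (S.pw β (x, t) * S.θ.x (x, t) / S.v (x, t))
          + 2 * (S.θ.f (x, t) - 1) * (S.θ.t (x, t)
            + S.θ.f (x, t) * (S.v (x, t))⁻¹ * S.u.x (x, t) - S.heat (x, t))) x := fun x =>
      (((S.θ.hx x t).sub_const 1).const_mul 2).mul (S.hasDerivAt_heatFlux x t)
    have hz := integral_cutoff_flux hR hF (by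
      fun_prop (disch := intro; exact S.v_ne _))
    have hsum := intervalIntegral.integral_add (μ := volume) (a := -R) (b := R)
      (f := fun x => S.excessDot R (x, t)) (Continuous.intervalIntegrable (by fun_prop) _ _)
      (Continuous.intervalIntegrable (u := fun x => cutoffDeriv R x
        * (2 * (S.θ.f (x, t) - 1) * (S.pw β (x, t) * S.θ.x (x, t) / S.v (x, t)))
        + cutoff R x * (2 * S.θ.x (x, t) * (S.pw β (x, t) * S.θ.x (x, t) / S.v (x, t))
          + 2 * (S.θ.f (x, t) - 1) * (S.θ.t (x, t)
            + S.θ.f (x, t) * (S.v (x, t))⁻¹ * S.u.x (x, t) - S.heat (x, t))))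
        (by fun_prop (disch := intro; exact S.v_ne _)) _ _)
    rw [hz, add_zero] at hsum
    rw [← hsum]
    refine intervalIntegral.integral_congr fun x _ => ?_
    simp only [excessDot]
    ring

theorem heat_le {S : MHDFlow α β T} {k x t : ℝ} (hS : S.Controlled k) (ht : t ∈ Icc 0 T) :
    S.heat (x, t) ≤ k ^ 2 * S.gradSq (x, t) := by
  have hk := hS.one_le
  have hv := S.v_pos (x, t)
  have h1 := mul_le_mul_of_nonneg_right (hS.mu_le x t ht) (sq_nonneg (S.u.x (x, t)))
  have h2 : S.mu (x, t) * S.u.x (x, t) ^ 2 + (S.wa.x (x, t) ^ 2 + S.wb.x (x, t) ^ 2)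
      + (S.ba.x (x, t) ^ 2 + S.bb.x (x, t) ^ 2) ≤ k * S.gradSq (x, t) := by
    have h3 := mul_le_mul_of_nonneg_right hk (by positivity :
      0 ≤ (S.wa.x (x, t) ^ 2 + S.wb.x (x, t) ^ 2) + (S.ba.x (x, t) ^ 2 + S.bb.x (x, t) ^ 2))
    rw [gradSq]
    linarith
  have h0 := S.gradSq_nonneg (x, t)
  rw [heat, div_eq_mul_inv]
  calc _ ≤ k * S.gradSq (x, t) * (S.v (x, t))⁻¹ := by gcongr
    _ ≤ k * S.gradSq (x, t) * k := by
      gcongr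
      exact hS.inv_v_le x t ht
    _ = _ := by ring

theorem u_x_sq_le_gradSq (S : MHDFlow α β T) (q : ℝ × ℝ) : S.u.x q ^ 2 ≤ S.gradSq q := by
  have : 0 ≤ (S.wa.x q ^ 2 + S.wb.x q ^ 2) + (S.ba.x q ^ 2 + S.bb.x q ^ 2) := by positivity
  rw [gradSq]
  linarith

theorem excessDot_le {S : MHDFlow α β T} {k R Z x t : ℝ} (hα : 0 ≤ α) (hS : S.Controlled k)
    (hR : 0 < R) (ht : t ∈ Icc 0 T) (hx : x ∈ Icc (-R) R)
    (hZ : 4 * ((S.θ.f (x, t) - 1) ^ 2 * S.pw β (x, t) / S.v (x, t)) ≤ Z) :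
    S.excessDot R (x, t)
      ≤ 4 * k ^ 2 * (cutoff R x * S.gradSq (x, t) * thermal (S.θ.f (x, t)))
        + 5 * k ^ 2 * (cutoff R x * S.gradSq (x, t))
        + k * (1 + ∫ y in (-(R + 1))..(R + 1), S.dens (y, t))
          * (cutoff R x * (S.θ.f (x, t) - 1) ^ 2)
        - 1 / k ^ 2 * (cutoff R x * S.θ.x (x, t) ^ 2) + 4 / R ^ 2 * Z := by
  have hk := hS.one_le
  have hv := S.v_pos (x, t)
  have hp := S.pw_pos β (x, t)
  have hφ := cutoff_nonneg R x
  have hθ := S.θ_pos (x, t)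
  have hr0 : 0 ≤ (S.v (x, t))⁻¹ := by positivity
  have h1 := θ_source_le hk hr0 (hS.inv_v_le x t ht) hφ (le_two_mul_thermal_add hθ)
    (thermal_nonneg hθ) (S.heat_nonneg hα (x, t)) (heat_le hS ht) (S.u_x_sq_le_gradSq (x, t))
    (θ_sq_le_of_mem hS ht hx)
  have h2 := cutoffDeriv_mul_le (ε := 1)
    (X := 2 * (S.θ.f (x, t) - 1) * (S.pw β (x, t) * S.θ.x (x, t) / S.v (x, t)))
    (Y := S.pw β (x, t) * S.θ.x (x, t) ^ 2 / S.v (x, t))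
    (Z := 4 * ((S.θ.f (x, t) - 1) ^ 2 * S.pw β (x, t) / S.v (x, t))) hR one_pos hx
    (by positivity) (by positivity) (le_of_eq (by ring))
  have h3 : 1 / k ^ 2 * S.θ.x (x, t) ^ 2 ≤ S.pw β (x, t) * S.θ.x (x, t) ^ 2 / S.v (x, t) := by
    have i1 := hS.one_le_mul_pw x t ht
    have i2 := hS.v_le x t ht
    rw [le_div_iff₀ hv]
    calc 1 / k ^ 2 * S.θ.x (x, t) ^ 2 * S.v (x, t) ≤ 1 / k ^ 2 * S.θ.x (x, t) ^ 2 * k := by gcongr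
      _ = 1 / k * S.θ.x (x, t) ^ 2 := by field_simp
      _ ≤ _ := by
        gcongr
        rw [div_le_iff₀ (by positivity)]
        linarith
  have h4 := mul_le_mul_of_nonneg_left h3 hφ
  have h5 := mul_le_mul_of_nonneg_left hZ (by positivity : 0 ≤ 4 / R ^ 2)
  rw [one_mul, one_mul] at h2
  unfold excessDot
  linarith

theorem integral_excessDot_le {S : MHDFlow α β T} {k R Z ε t : ℝ} (hα : 0 ≤ α)
    (hS : S.Controlled k) (hR : 0 < R) (hε : 0 < ε) (ht : t ∈ Icc 0 T)
    (hZ : ∀ x, 4 * ((S.θ.f (x, t) - 1) ^ 2 * S.pw β (x, t) / S.v (x, t)) ≤ Z) :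
    ∫ x in (-R)..R, S.excessDot R (x, t)
      ≤ 4 * k ^ 3 * S.gradSup R ε t + 5 * k ^ 2 * (∫ x in (-R)..R, cutoff R x * S.gradSq (x, t))
        + k * (1 + ∫ y in (-(R + 1))..(R + 1), S.dens (y, t))
          * (∫ x in (-R)..R, cutoff R x * (S.θ.f (x, t) - 1) ^ 2)
        - 1 / k ^ 2 * (∫ x in (-R)..R, cutoff R x * S.θ.x (x, t) ^ 2) + 8 * Z / R := by
  have hk := hS.one_le
  have hth : Continuous fun x => thermal (S.θ.f (x, t)) :=
    continuous_thermal_comp (by fun_prop) fun x => S.θ_pos _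
  have hG := S.gradSup_nonneg hR hε t
  set G := S.gradSup R ε t
  set D := ∫ y in (-(R + 1))..(R + 1), S.dens (y, t) with hD
  have h := intervalIntegral_le_comb₃ (a := -R) (b := R) (f := fun x => S.excessDot R (x, t))
    (c₁ := 4 * k ^ 2 * G) (c₂ := 1) (c₃ := 4 / R ^ 2 * Z) (g₁ := fun x => thermal (S.θ.f (x, t)))
    (g₂ := fun x => 5 * k ^ 2 * (cutoff R x * S.gradSq (x, t))
      + k * (1 + D) * (cutoff R x * (S.θ.f (x, t) - 1) ^ 2)
      - 1 / k ^ 2 * (cutoff R x * S.θ.x (x, t) ^ 2)) (g₃ := fun _ => 1)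
    (by linarith) (by fun_prop) hth (by fun_prop) (by fun_prop) fun x hx => by
      have h1 := mul_le_mul_of_nonneg_right (S.cutoff_mul_gradSq_le_gradSup hR hε hx t)
        (thermal_nonneg (S.θ_pos (x, t)))
      have h2 := mul_le_mul_of_nonneg_left h1 (by positivity : 0 ≤ 4 * k ^ 2)
      linarith [excessDot_le hα hS hR ht hx (hZ x)]
  rw [intervalIntegral.integral_sub (Continuous.intervalIntegrable (by fun_prop) _ _)
    (Continuous.intervalIntegrable (by fun_prop) _ _),
    intervalIntegral.integral_add (Continuous.intervalIntegrable (by fun_prop) _ _)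
    (Continuous.intervalIntegrable (by fun_prop) _ _)] at h
  simp only [intervalIntegral.integral_const, intervalIntegral.integral_const_mul, smul_eq_mul] at h
  have h1 := mul_le_mul_of_nonneg_left
    (integral_thermal_θ_le (hS.integral_energy_le t ht (-R) R (by linarith)) (by linarith))
    (by positivity : 0 ≤ 4 * k ^ 2 * G)
  have e : 4 / R ^ 2 * Z * ((R - -R) * 1) = 8 * Z / R := by
    field_simp
    ring
  rw [e] at h
  linarith

theorem integral_dirichletDot_le {S : MHDFlow α β T} {k R t : ℝ} (hα : 0 ≤ α)
    (hS : S.Controlled k) (hR : 0 < R) (ht : t ∈ Icc 0 T) :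
    ∫ x in (-R)..R, S.dirichletDot R (x, t)
      ≤ -(1 / (2 * k ^ 2)) * (∫ x in (-R)..R, cutoff R x * S.hessSq (x, t))
        + 8 * k ^ 8 * (∫ x in (-R)..R, cutoff R x * S.sourceSq (x, t))
        + 64 * k ^ 6 / R ^ 2 * ∫ x in (-R)..R, S.gradSq (x, t) :=
  intervalIntegral_le_comb₃ (by linarith) (by fun_prop) (by fun_prop) (by fun_prop) (by fun_prop)
    fun _ hx => dirichletDot_le hα hS hR hx ht

/-- The closing estimate of the gradient functional, with `H`, `G`, `Q`, `P` the weighted norms of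
the second derivatives, the first derivatives, `θ - 1` and `θ_x`, and `U` the unweighted norm. -/
theorem gradient_inequality {k R D H G Q P U z s d e : ℝ} (hk : 1 ≤ k) (hR : 1 ≤ R) (hD : 0 ≤ D)
    (hG : 0 ≤ G) (hQ : 0 ≤ Q) (hU0 : 0 ≤ U) (hU : U / R ≤ D) (hz : z ≤ 1)
    (hs : s ≤ 3 * k ^ 2 * ((1 / (224 * k ^ 15)) * H + (1 / (224 * k ^ 15))⁻¹ * G + 4 / R * U)
      + k ^ 2 * (1 + D) + P + G)
    (hd : d ≤ -(1 / (2 * k ^ 2)) * H + 8 * k ^ 8 * s + 64 * k ^ 6 / R ^ 2 * U)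
    (he : e ≤ 4 * k ^ 3 * ((1 / (224 * k ^ 15)) * H + (1 / (224 * k ^ 15))⁻¹ * G + 4 / R * U)
      + 5 * k ^ 2 * G + k * (1 + D) * Q - 1 / k ^ 2 * P + z) (hH : 0 ≤ H) :
    d + 8 * k ^ 10 * e + 1 / (4 * k ^ 2) * H
      ≤ 20000 * k ^ 28 * (1 + D) * (G + 8 * k ^ 10 * Q) + 20000 * k ^ 28 * (1 + D) := by
  have hk0 : 0 < k := by linarith
  have hUR : U / R ^ 2 ≤ D := by
    refine le_trans ?_ hU
    rw [sq]
    gcongr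
    nlinarith
  have hp : ∀ n : ℕ, n ≤ 28 → k ^ n ≤ k ^ 28 := fun n hn => pow_le_pow_right₀ hk hn
  set W := (1 / (224 * k ^ 15)) * H + (1 / (224 * k ^ 15))⁻¹ * G + 4 / R * U with hW
  have e1 : W ≤ 1 / (224 * k ^ 15) * H + 224 * k ^ 15 * G + 4 * D := by
    rw [hW, inv_div, div_one]
    have : 4 / R * U = 4 * (U / R) := by ring
    linarith
  have hW0 : 0 ≤ W := by positivity
  have e2 := mul_le_mul_of_nonneg_left hs (by positivity : 0 ≤ 8 * k ^ 8)
  have e3 := mul_le_mul_of_nonneg_left he (by positivity : 0 ≤ 8 * k ^ 10)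
  have e4 : 8 * k ^ 10 * (1 / k ^ 2 * P) = 8 * k ^ 8 * P := by field_simp
  have e5 : (24 * k ^ 10 + 32 * k ^ 13) * W ≤ 56 * k ^ 13 * W := by
    have : k ^ 10 ≤ k ^ 13 := pow_le_pow_right₀ hk (by norm_num)
    gcongr
    linarith
  have e6 := mul_le_mul_of_nonneg_left e1 (by positivity : 0 ≤ 56 * k ^ 13)
  have e7 : 56 * k ^ 13 * (1 / (224 * k ^ 15) * H) = 1 / (4 * k ^ 2) * H := by
    field_simp
    ring
  have e8 : 1 / (2 * k ^ 2) * H = 1 / (4 * k ^ 2) * H + 1 / (4 * k ^ 2) * H := by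
    field_simp
    ring
  have e9 : 64 * k ^ 6 / R ^ 2 * U ≤ 64 * k ^ 28 * D := by
    calc 64 * k ^ 6 / R ^ 2 * U = 64 * k ^ 6 * (U / R ^ 2) := by ring
      _ ≤ 64 * k ^ 28 * D := by
        gcongr
        · norm_num
  have e10 := mul_le_mul_of_nonneg_right (hp 8 (by norm_num)) hG
  have e11 := mul_le_mul_of_nonneg_right (hp 12 (by norm_num)) hG
  have e12 := mul_le_mul_of_nonneg_right (hp 13 (by norm_num)) hD
  have e13 := mul_le_mul_of_nonneg_right (hp 10 (by norm_num)) (by linarith : 0 ≤ 1 + D)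
  have e14 := mul_le_mul_of_nonneg_left hz (by positivity : 0 ≤ 8 * k ^ 10)
  have e15 : k * ((1 + D) * (8 * k ^ 10 * Q)) ≤ k ^ 28 * ((1 + D) * (8 * k ^ 10 * Q)) := by
    have := hp 1 (by norm_num)
    rw [pow_one] at this
    gcongr
  have e16 := hp 10 (by norm_num)
  have e17 : 0 ≤ k ^ 28 * (D * G) := by positivity
  have e18 : 0 ≤ k ^ 28 * ((1 + D) * (8 * k ^ 10 * Q)) := by positivity
  have e19 : 0 ≤ k ^ 28 * D := by positivity
  have e20 : 0 ≤ k ^ 28 * G := by positivity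
  have e21 : 0 ≤ k ^ 28 := by positivity
  clear_value W
  linarith

end MHDFlow

end GradientBound

section TemperatureUpper

variable {α β T K δ : ℝ}

namespace MHDFlow

theorem integral_cutoff_mul_initial_le {S : MHDFlow α β T} (hS : S.Adm K δ) {R : ℝ} (hR : 0 < R) :
    (∫ x in (-R)..R, cutoff R x * S.gradSq (x, 0)) ≤ K ^ 2
      ∧ (∫ x in (-R)..R, cutoff R x * (S.θ.f (x, 0) - 1) ^ 2) ≤ K ^ 2 := by
  have hRR : -R ≤ R := by linarith
  have h1 : ∫ x in (-R)..R, cutoff R x * S.gradSq (x, 0) ≤ ∫ x in (-R)..R, S.gradSq (x, 0) :=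
    intervalIntegral_mono_of_continuous hRR (by fun_prop) (by fun_prop) fun x hx =>
      mul_le_of_le_one_left (S.gradSq_nonneg _) (cutoff_le_one hR hx)
  have h2 : ∫ x in (-R)..R, cutoff R x * (S.θ.f (x, 0) - 1) ^ 2
      ≤ ∫ x in (-R)..R, (S.θ.f (x, 0) - 1) ^ 2 :=
    intervalIntegral_mono_of_continuous hRR (by fun_prop) (by fun_prop) fun x hx =>
      mul_le_of_le_one_left (sq_nonneg _) (cutoff_le_one hR hx)
  refine ⟨h1.trans ((hS.integral_le (by fun_prop) zero_le_one (fun x => ?_) hRR).trans_eq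
    (one_mul _)), h2.trans ((hS.integral_le (by fun_prop) zero_le_one (fun x => ?_) hRR).trans_eq
    (one_mul _))⟩
  · have : 0 ≤ (S.v (x, 0) - 1) ^ 2 + S.u.f (x, 0) ^ 2
      + (S.θ.f (x, 0) - 1) ^ 2 + (S.ba.f (x, 0) ^ 2 + S.bb.f (x, 0) ^ 2)
      + (S.wa.f (x, 0) ^ 2 + S.wb.f (x, 0) ^ 2) + S.vx (x, 0) ^ 2 + S.θ.x (x, 0) ^ 2 := by
      positivity
    rw [gradSq]
    linarith
  · have : 0 ≤ (S.v (x, 0) - 1) ^ 2 + S.u.f (x, 0) ^ 2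
      + (S.ba.f (x, 0) ^ 2 + S.bb.f (x, 0) ^ 2)
      + (S.wa.f (x, 0) ^ 2 + S.wb.f (x, 0) ^ 2) + S.vx (x, 0) ^ 2 + S.u.x (x, 0) ^ 2
      + S.θ.x (x, 0) ^ 2 + (S.ba.x (x, 0) ^ 2 + S.bb.x (x, 0) ^ 2)
      + (S.wa.x (x, 0) ^ 2 + S.wb.x (x, 0) ^ 2) := by positivity
    linarith

theorem exists_integral_gradSq_le (S : MHDFlow α β T) :
    ∃ C, 0 ≤ C ∧ ∀ t ∈ Icc 0 T, ∀ R, 1 ≤ R → C ≤ R → (∫ x in (-R)..R, S.gradSq (x, t)) / R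
      ≤ ∫ x in (-(R + 1))..(R + 1), S.dens (x, t) := by
  obtain ⟨C, hC, h⟩ := S.exists_bound_of_state (F := fun p => p.1 * √p.2)
    (continuous_fst.mul (Real.continuous_sqrt.comp continuous_snd)).continuousOn
  refine ⟨C, hC, fun t ht R hR hCR => ?_⟩
  have hR0 : 0 < R := by linarith
  rw [div_le_iff₀ hR0]
  have h1 : ∫ x in (-R)..R, S.gradSq (x, t) ≤ ∫ x in (-R)..R, R * S.dens (x, t) := by
    refine intervalIntegral_mono_of_continuous (by linarith) (by fun_prop) (by fun_prop)
      fun x _ => ?_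
    have hp : 0 < S.v (x, t) * √(S.θ.f (x, t)) :=
      mul_pos (S.v_pos _) (Real.sqrt_pos.2 (S.θ_pos _))
    have h2 := (div_le_iff₀ hp).1 (S.gradSq_div_le_dens (x, t))
    have h3 := mul_le_mul_of_nonneg_left ((h x t ht).trans hCR) (S.dens_nonneg (x, t))
    linarith
  rw [intervalIntegral.integral_const_mul, mul_comm] at h1
  refine h1.trans (mul_le_mul_of_nonneg_right ?_ hR0.le)
  exact intervalIntegral.integral_mono_interval (by linarith) (by linarith) (by linarith)
    (Eventually.of_forall fun x => S.dens_nonneg _)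
    (Continuous.intervalIntegrable (by fun_prop) _ _)

theorem gradient_functional_le {S : MHDFlow α β T} {k R t₀ : ℝ} (hα : 0 ≤ α) (hT : 0 < T)
    (hS : S.Controlled k) (hA : S.Adm K δ) (hR : 1 ≤ R)
    (hU : ∀ t ∈ Icc 0 T, (∫ x in (-R)..R, S.gradSq (x, t)) / R
      ≤ ∫ x in (-(R + 1))..(R + 1), S.dens (x, t))
    (hZ : ∀ x, ∀ t ∈ Icc 0 T, 8 * (4 * ((S.θ.f (x, t) - 1) ^ 2 * S.pw β (x, t) / S.v (x, t))) ≤ R)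
    (ht₀ : t₀ ∈ Icc 0 T) :
    (∫ x in (-R)..R, cutoff R x * S.gradSq (x, t₀))
      + 8 * k ^ 10 * (∫ x in (-R)..R, cutoff R x * (S.θ.f (x, t₀) - 1) ^ 2)
      + ∫ t in (0:ℝ)..t₀, 1 / (4 * k ^ 2) * (∫ x in (-R)..R, cutoff R x * S.hessSq (x, t))
      ≤ Real.exp (20000 * k ^ 28 * (T + k))
        * ((1 + 8 * k ^ 10) * K ^ 2 + 20000 * k ^ 28 * (T + k)) := by
  have hR0 : 0 < R := by linarith
  have hk := hS.one_le
  have hG : ∀ t, 0 ≤ ∫ x in (-R)..R, cutoff R x * S.gradSq (x, t) := fun t =>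
    intervalIntegral.integral_nonneg (by linarith)
      fun x _ => mul_nonneg (cutoff_nonneg R x) (S.gradSq_nonneg _)
  have hH : ∀ t, 0 ≤ ∫ x in (-R)..R, cutoff R x * S.hessSq (x, t) := fun t =>
    intervalIntegral.integral_nonneg (by linarith)
      fun x _ => mul_nonneg (cutoff_nonneg R x) (S.hessSq_nonneg _)
  have hQ : ∀ t, 0 ≤ ∫ x in (-R)..R, cutoff R x * (S.θ.f (x, t) - 1) ^ 2 := fun t =>
    intervalIntegral.integral_nonneg (by linarith)
      fun x _ => mul_nonneg (cutoff_nonneg R x) (sq_nonneg _)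
  have hD : ∀ t, 0 ≤ ∫ x in (-(R + 1))..(R + 1), S.dens (x, t) := fun t =>
    S.integral_dens_nonneg (by linarith) t
  have hGint := integral_const_mul_one_add_le (T := T) (a := 20000 * k ^ 28)
    (d := fun t => ∫ x in (-(R + 1))..(R + 1), S.dens (x, t)) (by fun_prop) (by positivity)
    (hS.integral_dens_le (R + 1) (by linarith))
  obtain ⟨i1, i2⟩ := integral_cutoff_mul_initial_le hA hR0
  have hgr := gronwall_with_dissipation
    (y := fun t => (∫ x in (-R)..R, cutoff R x * S.gradSq (x, t))
      + 8 * k ^ 10 * (∫ x in (-R)..R, cutoff R x * (S.θ.f (x, t) - 1) ^ 2))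
    (y' := fun t => (∫ x in (-R)..R, S.dirichletDot R (x, t))
      + 8 * k ^ 10 * (∫ x in (-R)..R, S.excessDot R (x, t)))
    (z := fun t => 1 / (4 * k ^ 2) * (∫ x in (-R)..R, cutoff R x * S.hessSq (x, t)))
    (a := fun t => 20000 * k ^ 28 * (1 + ∫ x in (-(R + 1))..(R + 1), S.dens (x, t)))
    (g := fun t => 20000 * k ^ 28 * (1 + ∫ x in (-(R + 1))..(R + 1), S.dens (x, t)))
    hT (by fun_prop) (by fun_prop) (by fun_prop) (by fun_prop)
    (fun t ht => (S.hasDerivAt_integral_cutoff_mul_gradSq hR0 ht).add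
      ((S.hasDerivAt_integral_cutoff_mul_excess hR0 ht).const_mul (8 * k ^ 10)))
    (fun t ht => by
      have ht' := Ioo_subset_Icc_self ht
      have hε : 0 < 1 / (224 * k ^ 15) := by positivity
      exact gradient_inequality hk hR (hD t) (hG t) (hQ t)
        (intervalIntegral.integral_nonneg (by linarith) fun x _ => S.gradSq_nonneg _)
        (hU t ht') (z := 8 * (R / 8) / R) (by
          refine le_of_eq ?_
          field_simp)
        (integral_cutoff_mul_sourceSq_le hS hR0 hε ht')
        (integral_dirichletDot_le hα hS hR0 ht')
        (integral_excessDot_le hα hS hR0 hε ht' fun x => by linarith [hZ x t ht']) (hH t))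
    (fun t => mul_nonneg (by positivity) (hH t))
    (fun t => mul_nonneg (by positivity) (by linarith [hD t]))
    (fun t => mul_nonneg (by positivity) (by linarith [hD t]))
    (add_nonneg (hG 0) (mul_nonneg (by positivity) (hQ 0))) hGint hGint t₀ ht₀
  refine hgr.trans (mul_le_mul_of_nonneg_left ?_ (Real.exp_nonneg _))
  have := mul_le_mul_of_nonneg_left i2 (by positivity : 0 ≤ 8 * k ^ 10)
  linarith

/-- The squared first derivatives are locally dominated by a function of time with bounded
integral. -/
theorem exists_gradSq_bound (hα : 0 ≤ α) (hT : 0 < T) (K k : ℝ) (hk : 1 ≤ k) :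
    ∃ C, 0 ≤ C ∧ ∀ S : MHDFlow α β T, S.Adm K δ → S.Controlled k → ∃ R₀, ∀ R, R₀ ≤ R →
      ∃ J : ℝ → ℝ, Continuous J ∧ (∀ t, 0 ≤ J t) ∧ (∫ t in (0:ℝ)..T, J t) ≤ C ∧
        ∀ t ∈ Icc 0 T, ∀ x ∈ Icc (-(R / 2)) (R / 2), S.gradSq (x, t) ≤ J t := by
  set Y := Real.exp (20000 * k ^ 28 * (T + k))
    * ((1 + 8 * k ^ 10) * K ^ 2 + 20000 * k ^ 28 * (T + k)) with hY
  have hY0 : 0 ≤ Y := by positivity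
  refine ⟨8 * k ^ 2 * Y + 8 * k + 2 * Y * T, by positivity, fun S hA hS => ?_⟩
  obtain ⟨C₁, hC₁, h₁⟩ := S.exists_integral_gradSq_le
  obtain ⟨C₂, hC₂, h₂⟩ := S.exists_bound_of_state
    (F := fun p => 8 * (4 * ((p.2 - 1) ^ 2 * p.2 ^ β / p.1))) (by
      refine continuousOn_const.mul (continuousOn_const.mul (ContinuousOn.div ?_
        continuousOn_fst fun p hp => (ne_of_gt hp.1)))
      exact ((continuousOn_snd.sub continuousOn_const).pow 2).mul
        (continuousOn_snd.rpow_const fun p hp => Or.inl (ne_of_gt hp.2)))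
  refine ⟨1 + C₁ + C₂, fun R hR => ?_⟩
  have hR1 : 1 ≤ R := by linarith
  have hR0 : 0 < R := by linarith
  have hU : ∀ t ∈ Icc 0 T, (∫ x in (-R)..R, S.gradSq (x, t)) / R
      ≤ ∫ x in (-(R + 1))..(R + 1), S.dens (x, t) := fun t ht => h₁ t ht R hR1 (by linarith)
  have hmain := fun t (ht : t ∈ Icc 0 T) => gradient_functional_le hα hT hS hA hR1 hU
    (fun x t ht => (h₂ x t ht).trans (by linarith)) ht
  rw [← hY] at hmain
  have hG : ∀ t, 0 ≤ ∫ x in (-R)..R, cutoff R x * S.gradSq (x, t) := fun t =>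
    intervalIntegral.integral_nonneg (by linarith)
      fun x _ => mul_nonneg (cutoff_nonneg R x) (S.gradSq_nonneg _)
  have hH : ∀ t, 0 ≤ ∫ x in (-R)..R, cutoff R x * S.hessSq (x, t) := fun t =>
    intervalIntegral.integral_nonneg (by linarith)
      fun x _ => mul_nonneg (cutoff_nonneg R x) (S.hessSq_nonneg _)
  have hQ : ∀ t, 0 ≤ 8 * k ^ 10 * ∫ x in (-R)..R, cutoff R x * (S.θ.f (x, t) - 1) ^ 2 := fun t =>
    mul_nonneg (by positivity) (intervalIntegral.integral_nonneg (by linarith)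
      fun x _ => mul_nonneg (cutoff_nonneg R x) (sq_nonneg _))
  refine ⟨fun t => 2 * S.gradSup R 1 t, by fun_prop,
    fun t => mul_nonneg zero_le_two (S.gradSup_nonneg hR0 one_pos t), ?_, fun t ht x hx => ?_⟩
  · have h := intervalIntegral_le_comb₃ (a := 0) (b := T) (f := fun t => 2 * S.gradSup R 1 t)
      (c₁ := 2) (c₂ := 8) (c₃ := 2 * Y)
      (g₁ := fun t => ∫ x in (-R)..R, cutoff R x * S.hessSq (x, t))
      (g₂ := fun t => ∫ x in (-(R + 1))..(R + 1), S.dens (x, t)) (g₃ := fun _ => 1) hT.le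
      (by fun_prop) (by fun_prop) (by fun_prop) (by fun_prop) fun t ht => by
        have i1 := hmain t ht
        have i2 : 0 ≤ ∫ s in (0:ℝ)..t,
            1 / (4 * k ^ 2) * (∫ x in (-R)..R, cutoff R x * S.hessSq (x, s)) :=
          intervalIntegral.integral_nonneg ht.1 fun s _ => mul_nonneg (by positivity) (hH s)
        have i3 := hU t ht
        have i4 : 4 / R * (∫ x in (-R)..R, S.gradSq (x, t))
            = 4 * ((∫ x in (-R)..R, S.gradSq (x, t)) / R) := by ring
        rw [gradSup, inv_one, i4]
        linarith [hQ t]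
    simp only [intervalIntegral.integral_const, smul_eq_mul] at h
    have i1 := hmain T (right_mem_Icc.2 hT.le)
    rw [intervalIntegral.integral_const_mul] at i1
    have i2 : 1 / (4 * k ^ 2) * (∫ t in (0:ℝ)..T, ∫ x in (-R)..R, cutoff R x * S.hessSq (x, t))
        ≤ Y := by linarith [hG T, hQ T]
    rw [div_mul_eq_mul_div, one_mul, div_le_iff₀ (by positivity)] at i2
    have i3 := hS.integral_dens_le (R + 1) (by linarith)
    linarith
  · have i1 := half_le_cutoff hR0 hx
    have i2 := S.cutoff_mul_gradSq_le_gradSup hR0 one_pos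
      (⟨by linarith [hx.1], by linarith [hx.2]⟩ : x ∈ Icc (-R) R) t
    have i3 := mul_le_mul_of_nonneg_right i1 (S.gradSq_nonneg (x, t))
    linarith

theorem θ_t_le_of_max {S : MHDFlow α β T} {k x t : ℝ} (hS : S.Controlled k)
    (ht : t ∈ Icc 0 T) (hx : S.θ.x (x, t) = 0) (hxx : S.θ.xx (x, t) ≤ 0)
    (hθ : 1 ≤ S.θ.f (x, t)) :
    S.θ.t (x, t) ≤ 2 * k ^ 2 * (1 + S.gradSq (x, t)) * S.θ.f (x, t) := by
  have hk := hS.one_le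
  have hv := S.v_pos (x, t)
  have hg := S.gradSq_nonneg (x, t)
  have hr0 : 0 ≤ (S.v (x, t))⁻¹ := by positivity
  have hrk := hS.inv_v_le x t ht
  have hp : 0 ≤ S.θ.f (x, t) ^ β / S.v (x, t) := (div_pos (S.pw_pos β (x, t)) hv).le
  have e : S.θ.t (x, t) = S.θ.f (x, t) ^ β / S.v (x, t) * S.θ.xx (x, t)
      + S.θ.f (x, t) * ((S.v (x, t))⁻¹ * -S.u.x (x, t)) + S.heat (x, t) := by
    rw [S.eq_θ, hx, heat, mu]
    ring
  have h1 := mul_nonpos_of_nonneg_of_nonpos hp hxx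
  have h2 : (S.v (x, t))⁻¹ * -S.u.x (x, t) ≤ k ^ 2 * (1 + S.gradSq (x, t)) := by
    have i1 := S.u_x_sq_le_gradSq (x, t)
    have i2 : -S.u.x (x, t) ≤ 1 + S.gradSq (x, t) := by
      linarith [sq_nonneg (S.u.x (x, t) + 1 / 2)]
    calc (S.v (x, t))⁻¹ * -S.u.x (x, t) ≤ (S.v (x, t))⁻¹ * (1 + S.gradSq (x, t)) := by gcongr
      _ ≤ k ^ 2 * (1 + S.gradSq (x, t)) := by
        gcongr
        nlinarith
  have h3 := mul_le_mul_of_nonneg_left h2 (by linarith : 0 ≤ S.θ.f (x, t))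
  have h4 := heat_le (x := x) hS ht
  have h5 : k ^ 2 * S.gradSq (x, t) ≤ k ^ 2 * (1 + S.gradSq (x, t)) * S.θ.f (x, t) := by
    calc k ^ 2 * S.gradSq (x, t) ≤ k ^ 2 * (1 + S.gradSq (x, t)) * 1 := by
          nlinarith
      _ ≤ _ := by gcongr
  rw [e]
  linarith

theorem exists_θ_upper_bound (hα : 0 ≤ α) (hβ : 0 < β) (hT : 0 < T) (K : ℝ) (hδ : 0 < δ)
    (hδ₁ : δ ≤ 1) : ∃ C, 0 < C ∧ ∀ S : MHDFlow α β T, S.Adm K δ → ∀ x, ∀ t ∈ Icc 0 T,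
      S.θ.f (x, t) ≤ C := by
  obtain ⟨k₀, hk₀⟩ := exists_controlled hα hβ hT K hδ hδ₁
  by_cases hk : 1 ≤ k₀
  swap
  · exact ⟨1, one_pos, fun S hA => absurd (hk₀ S hA).one_le hk⟩
  obtain ⟨C, hC, hJ⟩ := exists_gradSq_bound (β := β) (δ := δ) hα hT K k₀ hk
  refine ⟨(3 + 2 * K ^ 2) * Real.exp (3 * k₀ ^ 2 * (T + C)), by positivity, fun S hA => ?_⟩
  have hS := hk₀ S hA
  obtain ⟨R₀, hR₀⟩ := hJ S hA hS
  obtain ⟨R₁, hR₁⟩ := S.far 1 one_pos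
  obtain ⟨J, hJc, hJ0, hJi, hJg⟩ := hR₀ (max R₀ (2 * R₁)) (le_max_left _ _)
  have hR : R₁ ≤ max R₀ (2 * R₁) / 2 := by linarith [le_max_right R₀ (2 * R₁)]
  set lam : ℝ → ℝ := fun t =>
    (3 + 2 * K ^ 2) * Real.exp (∫ s in (0:ℝ)..t, 3 * k₀ ^ 2 * (1 + J s)) with hlam
  have hc : Continuous fun s => 3 * k₀ ^ 2 * (1 + J s) := by fun_prop
  have hderiv : ∀ t, HasDerivAt lam (3 * k₀ ^ 2 * (1 + J t) * lam t) t := fun t => by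
    refine (((hc.integral_hasStrictDerivAt 0 t).hasDerivAt.exp).const_mul _).congr_deriv ?_
    rw [hlam]
    ring
  have hlamc : Continuous lam := continuous_iff_continuousAt.2 fun t => (hderiv t).continuousAt
  have hlam2 : ∀ t, 0 ≤ t → 2 < lam t := fun t ht => by
    have h1 : 1 ≤ Real.exp (∫ s in (0:ℝ)..t, 3 * k₀ ^ 2 * (1 + J s)) :=
      Real.one_le_exp (intervalIntegral.integral_nonneg ht fun s _ => by
        have := hJ0 s
        positivity)
    simp only [hlam]
    nlinarith [sq_nonneg K]
  have hfar : ∀ x, ∀ t ∈ Icc 0 T, R₁ ≤ |x| → 0 < lam t - S.θ.f (x, t) := fun x t ht hx => by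
    have h1 := (abs_lt.1 (hR₁ (x, t) hx).2.2.1).2
    linarith [hlam2 t ht.1]
  have key : ∀ x, ∀ t ∈ Ico 0 T, 0 ≤ lam t - S.θ.f (x, t) := by
    refine nonneg_of_barrier (R := R₁) (f := fun x t => lam t - S.θ.f (x, t))
      (ft := fun x t => 3 * k₀ ^ 2 * (1 + J t) * lam t - S.θ.t (x, t)) (by fun_prop)
      (fun x => ?_) hfar (fun x t ht => (hderiv t).sub (S.θ.ht x t ht))
      fun x t ht h0 hmin => ?_
    · have h1 := hA.θ_le x
      simp only [hlam, intervalIntegral.integral_same, Real.exp_zero]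
      linarith
    · have ht' := Ioo_subset_Icc_self ht
      have hxR : |x| < R₁ := by
        by_contra! hx
        linarith [hfar x t ht' hx]
      obtain ⟨h1, h2⟩ := abs_lt.1 hxR
      have hl := hlam2 t ht'.1
      obtain ⟨hx0, hxx⟩ := deriv_eq_zero_and_nonneg_of_min (f := fun y => -S.θ.f (y, t))
        (fun y => (S.θ.hx y t).neg) (S.θ.hxx x t).neg (x := x) fun y => by linarith [hmin y]
      have h3 := θ_t_le_of_max hS ht' (neg_eq_zero.1 hx0) (by linarith) (by linarith)
      have h4 := hJg t ht' x ⟨by linarith, by linarith⟩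
      have hθ : S.θ.f (x, t) = lam t := by linarith
      rw [hθ] at h3
      have h5 : 2 * k₀ ^ 2 * (1 + S.gradSq (x, t)) * lam t ≤ 2 * k₀ ^ 2 * (1 + J t) * lam t := by
        gcongr
      have h6 : 0 < k₀ ^ 2 * (1 + J t) * lam t := by
        have := hJ0 t
        positivity
      linarith
  intro x t ht
  have h1 := nonneg_Icc_of_Ico (f := fun t => lam t - S.θ.f (x, t)) (by fun_prop) hT (key x) t ht
  have h2 : ∫ s in (0:ℝ)..t, 3 * k₀ ^ 2 * (1 + J s) ≤ 3 * k₀ ^ 2 * (T + C) :=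
    (intervalIntegral.integral_mono_interval le_rfl ht.1 ht.2 (Eventually.of_forall fun s => by
      have := hJ0 s
      positivity) (hc.intervalIntegrable _ _)).trans
      (integral_const_mul_one_add_le hJc (by positivity) hJi)
  refine (sub_nonneg.1 h1).trans ?_
  simp only [hlam]
  gcongr

end MHDFlow

end TemperatureUpper

/-- uniform upper bound for the temperature `θ`,
with a constant depending only on `T, α, β, K, δ`. -/
theorem temperature_upper_bound (α β T K δ : ℝ) (hα : 0 ≤ α) (hβ : 0 < β) (hT : 0 < T)
    (hK : 0 < K) (hδ₀ : 0 < δ) (hδ₁ : δ ≤ 1) :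
    ∃ C : ℝ, 0 < C ∧
      ∀ (v u θ : ℝ → ℝ → ℝ) (w b : ℝ → ℝ → ℝ × ℝ),
        IsClassicalSolution α β T v u θ w b → Admissible K δ v u θ w b →
        ∀ x : ℝ, ∀ t ∈ Icc (0:ℝ) T, θ x t ≤ C := by
  obtain ⟨C, hC, h⟩ := MHDFlow.exists_θ_upper_bound hα hβ hT K hδ₀ hδ₁
  exact ⟨C, hC, fun v u θ w b S hA x t ht =>
    (S.toFlow_θ hT x ht).symm.trans_le (h (S.toFlow hT) (S.adm_toFlow hT hA) x t ht)⟩
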